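/- Let k be an algebraically closed field of odd characteristic p with p ≡ 2 (mod 3), and let G = A_{p+2} be the alternating group on p+2 letters. Let G_0 be a subgroup of G having a normal p-subgroup G_1 with G_0/G_1 cyclic of order prime to p. Then G_0 occurs as the inertia group at a point over ∞ of some G-Galois cover of the projective line branched only at ∞ if and only if the conjugates of G_1 in G generate G. (Abhyankar's Inertia Conjecture holds for A_{p+2}, Muskat–Pries.) -/

import Mathlib

open scoped Polynomial

/-- The place at infinity of the rational function field `k(X)`: the valuation
subring `𝒪_∞ = {f/g : deg f ≤ deg g}`. -/
noncomputable def inftyPlace (k : Type) [Field k] : ValuationSubring (RatFunc k) :=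
  letI := Classical.decEq (RatFunc k)
  (FunctionField.inftyValuation k).valuationSubring

/-- The inertia group at a point (valuation subring) `O` of `L`, viewed as a
subgroup of the Galois group of `L/k(X)`: the subgroup of the stabilizer
(decomposition group) of `O` consisting of the elements acting trivially on the
residue field of `O`. -/
noncomputable def inertiaIn (k : Type) [Field k] {L : Type} [Field L]
    [Algebra (RatFunc k) L] (O : ValuationSubring L) : Subgroup (L ≃ₐ[RatFunc k] L) :=
  (O.inertiaSubgroup (RatFunc k)).map (O.decompositionSubgroup (RatFunc k)).subtype

/-- The subgroup `G₀` of `G` occurs as the inertia group at a point over `∞` of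
some `G`-Galois cover of the projective line over `k` branched only at `∞`. -/
def OccursAsInertiaAtInfty (k : Type) [Field k] (G : Type) [Group G]
    (G₀ : Subgroup G) : Prop :=
  ∃ (L : Type) (_ : Field L) (_ : Algebra (RatFunc k) L) (_ : Algebra (Polynomial k) L)
    (_ : IsScalarTower (Polynomial k) (RatFunc k) L),
    FiniteDimensional (RatFunc k) L ∧ IsGalois (RatFunc k) L ∧
    Algebra.Etale (Polynomial k) (integralClosure (Polynomial k) L) ∧
    ∃ (e : G ≃* (L ≃ₐ[RatFunc k] L)) (O : ValuationSubring L),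
      O.comap (algebraMap (RatFunc k) L) = inftyPlace k ∧
      Subgroup.map e.toMonoidHom G₀ = inertiaIn k O

section

open IsDedekindDomain

section LocalTheory

instance isGaloisGroup_integralClosure (A K L : Type*) [CommRing A] [IsDedekindDomain A] [Field K]
    [Field L] [Algebra A K] [IsFractionRing A K] [Algebra K L] [Algebra A L] [IsScalarTower A K L]
    [FiniteDimensional K L] [IsGalois K L] :
    IsGaloisGroup (L ≃ₐ[K] L) A (integralClosure A L) := by
  have : IsFractionRing (integralClosure A L) L :=
    integralClosure.isFractionRing_of_finite_extension K L
  exact IsGaloisGroup.of_isFractionRing (L ≃ₐ[K] L) A (integralClosure A L) K L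

theorem valuation_eq_exp_neg_card_inertia {A B G : Type*} (L : Type*) [CommRing A]
    [IsDedekindDomain A]
    [CommRing B] [IsDedekindDomain B] [Algebra A B] [Module.Finite A B] [Module.IsTorsionFree A B]
    [Group G] [Finite G] [MulSemiringAction G B] [IsGaloisGroup G A B]
    [Field L] [Algebra B L] [IsFractionRing B L]
    (v : HeightOneSpectrum B) (a : A) (ha : a ≠ 0) (hv : v.asIdeal.LiesOver (Ideal.span {a}))
    [(Ideal.span {a}).IsPrime] [PerfectField (Ideal.span {a}).ResidueField] :
    v.valuation L (algebraMap B L (algebraMap A B a)) =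
      WithZero.exp (-(Nat.card (v.asIdeal.inertia G) : ℤ)) := by
  have hinj := FaithfulSMul.algebraMap_injective A B
  have h0 : algebraMap A B a ≠ 0 := by simpa using (map_ne_zero_iff _ hinj).2 ha
  have := v.isPrime
  have hmap : (Ideal.span {a}).map (algebraMap A B) ≠ ⊥ := by
    rw [Ideal.map_span,
    Set.image_singleton]
    simpa using h0
  rw [HeightOneSpectrum.valuation_of_algebraMap, v.intValuation_eq_exp_neg_multiplicity h0,
    Ideal.card_inertia_eq_ramificationIdxIn (Ideal.span {a}) v.asIdeal,
    Ideal.ramificationIdxIn_eq_ramificationIdx _ v.asIdeal G,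
    Ideal.IsDedekindDomain.ramificationIdx_eq_multiplicity _ _ hmap, Ideal.map_span,
    Set.image_singleton]

theorem valuation_pow_card_inertia {A B G : Type*} (L : Type*) [CommRing A] [IsDedekindDomain A]
    [CommRing B] [IsDedekindDomain B] [Algebra A B] [Module.Finite A B] [Module.IsTorsionFree A B]
    [Group G] [Finite G] [MulSemiringAction G B] [IsGaloisGroup G A B]
    [Field L] [Algebra B L] [IsFractionRing B L]
    (v : HeightOneSpectrum B) (a : A) (ha : a ≠ 0) (hv : v.asIdeal.LiesOver (Ideal.span {a}))
    [(Ideal.span {a}).IsPrime] [PerfectField (Ideal.span {a}).ResidueField] (t : L) (ht : t ≠ 0) :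
    ∃ j : ℤ, v.valuation L t ^ Nat.card (v.asIdeal.inertia G) =
      v.valuation L (algebraMap B L (algebraMap A B a)) ^ j := by
  rw [valuation_eq_exp_neg_card_inertia (G := G) L v a ha hv]
  have h := (Valuation.ne_zero_iff (v.valuation L)).2 ht
  obtain ⟨n, hn⟩ := WithZero.ne_zero_iff_exists.1 h
  refine ⟨-(Multiplicative.toAdd n), ?_⟩
  rw [← WithZero.exp_zsmul, ← hn]
  have : (n : WithZero (Multiplicative ℤ)) = WithZero.exp (Multiplicative.toAdd n) := rfl
  rw [this, ← WithZero.exp_nsmul]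
  congr 1
  simp [mul_comm]

end LocalTheory

section InftyPlace

variable (k : Type) [Field k]

open scoped Classical in
theorem inftyPlace_eq : inftyPlace k = (RatFunc.inftyValuation k).valuationSubring := rfl

theorem mem_inftyPlace {r : RatFunc k} : r ∈ inftyPlace k ↔ r = 0 ∨ r.intDegree ≤ 0 := by
  classical
  have : r ∈ inftyPlace k ↔ RatFunc.inftyValuation k r ≤ 1 := by
    rw [inftyPlace_eq, Valuation.mem_valuationSubring_iff]
  rw [this, RatFunc.inftyValuation_apply]
  by_cases h : r = 0
  · simp [h, RatFunc.inftyValuationDef]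
  · rw [RatFunc.inftyValuation_of_nonzero k h, ← WithZero.exp_zero, WithZero.exp_le_exp]
    simp [h]

instance isDVR_inftyPlace : IsDiscreteValuationRing (inftyPlace k) := by
  classical
  rw [inftyPlace_eq]
  have : (RatFunc.inftyValuation k).IsRankOneDiscrete := by infer_instance
  infer_instance

/-- The constants, as elements of the place at infinity. -/
noncomputable def inftyConst : k →+* inftyPlace k :=
  (RatFunc.C).codRestrict (inftyPlace k).toSubring fun c => by
    change _ ∈ inftyPlace k
    rw [mem_inftyPlace]
    simp

/-- The uniformizer `1/X` at infinity. -/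
noncomputable def inftyUnif : inftyPlace k :=
  ⟨(RatFunc.X)⁻¹, by
    rw [mem_inftyPlace, RatFunc.intDegree_inv]
    simp⟩

theorem coe_inftyConst (c : k) : ((inftyConst k c : inftyPlace k) : RatFunc k) = RatFunc.C c := rfl

theorem coe_inftyUnif : ((inftyUnif k : inftyPlace k) : RatFunc k) = RatFunc.X⁻¹ := rfl

theorem inftyUnif_ne_zero : inftyUnif k ≠ 0 := by
  intro h
  have := congrArg (fun t : inftyPlace k => (t : RatFunc k)) h
  simp [coe_inftyUnif, RatFunc.X_ne_zero] at this

theorem mem_span_inftyUnif (y : inftyPlace k) :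
    y ∈ Ideal.span {inftyUnif k} ↔ (y : RatFunc k) = 0 ∨ (y : RatFunc k).intDegree < 0 := by
  rw [Ideal.mem_span_singleton']
  constructor
  · rintro ⟨b, rfl⟩
    by_cases hb : b = 0
    · simp [hb]
    have hb' : (b : RatFunc k) ≠ 0 := by simpa using hb
    right
    have := (mem_inftyPlace k).1 b.2
    push_cast [coe_inftyUnif]
    rw [RatFunc.intDegree_mul hb' (inv_ne_zero RatFunc.X_ne_zero), RatFunc.intDegree_inv,
      RatFunc.intDegree_X]
    have := this.resolve_left hb'
    omega
  · intro h
    by_cases hy : (y : RatFunc k) = 0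
    · exact ⟨0, by ext; simp [hy]⟩
    have h := h.resolve_left hy
    refine ⟨⟨RatFunc.X * (y : RatFunc k), ?_⟩, ?_⟩
    · rw [mem_inftyPlace, RatFunc.intDegree_mul RatFunc.X_ne_zero hy, RatFunc.intDegree_X]
      right; omega
    · ext
      push_cast [coe_inftyUnif]
      have := RatFunc.X_ne_zero (K := k)
      field_simp

theorem exists_sub_inftyConst_mem (y : inftyPlace k) :
    ∃ c : k, y - inftyConst k c ∈ Ideal.span {inftyUnif k} := by
  by_cases hy : (y : RatFunc k) = 0
  · exact ⟨0, by simp [mem_span_inftyUnif, hy]⟩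
  have h := ((mem_inftyPlace k).1 y.2).resolve_left hy
  by_cases h0 : (y : RatFunc k).intDegree < 0
  · exact ⟨0, by simp [mem_span_inftyUnif, h0]⟩
  have h0 : (y : RatFunc k).intDegree = 0 := by omega
  set f := (y : RatFunc k).num
  set g := (y : RatFunc k).denom
  have hf : f ≠ 0 := by simpa [f] using hy
  have hg : g ≠ 0 := RatFunc.denom_ne_zero _
  have hfg : f.natDegree = g.natDegree := by
    unfold RatFunc.intDegree at h0
    simp only [f, g]; omega
  have hgm : g.Monic := RatFunc.monic_denom _
  refine ⟨f.leadingCoeff, ?_⟩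
  rw [mem_span_inftyUnif]
  push_cast [coe_inftyConst]
  have e : (y : RatFunc k) - RatFunc.C f.leadingCoeff =
      algebraMap k[X] (RatFunc k) (f - Polynomial.C f.leadingCoeff * g) *
        (algebraMap k[X] (RatFunc k) g)⁻¹ := by
    have : (y : RatFunc k) = algebraMap k[X] (RatFunc k) f / algebraMap k[X] (RatFunc k) g :=
      (RatFunc.num_div_denom _).symm
    have hg' : algebraMap k[X] (RatFunc k) g ≠ 0 := by simpa using hg
    rw [this, map_sub, map_mul, RatFunc.algebraMap_C]
    field_simp
  by_cases hz : f - Polynomial.C f.leadingCoeff * g = 0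
  · left; rw [e, hz]; simp
  right
  have hg' : (algebraMap k[X] (RatFunc k) g)⁻¹ ≠ 0 := by simpa using hg
  have hz' : algebraMap k[X] (RatFunc k) (f - Polynomial.C f.leadingCoeff * g) ≠ 0 := by
    simpa [-map_sub] using hz
  rw [e, RatFunc.intDegree_mul hz' hg', RatFunc.intDegree_inv, RatFunc.intDegree_polynomial,
    RatFunc.intDegree_polynomial]
  have hd : (f - Polynomial.C f.leadingCoeff * g).degree < f.degree := by
    apply Polynomial.degree_sub_lt_left _ hf
    · simp [hgm.leadingCoeff]
    · rw [Polynomial.degree_C_mul (by simpa using hf), Polynomial.degree_eq_natDegree hf,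
        Polynomial.degree_eq_natDegree hg, hfg]
  have := Polynomial.natDegree_lt_natDegree hz hd
  omega

end InftyPlace

section ResidueField

theorem exists_sub_mem_of_isAlgClosed {k A B : Type*} [Field k] [IsAlgClosed k] [CommRing A]
    [CommRing B] [Algebra A B] [Algebra.IsIntegral A B] (ι : k →+* A) (p : Ideal A)
    (hres : ∀ a : A, ∃ c : k, a - ι c ∈ p) (P : Ideal B) [P.IsPrime] [P.LiesOver p] (b : B) :
    ∃ c : k, b - algebraMap A B (ι c) ∈ P := by
  have hle : p ≤ P.comap (algebraMap A B) := (Ideal.LiesOver.over (p := p) (P := P)).le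
  let f : A →+* B ⧸ P := (Ideal.Quotient.mk P).comp (algebraMap A B)
  have hf : f.IsIntegral := by
    apply RingHom.IsIntegral.trans
    · exact algebraMap_isIntegral_iff.2 inferInstance
    · exact RingHom.isIntegral_of_surjective _ Ideal.Quotient.mk_surjective
  let g : A ⧸ p →+* B ⧸ P := Ideal.quotientMap P (algebraMap A B) hle
  have hg : g.IsIntegral := by
    have : g.comp (Ideal.Quotient.mk p) = f := by ext; simp [g, f]
    exact RingHom.IsIntegral.tower_top (Ideal.Quotient.mk p) g (this ▸ hf)
  have hk : ((Ideal.Quotient.mk p).comp ι).IsIntegral := by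
    apply RingHom.isIntegral_of_surjective
    intro y
    obtain ⟨a, rfl⟩ := Ideal.Quotient.mk_surjective y
    obtain ⟨c, hc⟩ := hres a
    exact ⟨c, ((Ideal.Quotient.mk_eq_mk_iff_sub_mem _ _).2 hc).symm⟩
  have hint := hk.trans _ _ hg
  have hbij := IsAlgClosed.ringHom_bijective_of_isIntegral _ hint
  obtain ⟨c, hc⟩ := hbij.2 (Ideal.Quotient.mk P b)
  refine ⟨c, (Ideal.Quotient.mk_eq_mk_iff_sub_mem _ _).1 ?_⟩
  rw [← hc]
  simp [g]

theorem perfectField_residueField {k A : Type} [Field k] [IsAlgClosed k] [CommRing A]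
    (ι : k →+* A) (p : Ideal A) [hp : p.IsMaximal]
    (hres : ∀ a : A, ∃ c : k, a - ι c ∈ p) : PerfectField p.ResidueField := by
  let f : k →+* p.ResidueField := (algebraMap A p.ResidueField).comp ι
  have hf : Function.Bijective f := by
    refine ⟨f.injective, fun y => ?_⟩
    obtain ⟨z, rfl⟩ := (Ideal.bijective_algebraMap_quotient_residueField p).2 y
    obtain ⟨a, rfl⟩ := Ideal.Quotient.mk_surjective z
    obtain ⟨c, hc⟩ := hres a
    refine ⟨c, ?_⟩
    have := (Ideal.Quotient.mk_eq_mk_iff_sub_mem _ _).2 hc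
    rw [this, ← Ideal.Quotient.algebraMap_eq, ← IsScalarTower.algebraMap_apply]
    rfl
  have := IsAlgClosed.of_ringEquiv k p.ResidueField (RingEquiv.ofBijective f hf)
  infer_instance

end ResidueField

section InftyValuation

variable {k : Type} [Field k] {L : Type} [Field L] [Algebra (RatFunc k) L]

theorem mem_of_isIntegral_inftyPlace (O : ValuationSubring L)
    (hO : O.comap (algebraMap (RatFunc k) L) = inftyPlace k) (b : L)
    (hb : IsIntegral (inftyPlace k) b) : b ∈ O := by
  let φ : inftyPlace k →+* O :=
    ((algebraMap (RatFunc k) L).comp (inftyPlace k).subtype).codRestrict O.toSubring fun a =>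
      hO.ge a.2
  have h : IsIntegral O b := by
    obtain ⟨f, hf, hfb⟩ := hb
    refine ⟨f.map φ, hf.map φ, ?_⟩
    rw [Polynomial.eval₂_map]
    exact hfb
  obtain ⟨y, rfl⟩ := IsIntegrallyClosed.isIntegral_iff.1 h
  exact y.2

theorem algebraMap_mem_iff (O : ValuationSubring L)
    (hO : O.comap (algebraMap (RatFunc k) L) = inftyPlace k) (r : RatFunc k) :
    algebraMap (RatFunc k) L r ∈ O ↔ r = 0 ∨ r.intDegree ≤ 0 := by
  rw [← mem_inftyPlace, ← hO]; rfl

theorem valuation_algebraMap_lt_one_iff (O : ValuationSubring L)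
    (hO : O.comap (algebraMap (RatFunc k) L) = inftyPlace k) (r : RatFunc k) :
    O.valuation (algebraMap (RatFunc k) L r) < 1 ↔ r = 0 ∨ r.intDegree < 0 := by
  by_cases hr : r = 0
  · simp [hr]
  have hr' : algebraMap (RatFunc k) L r ≠ 0 := by simpa using hr
  have h := algebraMap_mem_iff O hO r⁻¹
  rw [← O.valuation_le_one_iff, map_inv₀, map_inv₀, RatFunc.intDegree_inv] at h
  have h2 : 0 < O.valuation (algebraMap (RatFunc k) L r) := by
    rw [zero_lt_iff]; simpa using hr
  rw [inv_le_one₀ h2] at h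
  rw [← not_le, h]
  simp [hr]

theorem exists_heightOneSpectrum_infty [FiniteDimensional (RatFunc k) L] [IsGalois (RatFunc k) L]
    [IsDedekindDomain (integralClosure (inftyPlace k) L)]
    [IsFractionRing (integralClosure (inftyPlace k) L) L]
    (O : ValuationSubring L) (hO : O.comap (algebraMap (RatFunc k) L) = inftyPlace k) :
    ∃ v : HeightOneSpectrum (integralClosure (inftyPlace k) L),
      (∀ b : integralClosure (inftyPlace k) L, b ∈ v.asIdeal ↔ O.valuation (b : L) < 1) ∧
      v.asIdeal.LiesOver (Ideal.span {inftyUnif k}) ∧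
      (v.valuation L).valuationSubring = O := by
  let φ : integralClosure (inftyPlace k) L →+* O :=
    (integralClosure (inftyPlace k) L).val.toRingHom.codRestrict O.toSubring
      fun b => mem_of_isIntegral_inftyPlace O hO b b.2
  let P := (IsLocalRing.maximalIdeal O).comap φ
  have hP : ∀ b, b ∈ P ↔ O.valuation (b : L) < 1 := fun b => by
    rw [Ideal.mem_comap]
    exact (O.valuation_lt_one_iff (φ b))
  have hover : P.LiesOver (Ideal.span {inftyUnif k}) := by
    constructor
    ext y
    rw [mem_span_inftyUnif, Ideal.mem_comap, hP]
    exact (valuation_algebraMap_lt_one_iff O hO (y : RatFunc k)).symm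
  have hne : P ≠ ⊥ := by
    intro h
    have h1 : algebraMap (inftyPlace k) (integralClosure (inftyPlace k) L) (inftyUnif k) ∈ P := by
      rw [hP]
      refine (valuation_algebraMap_lt_one_iff O hO (RatFunc.X)⁻¹).2 ?_
      simp [RatFunc.intDegree_inv]
    rw [h, Ideal.mem_bot] at h1
    have := congrArg (fun t : integralClosure (inftyPlace k) L => (t : L)) h1
    change algebraMap (RatFunc k) L ((RatFunc.X)⁻¹) = 0 at this
    simp [RatFunc.X_ne_zero] at this
  let v : HeightOneSpectrum (integralClosure (inftyPlace k) L) := ⟨P, inferInstance, hne⟩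
  refine ⟨v, hP, hover, ?_⟩
  apply ValuationSubring.eq_of_le_of_ne_top
  · intro t ht
    rw [Valuation.mem_valuationSubring_iff] at ht
    obtain ⟨n, d, hnd⟩ := v.exists_primeCompl_mul_eq_of_integer t ht
    have hd : O.valuation ((d : integralClosure (inftyPlace k) L) : L) = 1 := by
      apply le_antisymm
      · exact (O.valuation_le_one_iff _).2 (mem_of_isIntegral_inftyPlace O hO _ d.1.2)
      · exact not_lt.1 fun h => d.2 ((hP _).2 h)
    have hn := (O.valuation_le_one_iff _).2 (mem_of_isIntegral_inftyPlace O hO _ n.2)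
    rw [← O.valuation_le_one_iff]
    have := congrArg O.valuation hnd
    rw [map_mul] at this
    change _ * O.valuation ((d : integralClosure (inftyPlace k) L) : L) = _ at this
    rw [hd, mul_one] at this
    rw [this]; exact hn
  · intro h
    have : algebraMap (RatFunc k) L RatFunc.X ∈ O := by rw [h]; trivial
    rw [algebraMap_mem_iff O hO] at this
    simp [RatFunc.X_ne_zero] at this

end InftyValuation

section InftyInertia

open scoped Pointwise

variable {k : Type} [Field k] {L : Type} [Field L] [Algebra (RatFunc k) L]

theorem mem_inertiaIn_iff (O : ValuationSubring L) (σ : L ≃ₐ[RatFunc k] L) :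
    σ ∈ inertiaIn k O ↔ (∀ t, t ∈ O ↔ σ t ∈ O) ∧ ∀ t ∈ O, O.valuation (σ t - t) < 1 := by
  have hdec : σ ∈ O.decompositionSubgroup (RatFunc k) ↔ ∀ t, t ∈ O ↔ σ t ∈ O := by
    have h1 : σ ∈ O.decompositionSubgroup (RatFunc k) ↔ σ⁻¹ ∈ O.decompositionSubgroup (RatFunc k) :=
      (Subgroup.inv_mem_iff _).symm
    rw [h1, MulAction.mem_stabilizer_iff, SetLike.ext_iff]
    refine forall_congr' fun t => ?_
    rw [ValuationSubring.mem_inv_pointwise_smul_iff, AlgEquiv.smul_def]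
    exact Iff.comm
  unfold inertiaIn
  rw [Subgroup.mem_map]
  constructor
  · rintro ⟨τ, hτ, rfl⟩
    refine ⟨hdec.1 τ.2, fun t ht => ?_⟩
    have h := RingEquiv.congr_fun (MonoidHom.mem_ker.1 hτ) (IsLocalRing.residue O ⟨t, ht⟩)
    change IsLocalRing.residue O (τ • ⟨t, ht⟩) = IsLocalRing.residue O ⟨t, ht⟩ at h
    rw [← sub_eq_zero, ← map_sub, IsLocalRing.residue_eq_zero_iff, O.valuation_lt_one_iff] at h
    exact h
  · rintro ⟨h1, h2⟩
    refine ⟨⟨σ, hdec.2 h1⟩, ?_, rfl⟩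
    refine MonoidHom.mem_ker.2 (RingEquiv.ext fun y => ?_)
    obtain ⟨⟨t, ht⟩, rfl⟩ := IsLocalRing.residue_surjective y
    change IsLocalRing.residue O ((⟨σ, hdec.2 h1⟩ : O.decompositionSubgroup (RatFunc k)) • ⟨t, ht⟩)
      = IsLocalRing.residue O ⟨t, ht⟩
    rw [← sub_eq_zero, ← map_sub, IsLocalRing.residue_eq_zero_iff, O.valuation_lt_one_iff]
    exact h2 t ht

variable [IsAlgClosed k] [FiniteDimensional (RatFunc k) L] [IsGalois (RatFunc k) L]

theorem infty_package (O : ValuationSubring L)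
    (hO : O.comap (algebraMap (RatFunc k) L) = inftyPlace k) :
    (∀ t, O.valuation t ≤ 1 →
      ∃ c : k, O.valuation (t - algebraMap (RatFunc k) L (RatFunc.C c)) < 1) ∧
    (∀ t ≠ 0, ∃ j : ℤ, O.valuation t ^ Nat.card (inertiaIn k O) =
      O.valuation (algebraMap (RatFunc k) L RatFunc.X) ^ j) ∧
    (∀ σ : L ≃ₐ[RatFunc k] L, σ ∈ inertiaIn k O ↔ ∀ t, t ∈ O → σ t ∈ O) := by
  let A := inftyPlace k
  let B := integralClosure A L
  have : IsDedekindDomain B := integralClosure.isDedekindDomain A (RatFunc k) L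
  have : IsFractionRing B L := integralClosure.isFractionRing_of_finite_extension (RatFunc k) L
  have : Module.Finite A B := IsIntegralClosure.finite A (RatFunc k) L B
  obtain ⟨v, hP, hover, hvO⟩ := exists_heightOneSpectrum_infty O hO
  have hval : ∀ t, v.valuation L t ≤ 1 ↔ O.valuation t ≤ 1 := fun t => by
    rw [O.valuation_le_one_iff, ← hvO, Valuation.mem_valuationSubring_iff]
  have hval2 : ∀ t, v.valuation L t < 1 ↔ O.valuation t < 1 := fun t => by
    by_cases ht : t = 0
    · simp [ht]
    rw [← not_le, ← not_le, not_iff_not]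
    have h := hval t⁻¹
    rwa [map_inv₀, map_inv₀, inv_le_one₀, inv_le_one₀] at h <;>
    simpa [zero_lt_iff] using ht
  have hval3 : ∀ t, v.valuation L t = 1 ↔ O.valuation t = 1 := fun t => by
    rw [eq_iff_le_not_lt, eq_iff_le_not_lt, hval, hval2]
  have hV1 : ∀ t, O.valuation t ≤ 1 →
      ∃ c : k, O.valuation (t - algebraMap (RatFunc k) L (RatFunc.C c)) < 1 := by
    intro t ht
    have hPp := v.isPrime
    obtain ⟨n, d, hnd⟩ := v.exists_primeCompl_mul_eq_of_integer t ((hval t).2 ht)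
    obtain ⟨c, hc⟩ := exists_sub_mem_of_isAlgClosed (inftyConst k) _
      (exists_sub_inftyConst_mem k) v.asIdeal n
    obtain ⟨e, he⟩ := exists_sub_mem_of_isAlgClosed (inftyConst k) _
      (exists_sub_inftyConst_mem k) v.asIdeal (d : B)
    rw [hP] at hc he
    have hd : O.valuation ((d : B) : L) = 1 := by
      apply le_antisymm
      · exact (O.valuation_le_one_iff _).2 (mem_of_isIntegral_inftyPlace O hO _ d.1.2)
      · exact not_lt.1 fun h => d.2 ((hP _).2 h)
    let C : k → L := fun c => algebraMap (RatFunc k) L (RatFunc.C c)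
    change O.valuation (((d : B) : L) - C e) < 1 at he
    change O.valuation ((n : L) - C c) < 1 at hc
    change t * ((d : B) : L) = (n : L) at hnd
    have he0 : e ≠ 0 := by
      rintro rfl
      simp [C, hd] at he
    have hCe : O.valuation (C e) = 1 := by
      have : O.valuation (C e) = O.valuation (((d : B) : L) - (((d : B) : L) - C e)) := by ring_nf
      rw [this, Valuation.map_sub_eq_of_lt_left, hd]
      rwa [hd]
    have hCe0 : C e ≠ 0 := by intro h; simp [h] at hCe
    have hce : C (c / e) * C e = C c := by
      simp only [C, ← map_mul]; rw [div_mul_cancel₀ _ he0]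
    refine ⟨c / e, ?_⟩
    change O.valuation (t - C (c / e)) < 1
    have key : (t - C (c / e)) * C e = ((n : L) - C c) - t * (((d : B) : L) - C e) := by
      rw [sub_mul, hce, ← hnd]; ring
    have h2 := congrArg O.valuation key
    rw [map_mul, hCe, mul_one] at h2
    rw [h2]
    refine lt_of_le_of_lt (Valuation.map_sub _ _ _) (max_lt hc ?_)
    rw [map_mul]
    exact mul_lt_one_of_nonneg_of_lt_one_right ht (zero_le) he
  have hV3 : ∀ σ : L ≃ₐ[RatFunc k] L, σ ∈ inertiaIn k O ↔ ∀ t, t ∈ O → σ t ∈ O := by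
    intro σ
    rw [mem_inertiaIn_iff]
    refine ⟨fun h t ht => (h.1 t).1 ht, fun h => ?_⟩
    have hpow : ∀ n : ℕ, ∀ t, t ∈ O → (σ ^ n) t ∈ O := by
      intro n
      induction n with
      | zero => intro t ht; simpa using ht
      | succ n ih => intro t ht; rw [pow_succ']; exact h _ (ih t ht)
    have hinv : ∀ t, t ∈ O → σ.symm t ∈ O := by
      intro t ht
      have : σ⁻¹ = σ ^ (Nat.card (L ≃ₐ[RatFunc k] L) - 1) := by
        rw [inv_eq_iff_mul_eq_one, ← pow_succ', Nat.sub_add_cancel Nat.card_pos, pow_card_eq_one']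
      have h2 := hpow (Nat.card (L ≃ₐ[RatFunc k] L) - 1) t ht
      rw [← this] at h2
      exact h2
    have hiff : ∀ t, t ∈ O ↔ σ t ∈ O :=
      fun t => ⟨h t, fun ht => by simpa using hinv _ ht⟩
    refine ⟨hiff, fun t ht => ?_⟩
    obtain ⟨c, hc⟩ := hV1 t ((O.valuation_le_one_iff _).2 ht)
    have hlt : ∀ s, O.valuation s < 1 → O.valuation (σ s) < 1 := by
      intro s hs
      by_cases hs0 : s = 0
      · simp [hs0]
      rw [← not_le] at hs ⊢
      intro h1
      apply hs
      have h2 : σ s⁻¹ ∈ O := by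
        rw [← O.valuation_le_one_iff, map_inv₀, map_inv₀]
        exact inv_le_one_of_one_le₀ h1
      rw [← hiff, ← O.valuation_le_one_iff, map_inv₀, inv_le_one₀] at h2
      · exact h2
      · simpa [zero_lt_iff] using hs0
    have : σ t - t = σ (t - algebraMap (RatFunc k) L (RatFunc.C c)) -
        (t - algebraMap (RatFunc k) L (RatFunc.C c)) := by
      rw [map_sub, AlgEquiv.commutes]; ring
    rw [this]
    exact lt_of_le_of_lt (Valuation.map_sub _ _ _) (max_lt (hlt _ hc) hc)
  refine ⟨hV1, ?_, hV3⟩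
  have hinert : inertiaIn k O = v.asIdeal.inertia (L ≃ₐ[RatFunc k] L) := by
    ext σ
    constructor
    · intro hσ b
      rw [mem_inertiaIn_iff] at hσ
      rw [Submodule.mem_toAddSubgroup, hP]
      exact hσ.2 b (mem_of_isIntegral_inftyPlace O hO _ b.2)
    · intro hσ
      have hσ : ∀ b : B, O.valuation (σ b - b) < 1 := fun b => by
        have := hσ b
        rw [Submodule.mem_toAddSubgroup, hP] at this
        exact this
      rw [hV3]
      intro t ht
      obtain ⟨n, d, hnd⟩ := v.exists_primeCompl_mul_eq_of_integer t
        ((hval t).2 ((O.valuation_le_one_iff _).2 ht))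
      change t * ((d : B) : L) = (n : L) at hnd
      have hd : O.valuation ((d : B) : L) = 1 := by
        apply le_antisymm
        · exact (O.valuation_le_one_iff _).2 (mem_of_isIntegral_inftyPlace O hO _ d.1.2)
        · exact not_lt.1 fun h => d.2 ((hP _).2 h)
      have hσd : O.valuation (σ ((d : B) : L)) = 1 := by
        have : σ ((d : B) : L) = (d : B) - ((d : B) - σ ((d : B) : L)) := by ring
        rw [this, Valuation.map_sub_eq_of_lt_left, hd]
        rw [hd, Valuation.map_sub_swap]
        exact hσ d
      have hσn : O.valuation (σ (n : L)) ≤ 1 := by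
        have : σ (n : L) = (σ (n : L) - n) + n := by ring
        rw [this]
        exact (Valuation.map_add _ _ _).trans (max_le (hσ n).le
          ((O.valuation_le_one_iff _).2 (mem_of_isIntegral_inftyPlace O hO _ n.2)))
      have := congrArg (fun s => O.valuation (σ s)) hnd
      simp only [map_mul, hσd, mul_one] at this
      rw [← O.valuation_le_one_iff, this]
      exact hσn
  have hspan : Ideal.span {inftyUnif k} ≠ ⊥ := by simpa using inftyUnif_ne_zero k
  have hpr : (Ideal.span {inftyUnif k}).IsPrime := by
    rw [hover.over]
    exact v.isPrime.under _
  have hmax : (Ideal.span {inftyUnif k}).IsMaximal := hpr.isMaximal hspan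
  have := perfectField_residueField (inftyConst k) _ (exists_sub_inftyConst_mem k)
  intro t ht
  obtain ⟨j, hj⟩ := valuation_pow_card_inertia (G := L ≃ₐ[RatFunc k] L) L v (inftyUnif k)
    (inftyUnif_ne_zero k) hover t ht
  rw [← hinert] at hj
  refine ⟨-j, ?_⟩
  change _ = v.valuation L (algebraMap (RatFunc k) L RatFunc.X⁻¹) ^ j at hj
  have hX : algebraMap (RatFunc k) L RatFunc.X ≠ 0 := by simp [RatFunc.X_ne_zero]
  have h1 : v.valuation L (t ^ Nat.card (inertiaIn k O) *
      (algebraMap (RatFunc k) L RatFunc.X) ^ j) = 1 := by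
    rw [map_mul, map_pow, hj, map_inv₀, map_inv₀, map_zpow₀, inv_zpow, inv_mul_cancel₀]
    exact zpow_ne_zero _ (by simpa using hX)
  rw [hval3, map_mul, map_pow, map_zpow₀] at h1
  rw [zpow_neg]
  exact eq_inv_of_mul_eq_one_left h1

end InftyInertia

section PlacesOverInfty

theorem exists_place_over_infty (k : Type) [Field k] (L : Type) [Field L] [Algebra (RatFunc k) L]
    [FiniteDimensional (RatFunc k) L] [IsGalois (RatFunc k) L] :
    ∃ O : ValuationSubring L, O.comap (algebraMap (RatFunc k) L) = inftyPlace k := by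
  let A := inftyPlace k
  let B := integralClosure A L
  have : IsDedekindDomain B := integralClosure.isDedekindDomain A (RatFunc k) L
  have : IsFractionRing B L := integralClosure.isFractionRing_of_finite_extension (RatFunc k) L
  have hinj : Function.Injective (algebraMap A B) := fun a b h =>
    Subtype.ext ((algebraMap (RatFunc k) L).injective (congrArg (fun t : B => (t : L)) h))
  obtain ⟨P, hP, hPover⟩ := Ideal.exists_ideal_over_maximal_of_isIntegral (S := B)
    (IsLocalRing.maximalIdeal A) (by
      rw [(RingHom.injective_iff_ker_eq_bot _).1 hinj]; exact bot_le)
  have hne : P ≠ ⊥ := by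
    rintro rfl
    rw [← RingHom.ker_eq_comap_bot, (RingHom.injective_iff_ker_eq_bot _).1 hinj] at hPover
    exact IsDiscreteValuationRing.not_a_field A hPover.symm
  let v : HeightOneSpectrum B := ⟨P, hP.isPrime, hne⟩
  refine ⟨(v.valuation L).valuationSubring, ?_⟩
  symm
  apply ValuationSubring.eq_of_le_of_ne_top
  · intro a ha
    rw [ValuationSubring.mem_comap, Valuation.mem_valuationSubring_iff]
    exact v.valuation_le_one (algebraMap A B ⟨a, ha⟩)
  · intro h
    have h1 : RatFunc.X ∈ ((v.valuation L).valuationSubring).comap (algebraMap (RatFunc k) L) := by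
      rw [h]; trivial
    rw [ValuationSubring.mem_comap, Valuation.mem_valuationSubring_iff] at h1
    have h2 : v.valuation L (algebraMap B L (algebraMap A B (inftyUnif k))) < 1 := by
      rw [v.valuation_lt_one_iff_mem]
      change _ ∈ P.comap (algebraMap A B)
      rw [hPover, IsLocalRing.mem_maximalIdeal, mem_nonunits_iff]
      intro hu
      obtain ⟨u, hu⟩ := hu.exists_right_inv
      have h3 := congrArg (fun t : A => (t : RatFunc k)) hu
      have h4 := u.2
      have hX := RatFunc.X_ne_zero (K := k)
      push_cast [coe_inftyUnif] at h3
      have h5 : (u : RatFunc k) = RatFunc.X := by field_simp at h3; exact h3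
      rw [h5, mem_inftyPlace] at h4
      simp [RatFunc.X_ne_zero] at h4
    change v.valuation L (algebraMap (RatFunc k) L (RatFunc.X⁻¹)) < 1 at h2
    rw [map_inv₀, map_inv₀] at h2
    have h0 : v.valuation L (algebraMap (RatFunc k) L RatFunc.X) ≠ 0 := by
      simp [RatFunc.X_ne_zero]
    have := (inv_lt_one₀ (zero_lt_iff.2 h0)).1 h2
    exact absurd h1 (not_le.2 this)

end PlacesOverInfty

section FinitePlaces

variable {k : Type} [Field k] [IsAlgClosed k] {L : Type} [Field L] [Algebra (RatFunc k) L]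
  [Algebra k[X] L] [IsScalarTower k[X] (RatFunc k) L]
  [FiniteDimensional (RatFunc k) L] [IsGalois (RatFunc k) L]

omit [IsAlgClosed k] in
theorem sub_C_eval_mem_span (c : k) (f : k[X]) :
    f - Polynomial.C (f.eval c) ∈ Ideal.span {Polynomial.X - Polynomial.C c} := by
  rw [Ideal.mem_span_singleton, Polynomial.dvd_iff_isRoot]
  simp

instance isMaximal_span_X_sub_C (c : k) :
    (Ideal.span {(Polynomial.X - Polynomial.C c : k[X])}).IsMaximal :=
  PrincipalIdealRing.isMaximal_of_irreducible (Polynomial.irreducible_X_sub_C c)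

instance perfectField_residueField_span_X_sub_C (c : k) :
    PerfectField (Ideal.span {(Polynomial.X - Polynomial.C c : k[X])}).ResidueField :=
  perfectField_residueField (Polynomial.C : k →+* k[X]) _
    fun f => ⟨f.eval c, sub_C_eval_mem_span c f⟩

instance isDedekindDomain_integralClosure_polynomial :
    IsDedekindDomain (integralClosure k[X] L) :=
  integralClosure.isDedekindDomain k[X] (RatFunc k) L

instance finite_integralClosure_polynomial : Module.Finite k[X] (integralClosure k[X] L) :=
  IsIntegralClosure.finite k[X] (RatFunc k) L _

instance isFractionRing_integralClosure_polynomial : IsFractionRing (integralClosure k[X] L) L :=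
  integralClosure.isFractionRing_of_finite_extension (RatFunc k) L

omit [IsAlgClosed k] [FiniteDimensional (RatFunc k) L] [IsGalois (RatFunc k) L] in
theorem algebraMap_integralClosure_injective :
    Function.Injective (algebraMap k[X] (integralClosure k[X] L)) := by
  intro a b h
  have h := congrArg (fun t : integralClosure k[X] L => (t : L)) h
  change algebraMap k[X] L a = algebraMap k[X] L b at h
  rw [IsScalarTower.algebraMap_apply k[X] (RatFunc k) L,
    IsScalarTower.algebraMap_apply k[X] (RatFunc k) L] at h
  exact RatFunc.algebraMap_injective k ((algebraMap (RatFunc k) L).injective h)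

instance isTorsionFree_integralClosure_polynomial :
    Module.IsTorsionFree k[X] (integralClosure k[X] L) := by
  rw [Module.isTorsionFree_iff_faithfulSMul, faithfulSMul_iff_algebraMap_injective]
  exact algebraMap_integralClosure_injective

omit [Algebra (RatFunc k) L] [IsScalarTower k[X] (RatFunc k) L]
  [FiniteDimensional (RatFunc k) L] [IsGalois (RatFunc k) L] in
theorem exists_liesOver_span_X_sub_C (P : Ideal (integralClosure k[X] L)) [hP : P.IsPrime]
    (h0 : P ≠ ⊥) : ∃ c : k, P.LiesOver (Ideal.span {(Polynomial.X - Polynomial.C c : k[X])}) := by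
  have hne : P.under k[X] ≠ ⊥ := by
    intro h
    exact h0 (Ideal.eq_bot_of_comap_eq_bot h)
  have hpr : (P.under k[X]).IsPrime := inferInstance
  obtain ⟨f, hf⟩ := IsPrincipalIdealRing.principal (P.under k[X])
  rw [Ideal.submodule_span_eq] at hf
  have hf0 : f ≠ 0 := by rintro rfl; simp at hf; exact hne hf
  have hirr : Irreducible f := by
    rw [hf, Ideal.span_singleton_prime hf0] at hpr
    exact hpr.irreducible
  obtain ⟨c, hc⟩ := IsAlgClosed.exists_root f (by
    rw [Polynomial.degree_eq_natDegree hf0]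
    have := hirr.natDegree_pos
    exact_mod_cast this.ne')
  refine ⟨c, ⟨?_⟩⟩
  have hdvd := Polynomial.dvd_iff_isRoot.2 hc
  have hassoc := (Polynomial.irreducible_X_sub_C c).associated_of_dvd hirr hdvd
  rw [hf]
  exact (Ideal.span_singleton_eq_span_singleton.2 hassoc)

omit [IsAlgClosed k] [FiniteDimensional (RatFunc k) L] [IsGalois (RatFunc k) L] in
theorem exists_heightOneSpectrum_over (c : k) :
    ∃ v : HeightOneSpectrum (integralClosure k[X] L),
      v.asIdeal.LiesOver (Ideal.span {(Polynomial.X - Polynomial.C c : k[X])}) := by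
  have hinj := algebraMap_integralClosure_injective (k := k) (L := L)
  obtain ⟨P, hP, hPover⟩ := Ideal.exists_ideal_over_maximal_of_isIntegral
    (S := integralClosure k[X] L) (Ideal.span {(Polynomial.X - Polynomial.C c : k[X])}) (by
      rw [(RingHom.injective_iff_ker_eq_bot _).1 hinj]; exact bot_le)
  have hne : P ≠ ⊥ := by
    rintro rfl
    rw [← RingHom.ker_eq_comap_bot, (RingHom.injective_iff_ker_eq_bot _).1 hinj, eq_comm,
      Ideal.span_singleton_eq_bot] at hPover
    exact Polynomial.X_sub_C_ne_zero c hPover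
  exact ⟨⟨P, hP.isPrime, hne⟩, ⟨hPover.symm⟩⟩

omit [IsAlgClosed k] in
theorem isUnramifiedAt_bot_integralClosure :
    Algebra.IsUnramifiedAt k[X] (⊥ : Ideal (integralClosure k[X] L)) := by
  have h1 : IsFractionRing (integralClosure k[X] L)
      (Localization.AtPrime (⊥ : Ideal (integralClosure k[X] L))) := by
    simpa [Ideal.primeCompl_bot] using
      Localization.isLocalization (M := (⊥ : Ideal (integralClosure k[X] L)).primeCompl)
  have h2 : Algebra.FormallyUnramified k[X] (RatFunc k) :=
    Algebra.FormallyUnramified.of_isLocalization (nonZeroDivisors k[X])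
  have h3 : Algebra.FormallyUnramified (RatFunc k) L :=
    Algebra.FormallyUnramified.of_isSeparable _ _
  have h4 : Algebra.FormallyUnramified k[X] L :=
    Algebra.FormallyUnramified.comp k[X] (RatFunc k) L
  exact Algebra.FormallyUnramified.of_equiv
    ((IsLocalization.algEquiv (nonZeroDivisors (integralClosure k[X] L)) L
      (Localization.AtPrime (⊥ : Ideal (integralClosure k[X] L)))).restrictScalars k[X])

theorem etale_of_inertia_trivial
    (h : ∀ v : HeightOneSpectrum (integralClosure k[X] L), ∀ σ : L ≃ₐ[RatFunc k] L,
      (∀ b, σ • b - b ∈ v.asIdeal) → σ = 1) :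
    Algebra.Etale k[X] (integralClosure k[X] L) := by
  have hunr : Algebra.FormallyUnramified k[X] (integralClosure k[X] L) := by
    rw [Algebra.formallyUnramified_iff_forall]
    rintro ⟨P, hP⟩
    change Algebra.IsUnramifiedAt k[X] P
    by_cases h0 : P = ⊥
    · subst h0
      exact isUnramifiedAt_bot_integralClosure
    · let v : HeightOneSpectrum (integralClosure k[X] L) := ⟨P, hP, h0⟩
      obtain ⟨c, hc⟩ := exists_liesOver_span_X_sub_C P h0
      have : PerfectField (P.under k[X]).ResidueField := by
        have : (P.under k[X]).IsMaximal := hc.over ▸ isMaximal_span_X_sub_C c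
        exact perfectField_residueField (Polynomial.C : k →+* k[X]) _
          fun f => ⟨f.eval c, hc.over ▸ sub_C_eval_mem_span c f⟩
      rw [← Ideal.ramificationIdx_eq_one_iff,
        ← Ideal.ramificationIdxIn_eq_ramificationIdx (P.under k[X]) P (L ≃ₐ[RatFunc k] L),
        ← Ideal.card_inertia_eq_ramificationIdxIn (G := L ≃ₐ[RatFunc k] L) (P.under k[X]) P,
        Subgroup.card_eq_one, Subgroup.eq_bot_iff_forall]
      exact fun σ hσ => h v σ hσ
  have : Algebra.FinitePresentation k[X] (integralClosure k[X] L) :=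
    Algebra.FinitePresentation.of_finiteType.1 inferInstance
  exact Algebra.Etale.of_formallyUnramified_of_flat

theorem valuation_X_sub_C_of_etale [Algebra.Etale k[X] (integralClosure k[X] L)]
    (v : HeightOneSpectrum (integralClosure k[X] L)) (c : k)
    (hv : v.asIdeal.LiesOver (Ideal.span {(Polynomial.X - Polynomial.C c : k[X])})) :
    v.valuation L (algebraMap k[X] L (Polynomial.X - Polynomial.C c)) = WithZero.exp (-1 : ℤ) := by
  have := v.isPrime
  have h := valuation_eq_exp_neg_card_inertia (G := L ≃ₐ[RatFunc k] L) L v _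
    (Polynomial.X_sub_C_ne_zero c) hv
  rw [Ideal.card_inertia_eq_ramificationIdxIn
      (Ideal.span {(Polynomial.X - Polynomial.C c : k[X])}) v.asIdeal,
    Ideal.ramificationIdxIn_eq_ramificationIdx _ v.asIdeal (L ≃ₐ[RatFunc k] L),
    Ideal.ramificationIdx_eq_one] at h
  exact h

end FinitePlaces

theorem valuation_le_valuation_sum {F Γ ι : Type*} [Field F] [LinearOrderedCommGroupWithZero Γ]
    (v : Valuation F Γ) (s : Finset ι) (f : ι → F)
    (h : ∀ i ∈ s, ∀ j ∈ s, f i ≠ 0 → v (f i) = v (f j) → i = j) :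
    ∀ i ∈ s, v (f i) ≤ v (∑ j ∈ s, f j) := by
  classical
  intro i hi
  obtain ⟨m, hm, hmax⟩ := s.exists_max_image (fun j => v (f j)) ⟨i, hi⟩
  refine (hmax i hi).trans ?_
  by_cases h0 : f m = 0
  · simp [h0]
  rw [v.map_sum_eq_of_lt hm]
  intro j hj
  simp only [Finset.mem_sdiff, Finset.mem_singleton] at hj
  exact lt_of_le_of_ne (hmax j hj.1) fun e => hj.2 (h m hm j hj.1 h0 e.symm).symm

theorem comp_X_add_C_mem_lifts {R S : Type*} [CommRing R] [CommRing S] (f : R →+* S) {q : S[X]}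
    (hq : q ∈ Polynomial.lifts f) {r : S} (hr : r ∈ f.range) :
    q.comp (Polynomial.X + Polynomial.C r) ∈ Polynomial.lifts f := by
  obtain ⟨Q, rfl⟩ := (Polynomial.mem_lifts _).1 hq
  obtain ⟨a, rfl⟩ := hr
  exact (Polynomial.mem_lifts _).2 ⟨Q.comp (Polynomial.X + Polynomial.C a), by
    rw [Polynomial.map_comp, Polynomial.map_add, Polynomial.map_X, Polynomial.map_C]⟩

section Frobenius

variable {k : Type} [Field k] [IsAlgClosed k] {L : Type} [Field L] [Algebra (RatFunc k) L]
  [Algebra.IsSeparable (RatFunc k) L] (p : ℕ) [Fact p.Prime] [CharP L p]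

/-- Every element of a separable extension of `k(x)` is a polynomial of degree less than `p` in
`x` with coefficients which are `p`-th powers. -/
theorem exists_polynomial_frobenius_coeff (y : L) : ∃ q : L[X], q.natDegree < p ∧
    q ∈ Polynomial.lifts (frobenius L p).fieldRange.subtype ∧
    q.eval (algebraMap (RatFunc k) L RatFunc.X) = y := by
  have hp : p.Prime := Fact.out
  set x := algebraMap (RatFunc k) L RatFunc.X with hx
  let F := (frobenius L p).fieldRange
  have hF : ∀ t : L, t ^ p ∈ F := fun t => ⟨t, rfl⟩
  have : CharP F p := (algebraMap F L).charP (algebraMap F L).injective p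
  have hpi : IsPurelyInseparable F L := by
    rw [isPurelyInseparable_iff_pow_mem F p]
    exact fun t => ⟨1, ⟨t ^ p, hF t⟩, by simp; rfl⟩
  let E := IntermediateField.adjoin F {x}
  have hmem : ∀ r : RatFunc k, algebraMap (RatFunc k) L r ∈ E := by
    have hpoly : ∀ f : k[X], algebraMap (RatFunc k) L (algebraMap k[X] (RatFunc k) f) ∈ E := by
      intro f
      induction f using Polynomial.induction_on' with
      | add f g hf hg => rw [map_add, map_add]; exact add_mem hf hg
      | monomial n a =>
        rw [← Polynomial.C_mul_X_pow_eq_monomial, map_mul, map_mul, map_pow, map_pow]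
        refine mul_mem ?_ (pow_mem ?_ n)
        · obtain ⟨b, hb⟩ := IsAlgClosed.exists_pow_nat_eq a hp.pos
          rw [← hb, map_pow, map_pow, map_pow]
          exact E.algebraMap_mem ⟨_, hF _⟩
        · rw [RatFunc.algebraMap_X]
          exact IntermediateField.mem_adjoin_simple_self F x
    intro r
    induction r using RatFunc.induction_on with
    | f a b hb => rw [map_div₀]; exact div_mem (hpoly a) (hpoly b)
  let φ : RatFunc k →+* E := (algebraMap (RatFunc k) L).codRestrict E hmem
  let : Algebra (RatFunc k) E := φ.toAlgebra
  have : IsScalarTower (RatFunc k) E L := IsScalarTower.of_algebraMap_eq fun r => rfl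
  have hsep : Algebra.IsSeparable E L :=
    Algebra.isSeparable_tower_top_of_isSeparable (RatFunc k) E L
  have hpi' : IsPurelyInseparable E L := IsPurelyInseparable.tower_top F E L
  obtain ⟨⟨e, he⟩, hey⟩ := IsPurelyInseparable.surjective_algebraMap_of_isSeparable E L y
  have hint : IsIntegral F x := ⟨Polynomial.X ^ p - Polynomial.C ⟨x ^ p, hF x⟩,
    Polynomial.monic_X_pow_sub_C _ hp.ne_zero, by simp; exact sub_self _⟩
  have he' : e ∈ (IntermediateField.adjoin F {x}).toSubalgebra := he
  rw [IntermediateField.adjoin_simple_toSubalgebra_of_isAlgebraic hint.isAlgebraic,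
    Algebra.adjoin_singleton_eq_range_aeval] at he'
  obtain ⟨q, hq⟩ := he'
  have hq' : Polynomial.aeval x q = y := hq.trans hey
  let P : F[X] := Polynomial.X ^ p - Polynomial.C ⟨x ^ p, hF x⟩
  have hP : P.Monic := Polynomial.monic_X_pow_sub_C _ hp.ne_zero
  have hPx : Polynomial.aeval x P = 0 := by simp [P]; exact sub_self _
  refine ⟨(q %ₘ P).map F.subtype, ?_, (Polynomial.mem_lifts _).2 ⟨_, rfl⟩, ?_⟩
  · rw [Polynomial.natDegree_map]
    have := Polynomial.natDegree_modByMonic_lt q hP (by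
      intro h
      have := Polynomial.natDegree_X_pow_sub_C (n := p) (r := (⟨x ^ p, hF x⟩ : F))
      rw [show (Polynomial.X ^ p - Polynomial.C (⟨x ^ p, hF x⟩ : F)) = 1 from h] at this
      simp at this; exact hp.ne_zero this.symm)
    rwa [show P.natDegree = p from Polynomial.natDegree_X_pow_sub_C] at this
  · rw [Polynomial.eval_map]
    have := Polynomial.aeval_modByMonic_eq_self_of_root (p := q) hPx
    rw [Polynomial.aeval_def] at this
    exact this.trans hq'

end Frobenius

section Tame

variable {k : Type} [Field k] [IsAlgClosed k] {L : Type} [Field L] [Algebra (RatFunc k) L]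
  [Algebra k[X] L] [IsScalarTower k[X] (RatFunc k) L]
  [FiniteDimensional (RatFunc k) L] [IsGalois (RatFunc k) L]
  [Algebra.Etale k[X] (integralClosure k[X] L)] (p : ℕ) [Fact p.Prime] [CharP L p]

theorem frobenius_coeff_mem_integralClosure {y : L} (hy : y ∈ integralClosure k[X] L) {q : L[X]}
    (hdeg : q.natDegree < p) (hq : q ∈ Polynomial.lifts (frobenius L p).fieldRange.subtype)
    (hqy : q.eval (algebraMap (RatFunc k) L RatFunc.X) = y) (i : ℕ) (b : L)
    (hb : q.coeff i = b ^ p) : b ∈ integralClosure k[X] L := by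
  have hp : p.Prime := Fact.out
  obtain ⟨b', hb'⟩ : b ∈ (algebraMap (integralClosure k[X] L) L).range := by
    refine HeightOneSpectrum.mem_integers_of_valuation_le_one L b fun w => ?_
    obtain ⟨c, hc⟩ := exists_liesOver_span_X_sub_C w.asIdeal w.ne_bot
    have := w.isPrime
    set v := w.valuation L
    have hvx := valuation_X_sub_C_of_etale (L := L) w c hc
    set x := algebraMap (RatFunc k) L RatFunc.X with hx
    set d := algebraMap k[X] L (Polynomial.C c) with hd
    have hxd : algebraMap k[X] L (Polynomial.X - Polynomial.C c) = x - d := by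
      rw [map_sub, IsScalarTower.algebraMap_apply k[X] (RatFunc k) L Polynomial.X,
        RatFunc.algebraMap_X]
    rw [hxd] at hvx
    have hdF : d ∈ (frobenius L p).fieldRange.subtype.range := by
      obtain ⟨e, he⟩ := IsAlgClosed.exists_pow_nat_eq c hp.pos
      refine ⟨⟨d, ⟨algebraMap k[X] L (Polynomial.C e), ?_⟩⟩, rfl⟩
      rw [frobenius_def, ← map_pow, ← map_pow, he]
    have hdv : v d ≤ 1 := by
      have : v (algebraMap (integralClosure k[X] L) L (algebraMap k[X] _ (Polynomial.C c))) ≤ 1 :=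
        w.valuation_le_one _
      exact this
    let Q := q.comp (Polynomial.X + Polynomial.C d)
    have hQF : Q ∈ Polynomial.lifts (frobenius L p).fieldRange.subtype :=
      comp_X_add_C_mem_lifts _ hq hdF
    have hQdeg : Q.natDegree < p := by
      simp only [Q, Polynomial.natDegree_comp, Polynomial.natDegree_X_add_C, mul_one]
      exact hdeg
    have hQy : Q.eval (x - d) = y := by simp [Q, hqy]
    have hcoeff : ∀ l, ∃ t, Q.coeff l = t ^ p := fun l => by
      obtain ⟨⟨_, t, rfl⟩, ht⟩ := (Polynomial.lifts_iff_coeff_lifts Q).1 hQF l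
      exact ⟨t, ht.symm⟩
    have hyv : v y ≤ 1 := w.valuation_le_one (⟨y, hy⟩ : integralClosure k[X] L)
    rw [Polynomial.eval_eq_sum_range' hQdeg] at hQy
    have hQv : ∀ l, v (Q.coeff l) ≤ 1 := by
      intro l
      by_cases hl : l < p
      swap
      · rw [Polynomial.coeff_eq_zero_of_natDegree_lt (hQdeg.trans_le (not_lt.1 hl))]; simp
      obtain ⟨t, ht⟩ := hcoeff l
      by_cases h0 : t = 0
      · simp [ht, h0, hp.ne_zero]
      have hexp : ∀ (t : L) (l : ℕ), t ≠ 0 → v (t ^ p * (x - d) ^ l) =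
          WithZero.exp (WithZero.log (v t) * p - l : ℤ) := by
        intro t l h0
        have : v t = WithZero.exp (WithZero.log (v t)) :=
          (WithZero.exp_log ((Valuation.ne_zero_iff v).2 h0)).symm
        rw [map_mul, map_pow, map_pow, hvx, this, ← WithZero.exp_nsmul, ← WithZero.exp_nsmul,
          ← WithZero.exp_add]
        congr 1
        simp; ring
      have key := valuation_le_valuation_sum v (Finset.range p) (fun l => Q.coeff l * (x - d) ^ l)
        (by
          intro i hi j hj hi0 hij
          obtain ⟨a, ha⟩ := hcoeff i
          obtain ⟨b, hb⟩ := hcoeff j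
          have hj0 : Q.coeff j * (x - d) ^ j ≠ 0 := by
            rw [← Valuation.ne_zero_iff v, ← hij]
            exact (Valuation.ne_zero_iff v).2 hi0
          rw [ha] at hij hi0
          rw [hb] at hij hj0
          rw [hexp _ _ (by rintro rfl; simp [hp.ne_zero] at hi0),
            hexp _ _ (by rintro rfl; simp [hp.ne_zero] at hj0), WithZero.exp_inj] at hij
          have h1 : (p : ℤ) ∣ (i : ℤ) - j :=
            ⟨WithZero.log (v a) - WithZero.log (v b), by linarith⟩
          rw [Finset.mem_range] at hi hj
          obtain ⟨s, hs⟩ := h1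
          have : s = 0 := by
            by_contra hs0
            rcases lt_or_gt_of_ne hs0 with h | h <;> nlinarith
          subst this
          lia) l (Finset.mem_range.2 hl)
      rw [hQy] at key
      have key := key.trans hyv
      simp only [ht] at key ⊢
      rw [hexp _ _ h0, ← WithZero.exp_zero, WithZero.exp_le_exp] at key
      have hle : WithZero.log (v t) ≤ 0 := by
        by_contra h
        push Not at h
        nlinarith
      rw [map_pow]
      refine pow_le_one₀ zero_le ?_
      rw [← WithZero.exp_log ((Valuation.ne_zero_iff v).2 h0), ← WithZero.exp_zero,
        WithZero.exp_le_exp]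
      exact hle
    have hQl : Q ∈ Polynomial.lifts v.integer.subtype := by
      rw [Polynomial.lifts_iff_coeff_lifts]
      exact fun l => ⟨⟨Q.coeff l, hQv l⟩, rfl⟩
    have hql : q ∈ Polynomial.lifts v.integer.subtype := by
      have := comp_X_add_C_mem_lifts v.integer.subtype hQl (r := -d)
        ⟨⟨-d, by rw [Valuation.mem_integer_iff, Valuation.map_neg]; exact hdv⟩, rfl⟩
      have hX : (Polynomial.X + Polynomial.C d).comp (Polynomial.X + Polynomial.C (-d)) =
        Polynomial.X := by simp
      rwa [Polynomial.comp_assoc, hX, Polynomial.comp_X] at this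
    obtain ⟨⟨t, ht⟩, ht'⟩ := (Polynomial.lifts_iff_coeff_lifts q).1 hql i
    have ht' : t = q.coeff i := ht'
    rw [Valuation.mem_integer_iff, ht', hb, map_pow] at ht
    exact (pow_le_one_iff hp.ne_zero).1 ht
  rw [← hb']
  exact b'.2

theorem mem_range_of_pole_le (O : ValuationSubring L)
    (hO : O.comap (algebraMap (RatFunc k) L) = inftyPlace k)
    (hI : ¬ p ∣ Nat.card (inertiaIn k O)) (N : ℕ) : ∀ y ∈ integralClosure k[X] L,
    (∀ σ : L ≃ₐ[RatFunc k] L, O.valuation (σ y) ^ Nat.card (inertiaIn k O) ≤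
      O.valuation (algebraMap (RatFunc k) L RatFunc.X) ^ N) →
    ∃ f : k[X], algebraMap k[X] L f = y := by
  classical
  have hp : p.Prime := Fact.out
  obtain ⟨hV1, hV2, -⟩ := infty_package O hO
  have hlt := valuation_algebraMap_lt_one_iff O hO
  set D := Nat.card (inertiaIn k O) with hD
  have hD0 : D ≠ 0 := Nat.card_pos.ne'
  set x := algebraMap (RatFunc k) L RatFunc.X with hx
  set v := O.valuation with hv
  have hx1 : 1 < v x := by
    rw [← not_le, hv, O.valuation_le_one_iff, algebraMap_mem_iff O hO, not_or]
    exact ⟨RatFunc.X_ne_zero, by simp⟩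
  have hx0 : v x ≠ 0 := (zero_lt_one.trans hx1).ne'
  induction N using Nat.strong_induction_on with
  | _ N ih =>
    intro y hy hyN
    by_cases hN : N = 0
    · subst hN
      simp only [pow_zero, pow_le_one_iff hD0] at hyN
      obtain ⟨c, hc⟩ := hV1 y (hyN 1)
      have hCc : algebraMap (RatFunc k) L (RatFunc.C c) = algebraMap k[X] L (Polynomial.C c) := by
        rw [IsScalarTower.algebraMap_apply k[X] (RatFunc k) L, RatFunc.algebraMap_C]
      have hcO : v (algebraMap (RatFunc k) L (RatFunc.C c)) ≤ 1 := by
        rw [hv, O.valuation_le_one_iff, algebraMap_mem_iff O hO]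
        exact Or.inr (by simp)
      set z := y - algebraMap (RatFunc k) L (RatFunc.C c) with hz
      have hzint : IsIntegral k[X] z := by
        rw [hz, hCc]
        exact hy.sub isIntegral_algebraMap
      obtain ⟨f, hf⟩ := IsIntegrallyClosed.isIntegral_iff.1
        (Algebra.isIntegral_norm (RatFunc k) hzint)
      have hnorm := Algebra.norm_eq_prod_automorphisms (RatFunc k) z
      have hvn : v (algebraMap (RatFunc k) L (Algebra.norm (RatFunc k) z)) < 1 := by
        rw [hnorm, map_prod, ← Finset.mul_prod_erase _ _ (Finset.mem_univ 1)]
        refine mul_lt_one_of_lt_of_le hc (Finset.prod_le_one (fun _ _ => zero_le) fun σ _ => ?_)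
        rw [hz, map_sub, AlgEquiv.commutes]
        exact v.map_sub_le (hyN σ) hcO
      rw [hlt, ← hf] at hvn
      have hz0 : Algebra.norm (RatFunc k) z = 0 := by
        rcases hvn with h | h
        · rw [← hf, h]
        · rw [RatFunc.intDegree_polynomial] at h
          lia
      rw [Algebra.norm_eq_zero_iff, hz, sub_eq_zero] at hz0
      exact ⟨Polynomial.C c, by rw [hz0, hCc]⟩
    · obtain ⟨q, hdeg, hq, hqy⟩ := exists_polynomial_frobenius_coeff (k := k) p y
      have hcoeff : ∀ l, ∃ t, q.coeff l = t ^ p := fun l => by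
        obtain ⟨⟨_, t, rfl⟩, ht⟩ := (Polynomial.lifts_iff_coeff_lifts q).1 hq l
        exact ⟨t, ht.symm⟩
      have hsum := hqy
      rw [Polynomial.eval_eq_sum_range' hdeg] at hsum
      have hjexp : ∀ (t : L) (l : ℕ) (j : ℤ), v t ^ D = v x ^ j →
          v (t ^ p * x ^ l) ^ D = v x ^ (p * j + D * l : ℤ) := by
        intro t l j h
        rw [map_mul, map_pow, map_pow, mul_pow, ← pow_mul, mul_comm p D, pow_mul, h,
          zpow_add₀ hx0, mul_comm (p : ℤ), zpow_mul, ← zpow_natCast, ← pow_mul, mul_comm (D : ℤ),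
          zpow_mul, zpow_natCast, zpow_natCast, pow_mul]
        simp
      have hbound : ∀ l < p, ∀ t, q.coeff l = t ^ p → ∀ σ : L ≃ₐ[RatFunc k] L,
          v (σ t) ^ D ≤ v x ^ (N / p) := by
        intro l hl t ht σ
        by_cases ht0 : t = 0
        · simp [ht0, hD0]
        have hsum' : ∑ i ∈ Finset.range p, σ (q.coeff i) * x ^ i = σ y := by
          rw [← hsum, map_sum]
          refine Finset.sum_congr rfl fun i _ => ?_
          rw [map_mul, map_pow, hx, AlgEquiv.commutes]
        have key := valuation_le_valuation_sum v (Finset.range p)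
          (fun l => σ (q.coeff l) * x ^ l) (by
            intro i hi j hj hi0 hij
            obtain ⟨a, ha⟩ := hcoeff i
            obtain ⟨b, hb⟩ := hcoeff j
            have hj0 : σ (q.coeff j) * x ^ j ≠ 0 := by
              rw [← Valuation.ne_zero_iff v, ← hij]
              exact (Valuation.ne_zero_iff v).2 hi0
            rw [ha, map_pow] at hij hi0
            rw [hb, map_pow] at hij hj0
            obtain ⟨ja, hja⟩ := hV2 (σ a) (by intro h; simp [h, hp.ne_zero] at hi0)
            obtain ⟨jb, hjb⟩ := hV2 (σ b) (by intro h; simp [h, hp.ne_zero] at hj0)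
            have hij := congrArg (· ^ D) hij
            rw [hjexp _ _ _ hja, hjexp _ _ _ hjb] at hij
            have hij := zpow_right_injective₀ (zero_lt_one.trans hx1) hx1.ne' hij
            have h1 : (p : ℤ) ∣ D * ((i : ℤ) - j) := ⟨jb - ja, by linarith⟩
            have h2 := (Int.Prime.dvd_mul' hp h1).resolve_left
              (fun h => hI (Int.natCast_dvd_natCast.1 h))
            rw [Finset.mem_range] at hi hj
            obtain ⟨s, hs⟩ := h2
            have : s = 0 := by
              by_contra hs0
              rcases lt_or_gt_of_ne hs0 with h | h <;> nlinarith
            subst this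
            lia) l (Finset.mem_range.2 hl)
        rw [hsum'] at key
        simp only [ht, map_pow σ] at key
        obtain ⟨j, hj⟩ := hV2 (σ t) (by simpa using ht0)
        have key := (pow_le_pow_left₀ zero_le key D).trans (hyN σ)
        rw [hjexp _ _ _ hj, ← zpow_natCast, zpow_le_zpow_iff_right₀ hx1] at key
        rw [hj, ← zpow_natCast, zpow_le_zpow_iff_right₀ hx1]
        push_cast
        rw [Int.le_ediv_iff_mul_le (by exact_mod_cast hp.pos)]
        have : (0 : ℤ) ≤ D * l := by positivity
        linarith
      have hpoly : ∀ l < p, ∃ f : k[X], algebraMap k[X] L f = q.coeff l := by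
        intro l hl
        obtain ⟨t, ht⟩ := hcoeff l
        obtain ⟨f, hf⟩ := ih (N / p) (Nat.div_lt_self (Nat.pos_of_ne_zero hN) hp.one_lt) t
          (frobenius_coeff_mem_integralClosure p hy hdeg hq hqy l t ht) (hbound l hl t ht)
        exact ⟨f ^ p, by rw [map_pow, hf, ht]⟩
      choose! f hf using hpoly
      refine ⟨∑ l ∈ Finset.range p, f l * Polynomial.X ^ l, ?_⟩
      rw [← hsum, map_sum]
      refine Finset.sum_congr rfl fun l hl => ?_
      rw [map_mul, hf l (Finset.mem_range.1 hl), map_pow,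
        IsScalarTower.algebraMap_apply k[X] (RatFunc k) L Polynomial.X, RatFunc.algebraMap_X]

theorem card_galois_eq_one_of_tame (O : ValuationSubring L)
    (hO : O.comap (algebraMap (RatFunc k) L) = inftyPlace k)
    (hI : ¬ p ∣ Nat.card (inertiaIn k O)) : Subsingleton (L ≃ₐ[RatFunc k] L) := by
  have hmain : ∀ y ∈ integralClosure k[X] L, ∃ f : k[X], algebraMap k[X] L f = y := by
    intro y hy
    obtain ⟨-, hV2, -⟩ := infty_package O hO
    have hx1 : 1 < O.valuation (algebraMap (RatFunc k) L RatFunc.X) := by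
      rw [← not_le, O.valuation_le_one_iff, algebraMap_mem_iff O hO, not_or]
      exact ⟨RatFunc.X_ne_zero, by simp⟩
    by_cases hy0 : y = 0
    · exact ⟨0, by simp [hy0]⟩
    choose j hj using fun σ : L ≃ₐ[RatFunc k] L => hV2 (σ y) (by simpa using hy0)
    refine mem_range_of_pole_le p O hO hI (∑ σ, (j σ).toNat) y hy fun σ => ?_
    rw [hj, ← zpow_natCast, zpow_le_zpow_iff_right₀ hx1]
    have h1 := Finset.single_le_sum (f := fun σ => (j σ).toNat) (fun _ _ => Nat.zero_le _)
      (Finset.mem_univ σ)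
    have h2 := Int.self_le_toNat (j σ)
    have h3 : ((j σ).toNat : ℤ) ≤ ((∑ σ, (j σ).toNat : ℕ) : ℤ) := by exact_mod_cast h1
    exact h2.trans h3
  refine ⟨fun σ τ => AlgEquiv.ext fun t => ?_⟩
  obtain ⟨a, b, hb, rfl⟩ := IsFractionRing.div_surjective (A := integralClosure k[X] L) t
  obtain ⟨f, hf⟩ := hmain a a.2
  obtain ⟨g, hg⟩ := hmain b b.2
  change σ ((a : L) / b) = τ ((a : L) / b)
  rw [← hf, ← hg, IsScalarTower.algebraMap_apply k[X] (RatFunc k) L,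
    IsScalarTower.algebraMap_apply k[X] (RatFunc k) L, ← map_div₀, AlgEquiv.commutes,
    AlgEquiv.commutes]

end Tame

section CoverPoly

open Polynomial

/-- The polynomial `δ (T ^ (p + 2) + T ^ 2) + T ^ 4 + 8 T ^ 3 + 16 T - 4 - t T ^ 2`. -/
noncomputable def coverPoly {A : Type*} [CommRing A] (p : ℕ) (δ t : A) : A[X] :=
  C δ * (X ^ (p + 2) + X ^ 2) + X ^ 4 + 8 * X ^ 3 + 16 * X - 4 - C t * X ^ 2

/-- The polynomial `T ^ 2 + 2 T - 2` whose roots are the critical points of the cover. -/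
noncomputable def critPoly (A : Type*) [CommRing A] : A[X] := X ^ 2 + 2 * X - 2

section CommRing

variable {A : Type*} [CommRing A] (p : ℕ) (δ t : A)

theorem coverPoly_map {A' : Type*} [CommRing A'] (φ : A →+* A') :
    (coverPoly p δ t).map φ = coverPoly p (φ δ) (φ t) := by
  simp [coverPoly]

theorem critPoly_map {A' : Type*} [CommRing A'] (φ : A →+* A') :
    (critPoly A).map φ = critPoly A' := by
  simp [critPoly]

theorem eval_coverPoly (u : A) : (coverPoly p δ t).eval u =
    δ * (u ^ (p + 2) + u ^ 2) + u ^ 4 + 8 * u ^ 3 + 16 * u - 4 - t * u ^ 2 := by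
  simp [coverPoly]

theorem eval_critPoly (u : A) : (critPoly A).eval u = u ^ 2 + 2 * u - 2 := by
  simp [critPoly]

theorem coverPoly_eq_sub : coverPoly p δ t = coverPoly p δ 0 - C t * X ^ 2 := by
  simp [coverPoly]

theorem X_mul_derivative_coverPoly [CharP A p] :
    X * derivative (coverPoly p δ t) - 2 * coverPoly p δ t = 2 * critPoly A ^ 2 := by
  have hp : (C (p : A) : A[X]) = 0 := by simp
  have h8 : derivative (8 : A[X]) = 0 := derivative_ofNat 8
  have h16 : derivative (16 : A[X]) = 0 := derivative_ofNat 16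
  have h4 : derivative (4 : A[X]) = 0 := derivative_ofNat 4
  simp only [coverPoly, critPoly, derivative_sub, derivative_add, derivative_mul, derivative_C,
    derivative_X_pow, derivative_X, h8, h16, h4]
  push_cast
  simp only [map_add, hp]
  simp only [map_ofNat]
  ring

theorem natDegree_coverPoly [Nontrivial A] [NoZeroDivisors A] (hp : 3 ≤ p) (hδ : δ ≠ 0) :
    (coverPoly p δ t).natDegree = p + 2 ∧ (coverPoly p δ t).leadingCoeff = δ := by
  have h : coverPoly p δ t = C δ * X ^ (p + 2) +
      (C δ * X ^ 2 + X ^ 4 + C 8 * X ^ 3 + C 16 * X - C 4 - C t * X ^ 2) := by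
    rw [coverPoly]
    simp only [map_ofNat]
    ring
  have hd : (C δ * X ^ 2 + X ^ 4 + C 8 * X ^ 3 + C 16 * X - C 4 - C t * X ^ 2 : A[X]).degree <
      (C δ * X ^ (p + 2) : A[X]).degree := by
    rw [degree_C_mul_X_pow _ hδ]
    refine lt_of_le_of_lt (b := ((4 : ℕ) : WithBot ℕ)) ?_ (by exact_mod_cast (by lia : 4 < p + 2))
    compute_degree
    exact le_rfl
  constructor
  · apply natDegree_eq_of_degree_eq_some
    rw [h, degree_add_eq_left_of_degree_lt hd, degree_C_mul_X_pow _ hδ]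
  · rw [h, leadingCoeff_add_of_degree_lt' hd, leadingCoeff_C_mul_X_pow]

end CommRing

theorem coverPoly_ne_zero {A : Type*} [Field A] {p : ℕ} (hp : 3 ≤ p) {δ t : A} (hδ : δ ≠ 0) :
    coverPoly p δ t ≠ 0 := by
  intro h
  have := (natDegree_coverPoly p δ t hp hδ).1
  rw [h] at this
  simp at this

/-- The parameters `κ, δ` for which the cover with polynomial `coverPoly p δ t` has triple
ramification at the roots `-1 ± κ` of `critPoly`. -/
structure CoverParam {A : Type*} [Field A] (p : ℕ) (δ κ : A) : Prop where
  sq_eq : κ ^ 2 = 3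
  mul_pow_eq : δ * κ ^ (p - 1) = -12

theorem natCast_ne_zero_of_lt {A : Type*} [Field A] {p : ℕ} [CharP A p] {n : ℕ}
    (hn0 : n ≠ 0) (hn : n < p) : (n : A) ≠ 0 := by
  rw [ne_eq, CharP.cast_eq_zero_iff A p]
  exact fun h => hn0 (Nat.eq_zero_of_dvd_of_lt h hn)

section Factor

variable {A : Type*} [Field A] {p : ℕ} {δ κ : A}

theorem CoverParam.map (h : CoverParam p δ κ) {A' : Type*} [Field A'] (φ : A →+* A') :
    CoverParam p (φ δ) (φ κ) :=
  ⟨by rw [← map_pow, h.sq_eq, map_ofNat], by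
    rw [← map_pow, ← map_mul, h.mul_pow_eq, map_neg, map_ofNat]⟩

theorem CoverParam.eval_critPoly_eq_zero (h : CoverParam p δ κ) :
    (critPoly A).eval (-1 + κ) = 0 := by
  rw [eval_critPoly]
  linear_combination h.sq_eq

theorem CoverParam.neg [hpp : Fact p.Prime] (h : CoverParam p δ κ) (hp : 5 ≤ p) :
    CoverParam p δ (-κ) := by
  refine ⟨by rw [neg_sq, h.sq_eq], ?_⟩
  have : Even (p - 1) := hpp.out.even_sub_one (by lia)
  rw [this.neg_pow, h.mul_pow_eq]

theorem CoverParam.critPoly_eq (h : CoverParam p δ κ) :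
    critPoly A = (X - C (-1 + κ)) * (X - C (-1 + -κ)) := by
  have h1 : (C κ : A[X]) ^ 2 = 3 := by rw [← C_pow, h.sq_eq, map_ofNat]
  rw [critPoly]
  simp only [map_add, map_neg, map_one]
  linear_combination h1

theorem derivative_critPoly : derivative (critPoly A) = 2 * (X + 1) := by
  simp only [critPoly, derivative_sub, derivative_add, derivative_mul, derivative_X_pow,
    derivative_X, derivative_ofNat]
  simp only [Nat.cast_ofNat, map_ofNat]
  ring

theorem critPoly_ne_zero : critPoly A ≠ 0 := by
  have : (critPoly A).natDegree = 2 := by rw [critPoly]; compute_degree!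
  intro h
  simp [h] at this

variable [CharP A p]

theorem two_ne_zero_of_lt (hp : 3 ≤ p) : (2 : A) ≠ 0 := by
  exact_mod_cast natCast_ne_zero_of_lt (A := A) (p := p) two_ne_zero (by lia : 2 < p)

theorem CoverParam.three_ne_zero (hp : 5 ≤ p) : (3 : A) ≠ 0 := by
  exact_mod_cast natCast_ne_zero_of_lt (A := A) (p := p) (n := 3) (by norm_num) (by lia)

theorem CoverParam.kappa_ne_zero (h : CoverParam p δ κ) (hp : 5 ≤ p) : κ ≠ 0 := by
  rintro rfl
  have := h.sq_eq
  rw [zero_pow two_ne_zero] at this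
  exact CoverParam.three_ne_zero (A := A) (p := p) hp this.symm

theorem CoverParam.delta_ne_zero (h : CoverParam p δ κ) (hp : 5 ≤ p) : δ ≠ 0 := by
  rintro rfl
  have h1 := h.mul_pow_eq
  have h2 := two_ne_zero_of_lt (A := A) (p := p) (by lia)
  have h3 := CoverParam.three_ne_zero (A := A) (p := p) hp
  rw [zero_mul] at h1
  have : (2 : A) * 2 * 3 = 0 := by linear_combination h1
  simp [h2, h3] at this

theorem isCoprime_critPoly_X (hp : 3 ≤ p) : IsCoprime (critPoly A) X := by
  have h2 := two_ne_zero_of_lt (A := A) (p := p) hp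
  refine ⟨-C (2⁻¹), C (2⁻¹) * (X + 2), ?_⟩
  have : (C (2⁻¹) : A[X]) * 2 = 1 := by
    rw [← map_ofNat C, ← C_mul, inv_mul_cancel₀ h2, C_1]
  rw [critPoly]
  linear_combination this

theorem isCoprime_critPoly_X_add_one (hp : 5 ≤ p) : IsCoprime (critPoly A) (X + 1) := by
  have h3 := CoverParam.three_ne_zero (A := A) (p := p) hp
  refine ⟨-C (3⁻¹), C (3⁻¹) * (X + 1), ?_⟩
  have : (C (3⁻¹) : A[X]) * 3 = 1 := by
    rw [← map_ofNat C, ← C_mul, inv_mul_cancel₀ h3, C_1]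
  rw [critPoly]
  linear_combination this

variable [hpp : Fact p.Prime]

theorem CoverParam.eval_coverPoly_zero_eq_zero (h : CoverParam p δ κ) :
    (coverPoly p δ 0).eval (-1 + κ) = 0 := by
  have h1 := h.sq_eq
  have hpow : (-1 + κ) ^ p = -1 + κ * κ ^ (p - 1) := by
    rw [add_pow_expChar, ← pow_succ', Nat.sub_add_cancel hpp.out.one_le]
    have : (1 + -1 : A) ^ p = 1 ^ p + (-1) ^ p := add_pow_expChar (R := A) (p := p) 1 (-1)
    rw [add_neg_cancel, zero_pow hpp.out.ne_zero, one_pow] at this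
    linear_combination -this
  rw [eval_coverPoly, pow_add, hpow]
  have h2 := h.mul_pow_eq
  linear_combination κ * (-1 + κ) ^ 2 * h2 + (κ ^ 2 - 8 * κ + 9) * h1

theorem CoverParam.exists_factor (h : CoverParam p δ κ) (hp : 5 ≤ p) :
    ∃ R : A[X], coverPoly p δ 0 = critPoly A ^ 3 * R ∧ IsCoprime (critPoly A) R := by
  have h2 := two_ne_zero_of_lt (A := A) (p := p) (by lia)
  have hc2 : (C (2⁻¹) : A[X]) * 2 = 1 := by
    rw [← map_ofNat C, ← C_mul, inv_mul_cancel₀ h2, C_1]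
  have hκ := h.kappa_ne_zero hp
  have hcp : IsCoprime (X - C (-1 + κ)) (X - C (-1 + -κ)) := by
    apply isCoprime_X_sub_C_of_isUnit_sub
    rw [isUnit_iff_ne_zero]
    intro h'
    have : (2 : A) * κ = 0 := by linear_combination h'
    simp [h2, hκ] at this
  have h1 : critPoly A ∣ coverPoly p δ 0 := by
    rw [h.critPoly_eq]
    exact hcp.mul_dvd (dvd_iff_isRoot.2 h.eval_coverPoly_zero_eq_zero)
      (dvd_iff_isRoot.2 (h.neg hp).eval_coverPoly_zero_eq_zero)
  have hcop : IsCoprime (critPoly A) (X * (X + 1)) :=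
    (isCoprime_critPoly_X (p := p) (by lia)).mul_right (isCoprime_critPoly_X_add_one (p := p) hp)
  have hid := X_mul_derivative_coverPoly p δ 0
  have hd := derivative_critPoly (A := A)
  have h0 := critPoly_ne_zero (A := A)
  obtain ⟨Q, hQ⟩ := h1
  have hQ2 : critPoly A ∣ Q := by
    refine hcop.dvd_of_dvd_mul_left ⟨C (2⁻¹) * (2 * Q + 2 * critPoly A - X * derivative Q), ?_⟩
    rw [hQ, derivative_mul, hd] at hid
    linear_combination C (2⁻¹) * hid - X * (X + 1) * Q * hc2
  obtain ⟨S, rfl⟩ := hQ2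
  have hQ3 : critPoly A ∣ S := by
    refine hcop.dvd_of_dvd_mul_left ⟨C (2⁻¹) * C (2⁻¹) * (2 * S + 2 - X * derivative S), ?_⟩
    rw [hQ, derivative_mul, derivative_mul, hd] at hid
    apply mul_left_cancel₀ h0
    linear_combination C (2⁻¹) * C (2⁻¹) * hid -
      X * (X + 1) * critPoly A * S * (1 + C 2⁻¹ * 2) * hc2
  obtain ⟨R, rfl⟩ := hQ3
  refine ⟨R, by rw [hQ]; ring, C (2⁻¹) * (X * derivative R - 2 * R),
    C (2⁻¹) * (6 * X * (X + 1)), ?_⟩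
  rw [hQ, derivative_mul, derivative_mul, derivative_mul, hd] at hid
  apply mul_left_cancel₀ h0
  apply mul_left_cancel₀ h0
  linear_combination C (2⁻¹) * hid + critPoly A ^ 2 * hc2

end Factor

end CoverPoly

section CoverRoots

open Polynomial

/-- The family `r` lists the roots of `coverPoly p δ t` with multiplicity. -/
structure CoverFactor {L : Type*} [Field L] (p : ℕ) (δ κ t : L) (r : Fin (p + 2) → L) : Prop where
  param : CoverParam p δ κ
  eq_prod : coverPoly p δ t = C δ * ∏ i, (X - C (r i))

/-- The family `r` lists the roots of `coverPoly p δ t`, where `t ≠ 0`. -/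
structure CoverRoots {L : Type*} [Field L] (p : ℕ) (δ κ t : L) (r : Fin (p + 2) → L) : Prop
    extends CoverFactor p δ κ t r where
  t_ne_zero : t ≠ 0

namespace CoverFactor

variable {L : Type*} [Field L] {p : ℕ} {δ κ t : L} {r : Fin (p + 2) → L}

theorem eval_eq_prod (H : CoverFactor p δ κ t r) (u : L) :
    (coverPoly p δ t).eval u = δ * ∏ i, (u - r i) := by
  rw [H.eq_prod]
  simp [eval_prod]

theorem eval_root (H : CoverFactor p δ κ t r) (i) : (coverPoly p δ t).eval (r i) = 0 := by
  rw [H.eval_eq_prod, Finset.prod_eq_zero (Finset.mem_univ i) (sub_self _), mul_zero]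

theorem root_eq (H : CoverFactor p δ κ t r) (i) :
    δ * (r i ^ (p + 2) + r i ^ 2) + r i ^ 4 + 8 * r i ^ 3 + 16 * r i - 4 = t * r i ^ 2 := by
  have h := H.eval_root i
  rw [eval_coverPoly] at h
  linear_combination h

theorem eval_zero_root (H : CoverFactor p δ κ t r) (i) :
    (coverPoly p δ 0).eval (r i) = t * r i ^ 2 := by
  rw [eval_coverPoly]
  linear_combination H.root_eq i

variable [CharP L p]

theorem exists_root_eq (H : CoverFactor p δ κ t r) (hp : 5 ≤ p) {u : L}
    (hu : (coverPoly p δ t).eval u = 0) : ∃ i, u = r i := by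
  rw [H.eval_eq_prod, mul_eq_zero, Finset.prod_eq_zero_iff] at hu
  obtain ⟨i, -, hi⟩ := hu.resolve_left (H.param.delta_ne_zero hp)
  exact ⟨i, sub_eq_zero.1 hi⟩

omit [CharP L p] in
theorem four_eq (H : CoverFactor p δ κ t r) (hodd : Odd p) : δ * ∏ i, r i = 4 := by
  have h := H.eval_eq_prod 0
  have h2 : Odd (p + 2) := hodd.add_even even_two
  rw [eval_coverPoly] at h
  simp only [zero_sub, Finset.prod_neg, Finset.card_univ, Fintype.card_fin, h2.neg_one_pow] at h
  rw [zero_pow (by lia), zero_pow (by lia)] at h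
  linear_combination h

theorem root_ne_zero (H : CoverFactor p δ κ t r) (hp : 5 ≤ p) (i) : r i ≠ 0 := by
  intro h
  have h1 := H.root_eq i
  have h2 := two_ne_zero_of_lt (A := L) (p := p) (by lia)
  rw [h] at h1
  have : (2 : L) * 2 = 0 := by
    rw [zero_pow (by lia)] at h1
    linear_combination -h1
  simp [h2] at this

theorem root_mul_prod (H : CoverFactor p δ κ t r) (i) :
    r i * (δ * ∏ j ∈ Finset.univ.erase i, (r i - r j)) = 2 * (critPoly L).eval (r i) ^ 2 := by
  have h := congrArg (eval (r i)) (X_mul_derivative_coverPoly p δ t)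
  rw [eval_sub, eval_mul, eval_mul, H.eval_root, eval_mul, eval_pow, H.eq_prod,
    derivative_C_mul, eval_C_mul] at h
  have h2 := Lagrange.eval_nodal_derivative_eval_node_eq (v := r) (Finset.mem_univ i)
  rw [Lagrange.nodal, Lagrange.eval_nodal] at h2
  rw [h2] at h
  simpa using h

theorem eval_critPoly_eq_zero_of_eq (H : CoverFactor p δ κ t r) (hp : 5 ≤ p) {i j} (hij : i ≠ j)
    (h : r i = r j) : (critPoly L).eval (r i) = 0 := by
  have h1 := H.root_mul_prod i
  rw [Finset.prod_eq_zero (i := j) (by simp [hij.symm]) (by rw [h, sub_self]), mul_zero,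
    mul_zero] at h1
  have h2 := two_ne_zero_of_lt (A := L) (p := p) (by lia)
  simpa [h2] using h1.symm

variable [hpp : Fact p.Prime]

theorem exists_eval_critPoly_eq_zero (H : CoverFactor p δ κ 0 r) (hp : 5 ≤ p) :
    ∃ i, (critPoly L).eval (r i) = 0 := by
  obtain ⟨i, hi⟩ := H.exists_root_eq hp H.param.eval_coverPoly_zero_eq_zero
  exact ⟨i, hi ▸ H.param.eval_critPoly_eq_zero⟩

open Classical in
theorem card_eval_critPoly_eq_zero_le (H : CoverFactor p δ κ 0 r) (hp : 5 ≤ p) :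
    (Finset.univ.filter fun i => (critPoly L).eval (r i) = 0).card ≤ 6 := by
  obtain ⟨R, hR, hcop⟩ := H.param.exists_factor hp
  have hδ := H.param.delta_ne_zero hp
  have h0 : critPoly L ^ 3 * R ≠ 0 := hR ▸ coverPoly_ne_zero (by lia) hδ
  have hroots : (coverPoly p δ 0).roots = Finset.univ.val.map r := by
    rw [H.eq_prod, roots_C_mul _ hδ, ← roots_multiset_prod_X_sub_C (Finset.univ.val.map r),
      Multiset.map_map]
    rfl
  have hcard : (Finset.univ.filter fun i => (critPoly L).eval (r i) = 0).card =
      Multiset.card ((coverPoly p δ 0).roots.filter fun u => (critPoly L).eval u = 0) := by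
    rw [hroots, Multiset.filter_map, Multiset.card_map]
    rfl
  have hR0 : R.roots.filter (fun u => (critPoly L).eval u = 0) = 0 := by
    rw [Multiset.filter_eq_nil]
    intro u hu hu'
    obtain ⟨a, b, hab⟩ := hcop
    have h1 := congrArg (eval u) hab
    rw [eval_add, eval_mul, eval_mul, hu', (mem_roots'.1 hu).2] at h1
    simp at h1
  rw [hcard, hR, roots_mul h0, roots_pow, Multiset.filter_add, hR0, add_zero]
  refine (Multiset.card_le_card (Multiset.filter_le _ _)).trans ?_
  rw [Multiset.card_nsmul]
  have hdeg : (critPoly L).natDegree ≤ 2 := by rw [critPoly]; compute_degree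
  have := (card_roots' (critPoly L)).trans hdeg
  lia

end CoverFactor

namespace CoverRoots

variable {L : Type*} [Field L] {p : ℕ} {δ κ t : L} {r : Fin (p + 2) → L} [hpp : Fact p.Prime]
  [CharP L p]

theorem eval_critPoly_root_ne_zero (H : CoverRoots p δ κ t r) (hp : 5 ≤ p) (i) :
    (critPoly L).eval (r i) ≠ 0 := by
  intro h
  obtain ⟨R, hR, -⟩ := H.param.exists_factor hp
  have h1 := H.eval_zero_root i
  rw [hR, eval_mul, eval_pow, h, zero_pow (by norm_num), zero_mul] at h1
  exact mul_ne_zero H.t_ne_zero (pow_ne_zero 2 (H.root_ne_zero hp i)) h1.symm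

theorem injective (H : CoverRoots p δ κ t r) (hp : 5 ≤ p) : Function.Injective r := by
  intro i j hij
  by_contra hne
  exact H.eval_critPoly_root_ne_zero hp i (H.eval_critPoly_eq_zero_of_eq hp hne hij)

theorem exists_perm (H : CoverRoots p δ κ t r) (hp : 5 ≤ p) (σ : L →+* L) (hδ : σ δ = δ)
    (ht : σ t = t) : ∃ s : Equiv.Perm (Fin (p + 2)), ∀ i, σ (r i) = r (s i) := by
  have h : ∀ i, ∃ j, σ (r i) = r j := by
    intro i
    refine H.exists_root_eq hp ?_
    have h1 := congrArg σ (H.eval_root i)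
    rwa [map_zero, ← eval_map_apply, coverPoly_map, hδ, ht] at h1
  choose s hs using h
  refine ⟨Equiv.ofBijective s (Finite.injective_iff_bijective.1 ?_), hs⟩
  intro i j hij
  apply H.injective hp
  apply σ.injective
  rw [hs, hs, hij]

theorem exists_perm_hom (H : CoverRoots p δ κ t r) (hp : 5 ≤ p) {K : Type*} [Field K]
    [Algebra K L] (hδ : δ ∈ (algebraMap K L).range) (ht : t ∈ (algebraMap K L).range) :
    ∃ π : (L ≃ₐ[K] L) →* Equiv.Perm (Fin (p + 2)), ∀ σ i, σ (r i) = r (π σ i) := by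
  obtain ⟨δ, rfl⟩ := hδ
  obtain ⟨t, rfl⟩ := ht
  choose π hπ using fun σ : L ≃ₐ[K] L =>
    H.exists_perm hp (σ : L →+* L) (σ.commutes δ) (σ.commutes t)
  refine ⟨MonoidHom.mk' π fun σ τ => ?_, hπ⟩
  ext i
  congr 1
  apply H.injective hp
  rw [← hπ, Equiv.Perm.mul_apply, ← hπ, ← hπ]
  rfl

omit [CharP L p] in
theorem exists_det_sq [CharP L p] {k : Type*} [Field k] [IsAlgClosed k] (φ : k →+* L) {δ κ : k}
    (H : CoverRoots p (φ δ) (φ κ) t r) (hp : 5 ≤ p) :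
    ∃ e : k, e ≠ 0 ∧ (Matrix.vandermonde r).det ^ 2 = (φ e * ∏ i, (critPoly L).eval (r i)) ^ 2 := by
  have hδ : φ δ ≠ 0 := H.param.delta_ne_zero hp
  have hδ0 : δ ≠ 0 := fun h => hδ (by rw [h, map_zero])
  have h2 := two_ne_zero_of_lt (A := L) (p := p) (by lia)
  have h2k : (2 : k) ≠ 0 := fun h => h2 (by rw [← map_ofNat φ, h, map_zero])
  obtain ⟨ε, hε, h1⟩ : ∃ ε : k, ε ^ 2 = 1 ∧ (Matrix.vandermonde r).det ^ 2 =
      φ ε * ∏ i, ∏ j ∈ Finset.univ.erase i, (r i - r j) := by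
    have hoff := Finset.prod_prod_Ioi_mul_eq_prod_prod_off_diag (fun i j => r i - r j)
    have hneg : ∀ i, ∏ j ∈ Finset.Ioi i, (r j - r i) * (r i - r j) =
        (-1) ^ (Finset.Ioi i).card * (∏ j ∈ Finset.Ioi i, (r j - r i)) ^ 2 := by
      intro i
      rw [← Finset.prod_pow, ← Finset.prod_const, ← Finset.prod_mul_distrib]
      exact Finset.prod_congr rfl fun j _ => by ring
    simp only [hneg, Finset.prod_mul_distrib, Finset.prod_pow_eq_pow_sum, Finset.prod_pow] at hoff
    rw [← Matrix.det_vandermonde] at hoff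
    have hflip : ∏ i, ∏ j ∈ Finset.univ.erase i, (r i - r j) =
        (-1) ^ (∑ i : Fin (p + 2), (Finset.univ.erase i).card) *
          ∏ i, ∏ j ∈ ({i} : Finset _)ᶜ, (r j - r i) := by
      rw [← Finset.prod_pow_eq_pow_sum, ← Finset.prod_mul_distrib]
      refine Finset.prod_congr rfl fun i _ => ?_
      rw [Finset.compl_singleton, ← Finset.prod_const, ← Finset.prod_mul_distrib]
      exact Finset.prod_congr rfl fun j _ => by ring
    rw [hflip, ← hoff]
    set a := ∑ i : Fin (p + 2), (Finset.univ.erase i).card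
    set b := ∑ i : Fin (p + 2), (Finset.Ioi i).card
    refine ⟨(-1) ^ (a + b), by rw [← pow_mul, mul_comm, pow_mul]; simp, ?_⟩
    rw [← mul_assoc, ← mul_assoc, map_pow, map_neg, map_one, ← pow_add, ← pow_add,
      Even.neg_one_pow ⟨a + b, by ring⟩, one_mul]
  have h3 : ∏ i, (r i * (φ δ * ∏ j ∈ Finset.univ.erase i, (r i - r j))) =
      ∏ i, (2 * (critPoly L).eval (r i) ^ 2) := Finset.prod_congr rfl fun i _ => H.root_mul_prod i
  simp only [Finset.prod_mul_distrib, Finset.prod_const, Finset.prod_pow, Finset.card_univ,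
    Fintype.card_fin] at h3
  have h4 := H.four_eq (hpp.out.odd_of_ne_two (by lia))
  have hε0 : ε ≠ 0 := by rintro rfl; simp at hε
  obtain ⟨e, he⟩ :=
    IsAlgClosed.exists_pow_nat_eq (ε * (2 ^ (p + 2) / (4 * δ ^ (p + 1)))) zero_lt_two
  have h4k : (4 : k) ≠ 0 := by
    have : (4 : k) = 2 * 2 := by norm_num
    rw [this]; exact mul_ne_zero h2k h2k
  refine ⟨e, ?_, ?_⟩
  · rintro rfl
    rw [zero_pow two_ne_zero] at he
    have : ε * (2 ^ (p + 2) / (4 * δ ^ (p + 1))) ≠ 0 := 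
      mul_ne_zero hε0 (div_ne_zero (pow_ne_zero _ h2k) (mul_ne_zero h4k (pow_ne_zero _ hδ0)))
    exact this he.symm
  rw [mul_pow, ← map_pow, he, h1, map_mul, mul_assoc]
  congr 1
  have h4L : (4 : L) ≠ 0 := by rw [← map_ofNat φ]; simpa using h4k
  simp only [map_div₀, map_pow, map_mul, map_ofNat]
  rw [div_mul_eq_mul_div, eq_div_iff (mul_ne_zero h4L (pow_ne_zero _ hδ)), ← h3, ← h4]
  ring

theorem sign_eq_one {k : Type*} [Field k] [IsAlgClosed k] (φ : k →+* L) {δ κ : k}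
    (H : CoverRoots p (φ δ) (φ κ) t r) (hp : 5 ≤ p) (σ : L →+* L) (hσ : ∀ c, σ (φ c) = φ c)
    (s : Equiv.Perm (Fin (p + 2))) (hs : ∀ i, σ (r i) = r (s i)) : Equiv.Perm.sign s = 1 := by
  obtain ⟨e, he, h⟩ := H.exists_det_sq φ hp
  have hfix : σ (φ e * ∏ i, (critPoly L).eval (r i)) = φ e * ∏ i, (critPoly L).eval (r i) := by
    rw [map_mul, hσ, map_prod]
    congr 1
    rw [← Equiv.prod_comp s fun i => (critPoly L).eval (r i)]
    refine Finset.prod_congr rfl fun i _ => ?_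
    rw [← hs, ← eval_map_apply, critPoly_map]
  have hdet : σ (Matrix.vandermonde r).det = (Matrix.vandermonde r).det := by
    rcases sq_eq_sq_iff_eq_or_eq_neg.1 h with h | h
    · rw [h, hfix]
    · rw [h, map_neg, hfix]
  have hdet2 : σ (Matrix.vandermonde r).det = Equiv.Perm.sign s * (Matrix.vandermonde r).det := by
    rw [← Matrix.det_permute, RingHom.map_det]
    congr 1
    ext i j
    simp [Matrix.vandermonde_apply, hs]
  have hne : (Matrix.vandermonde r).det ≠ 0 := Matrix.det_vandermonde_ne_zero_iff.2 (H.injective hp)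
  have h1 : ((Equiv.Perm.sign s : ℤ) : L) = 1 := by
    rw [hdet] at hdet2
    exact mul_right_cancel₀ hne (by rw [one_mul]; exact hdet2.symm)
  rcases Int.units_eq_one_or (Equiv.Perm.sign s) with h' | h'
  · exact h'
  · exfalso
    rw [h'] at h1
    apply two_ne_zero_of_lt (A := L) (p := p) (by lia)
    push_cast at h1
    linear_combination -h1

end CoverRoots

end CoverRoots

section CoverRootsInfty

open Polynomial

namespace CoverRoots

variable {L : Type} [Field L] {p : ℕ} {δ κ t : L} {r : Fin (p + 2) → L}
  (O : ValuationSubring L)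

theorem valuation_root_cases (H : CoverRoots p δ κ t r) (hp : 5 ≤ p) (hδ : O.valuation δ = 1)
    (h2 : O.valuation 2 = 1) (ht : 1 < O.valuation t) (i) :
    (1 < O.valuation (r i) ∧ O.valuation (r i) ^ p = O.valuation t) ∨
      (O.valuation (r i) < 1 ∧ O.valuation t * O.valuation (r i) ^ 2 = 1) := by
  have hδO : δ ∈ O := (O.valuation_le_one_iff _).1 hδ.le
  have hnat (n : ℕ) : (n : L) ∈ O := natCast_mem O n
  have h := H.root_eq i
  generalize r i = u at h
  rcases le_or_gt (O.valuation u) 1 with hu | hu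
  · right
    have huO : u ∈ O := (O.valuation_le_one_iff _).1 hu
    have hb : δ * (u ^ (p + 1) + u) + u ^ 3 + (8 : ℕ) * u ^ 2 + (16 : ℕ) ∈ O :=
      add_mem (add_mem (add_mem (mul_mem hδO (add_mem (pow_mem huO _) huO)) (pow_mem huO _))
        (mul_mem (hnat 8) (pow_mem huO 2))) (hnat 16)
    have h' : t * u ^ 2 = u * (δ * (u ^ (p + 1) + u) + u ^ 3 + (8 : ℕ) * u ^ 2 + (16 : ℕ)) - 4 := by
      rw [← h]; push_cast; ring
    rcases hu.lt_or_eq with hu1 | hu1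
    · refine ⟨hu1, ?_⟩
      rw [← map_pow, ← map_mul, h', Valuation.map_sub_eq_of_lt_right]
      · rw [show (4 : L) = 2 * 2 by norm_num, map_mul, h2, one_mul]
      · rw [show (4 : L) = 2 * 2 by norm_num, map_mul, map_mul, h2, one_mul]
        exact mul_lt_one_of_lt_of_le hu1 ((O.valuation_le_one_iff _).2 hb)
    · exfalso
      have h3 : t * u ^ 2 ∈ O := by
        rw [h']
        exact sub_mem (mul_mem huO hb) (by exact_mod_cast hnat 4)
      rw [← O.valuation_le_one_iff, map_mul, map_pow, hu1, one_pow, mul_one] at h3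
      exact h3.not_gt ht
  · left
    refine ⟨hu, ?_⟩
    have hu0 : u ≠ 0 := by rintro rfl; simp at hu
    have hy : u⁻¹ ∈ O := by
      rw [← O.valuation_le_one_iff, map_inv₀]
      exact inv_le_one_of_one_le₀ hu.le
    have hb : 1 + (8 : ℕ) * u⁻¹ + δ * u⁻¹ ^ 2 + (16 : ℕ) * u⁻¹ ^ 3 - (4 : ℕ) * u⁻¹ ^ 4 ∈ O :=
      sub_mem (add_mem (add_mem (add_mem (one_mem O) (mul_mem (hnat 8) hy))
        (mul_mem hδO (pow_mem hy _))) (mul_mem (hnat 16) (pow_mem hy _)))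
        (mul_mem (hnat 4) (pow_mem hy _))
    have h' : t = δ * u ^ p +
        u ^ 2 * (1 + (8 : ℕ) * u⁻¹ + δ * u⁻¹ ^ 2 + (16 : ℕ) * u⁻¹ ^ 3 - (4 : ℕ) * u⁻¹ ^ 4) := by
      have : t = (δ * (u ^ (p + 2) + u ^ 2) + u ^ 4 + 8 * u ^ 3 + 16 * u - 4) / u ^ 2 := by
        rw [h]; field_simp
      rw [this]; push_cast; field_simp; ring
    rw [h', Valuation.map_add_eq_of_lt_left, map_mul, hδ, one_mul, map_pow]
    rw [map_mul, map_mul, hδ, one_mul, map_pow, map_pow]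
    refine lt_of_le_of_lt (mul_le_of_le_one_right zero_le ((O.valuation_le_one_iff _).2 hb)) ?_
    exact pow_lt_pow_right₀ hu (by lia)

variable [hpp : Fact p.Prime]

open Classical in
theorem card_large (H : CoverRoots p δ κ t r) (hp : 5 ≤ p) (hδ : O.valuation δ = 1)
    (h2 : O.valuation 2 = 1) (ht : 1 < O.valuation t) :
    (Finset.univ.filter fun i => 1 < O.valuation (r i)).card = p := by
  have h4 := congrArg O.valuation (H.four_eq (hpp.out.odd_of_ne_two (by lia)))
  rw [map_mul, hδ, one_mul, show (4 : L) = 2 * 2 by norm_num, map_mul, h2, one_mul, map_prod] at h4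
  have hc := H.valuation_root_cases O hp hδ h2 ht
  set S := Finset.univ.filter fun i => 1 < O.valuation (r i) with hS
  have hcard := Finset.card_add_card_compl S
  rw [Fintype.card_fin] at hcard
  have h5 := congrArg (· ^ (2 * p)) h4
  simp only [one_pow, ← Finset.prod_pow] at h5
  rw [← Finset.prod_mul_prod_compl S, Finset.prod_congr (g := fun _ => O.valuation t ^ 2) rfl,
    Finset.prod_const] at h5
  swap
  · intro i hi
    rcases hc i with h | h
    · rw [mul_comm, pow_mul, h.2]
    · exact absurd (Finset.mem_filter.1 hi).2 h.1.le.not_gt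
  have h6 : (O.valuation t ^ p) ^ Sᶜ.card * ∏ i ∈ Sᶜ, O.valuation (r i) ^ (2 * p) = 1 := by
    rw [← Finset.prod_const, ← Finset.prod_mul_distrib]
    refine Finset.prod_eq_one fun i hi => ?_
    rcases hc i with h | h
    · exact absurd h.1 (by simpa [hS] using hi)
    · rw [pow_mul, ← mul_pow, h.2, one_pow]
  have h7 : (O.valuation t ^ 2) ^ S.card = (O.valuation t ^ p) ^ Sᶜ.card :=
    mul_right_cancel₀ (right_ne_zero_of_mul_eq_one h6) (h5.trans h6.symm)
  rw [← pow_mul, ← pow_mul] at h7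
  have h8 := pow_right_injective₀ (zero_lt_one.trans ht) ht.ne' h7
  have h9 : (p + 2) * S.card = (p + 2) * p := by
    have : p * S.card + p * Sᶜ.card = p * (p + 2) := by rw [← mul_add, hcard]
    nlinarith
  exact Nat.eq_of_mul_eq_mul_left (by lia) h9

variable [CharP L p]

theorem valuation_sub_pow (H : CoverRoots p δ κ t r) (hp : 5 ≤ p) (hδ : O.valuation δ = 1)
    (h2 : O.valuation 2 = 1) (ht : 1 < O.valuation t) {i j} (hij : i ≠ j)
    (hi : 1 < O.valuation (r i)) (hj : 1 < O.valuation (r j)) :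
    O.valuation (r i - r j) ^ (p * (p - 1)) = O.valuation t := by
  have hc := H.valuation_root_cases O hp hδ h2 ht
  have hne : r i - r j ≠ 0 := sub_ne_zero.2 fun h => hij (H.injective hp h)
  have hip := ((hc i).resolve_right fun h => h.1.le.not_gt hi).2
  have hjp := ((hc j).resolve_right fun h => h.1.le.not_gt hj).2
  have hvu : O.valuation (r j) = O.valuation (r i) :=
    (pow_left_inj₀ zero_le zero_le hpp.out.ne_zero).1 (hjp.trans hip.symm)
  have hei := H.root_eq i
  have hej := H.root_eq j
  have h0i := H.root_ne_zero hp i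
  have h0j := H.root_ne_zero hp j
  have hnat (n : ℕ) : (n : L) ∈ O := natCast_mem O n
  generalize r i = u at *
  generalize r j = u' at *
  have hinv {a : L} (ha : 1 < O.valuation a) : a⁻¹ ∈ O := by
    rw [← O.valuation_le_one_iff, map_inv₀]
    exact inv_le_one_of_one_le₀ ha.le
  have hy := hinv hi
  have hy' := hinv hj
  have hb : (8 : ℕ) - (16 : ℕ) * (u⁻¹ * u'⁻¹) + (4 : ℕ) * (u⁻¹ ^ 2 * u'⁻¹ + u⁻¹ * u'⁻¹ ^ 2) ∈ O :=
    add_mem (sub_mem (hnat 8) (mul_mem (hnat 16) (mul_mem hy hy'))) (mul_mem (hnat 4)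
      (add_mem (mul_mem (pow_mem hy _) hy') (mul_mem hy (pow_mem hy' _))))
  set b := (8 : ℕ) - (16 : ℕ) * (u⁻¹ * u'⁻¹) + (4 : ℕ) * (u⁻¹ ^ 2 * u'⁻¹ + u⁻¹ * u'⁻¹ ^ 2)
    with hbdef
  have hb1 : O.valuation b ≤ 1 := (O.valuation_le_one_iff _).2 hb
  have key : δ * (u - u') ^ (p - 1) = -((u + u') + b) := by
    have e1 : t = δ * u ^ p + δ + u ^ 2 + 8 * u + 16 * u⁻¹ - 4 * u⁻¹ ^ 2 := by
      have : t = (δ * (u ^ (p + 2) + u ^ 2) + u ^ 4 + 8 * u ^ 3 + 16 * u - 4) / u ^ 2 := by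
        rw [hei]; field_simp
      rw [this]; field_simp; ring
    have e2 : t = δ * u' ^ p + δ + u' ^ 2 + 8 * u' + 16 * u'⁻¹ - 4 * u'⁻¹ ^ 2 := by
      have : t = (δ * (u' ^ (p + 2) + u' ^ 2) + u' ^ 4 + 8 * u' ^ 3 + 16 * u' - 4) / u' ^ 2 := by
        rw [hej]; field_simp
      rw [this]; field_simp; ring
    have e3 : (u - u') ^ p = u ^ p - u' ^ p := sub_pow_expChar u u'
    rw [← Nat.sub_add_cancel hpp.out.one_le, pow_succ, Nat.sub_add_cancel hpp.out.one_le] at e3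
    have e4 : u⁻¹ - u'⁻¹ = -(u - u') * (u⁻¹ * u'⁻¹) := by field_simp; ring
    apply mul_right_cancel₀ hne
    rw [hbdef]
    push_cast
    linear_combination δ * e3 + e2 - e1 - (16 - 4 * (u⁻¹ + u'⁻¹)) * e4
  have hle : O.valuation (u - u') ≤ O.valuation u := Valuation.map_sub_le _ le_rfl hvu.le
  have hpow : O.valuation (u - u') ^ (p - 1) = O.valuation (u + u' + b) := by
    rw [← map_pow, ← one_mul (O.valuation (_ ^ _)), ← hδ, ← map_mul, key, Valuation.map_neg]
  have hlt : O.valuation (u - u') < O.valuation u := by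
    refine lt_of_le_of_ne hle fun h => ?_
    have h3 : O.valuation (u + u' + b) ≤ O.valuation u :=
      Valuation.map_add_le _ (Valuation.map_add_le _ le_rfl hvu.le) (hb1.trans hi.le)
    rw [← hpow, h] at h3
    refine h3.not_gt ?_
    calc O.valuation u = O.valuation u ^ 1 := (pow_one _).symm
      _ < _ := pow_lt_pow_right₀ hi (by lia)
  have hsum : O.valuation (u + u') = O.valuation u := by
    rw [show u + u' = 2 * u - (u - u') by ring, Valuation.map_sub_eq_of_lt_left, map_mul, h2,
      one_mul]
    rwa [map_mul, h2, one_mul]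
  rw [Valuation.map_add_eq_of_lt_left _ (by rw [hsum]; exact hb1.trans_lt hi), hsum] at hpow
  rw [mul_comm, pow_mul, hpow, hip]

end CoverRoots

end CoverRootsInfty

section InertiaCard

open Polynomial

variable (k : Type) [Field k] (L : Type) [Field L] [Algebra (RatFunc k) L]

/-- The embedding of the constants `k` into an extension `L` of `k(X)`. -/
noncomputable def constHom : k →+* L := (algebraMap (RatFunc k) L).comp RatFunc.C

variable {k L}

theorem algEquiv_constHom (σ : L ≃ₐ[RatFunc k] L) (c : k) : σ (constHom k L c) = constHom k L c :=
  σ.commutes _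

variable (O : ValuationSubring L) (hO : O.comap (algebraMap (RatFunc k) L) = inftyPlace k)

include hO

theorem constHom_mem (c : k) : constHom k L c ∈ O := by
  rw [constHom, RingHom.comp_apply, algebraMap_mem_iff O hO]
  right
  rw [RatFunc.intDegree_C]

theorem valuation_constHom {c : k} (hc : c ≠ 0) : O.valuation (constHom k L c) = 1 := by
  refine le_antisymm ((O.valuation_le_one_iff _).2 (constHom_mem O hO c)) ?_
  have h := (O.valuation_le_one_iff _).2 (constHom_mem O hO c⁻¹)
  rw [map_inv₀, map_inv₀] at h
  rwa [inv_le_one₀] at h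
  rw [Valuation.pos_iff]
  simpa using hc

theorem one_lt_valuation_X : 1 < O.valuation (algebraMap (RatFunc k) L RatFunc.X) := by
  rw [← not_le, O.valuation_le_one_iff, algebraMap_mem_iff O hO, RatFunc.intDegree_X]
  simp [RatFunc.X_ne_zero]

omit hO

variable [IsAlgClosed k] [FiniteDimensional (RatFunc k) L] [IsGalois (RatFunc k) L]
  {p : ℕ} [hpp : Fact p.Prime] [CharP L p] {δ κ : k} {N : ℕ} {r : Fin (p + 2) → L}

namespace CoverRoots

include hO in
omit [IsAlgClosed k] [FiniteDimensional (RatFunc k) L] [IsGalois (RatFunc k) L] hpp in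
theorem infty_hyps (hp : 5 ≤ p) (hN : N ≠ 0)
    (H : CoverRoots p (constHom k L δ) (constHom k L κ)
      (algebraMap (RatFunc k) L RatFunc.X ^ N) r) :
    O.valuation (constHom k L δ) = 1 ∧ O.valuation (2 : L) = 1 ∧
      1 < O.valuation (algebraMap (RatFunc k) L RatFunc.X ^ N) := by
  refine ⟨valuation_constHom O hO ?_, ?_, ?_⟩
  · rintro rfl
    exact H.param.delta_ne_zero hp (map_zero _)
  · rw [← map_ofNat (constHom k L)]
    refine valuation_constHom O hO fun h => two_ne_zero_of_lt (A := L) (p := p) (by lia) ?_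
    rw [← map_ofNat (constHom k L), h, map_zero]
  · rw [map_pow]
    exact one_lt_pow₀ (one_lt_valuation_X O hO) hN

open Classical in
include hO in
omit [IsAlgClosed k] [FiniteDimensional (RatFunc k) L] [IsGalois (RatFunc k) L] in
theorem exists_large (hp : 5 ≤ p) (hN : N ≠ 0)
    (H : CoverRoots p (constHom k L δ) (constHom k L κ)
      (algebraMap (RatFunc k) L RatFunc.X ^ N) r) :
    ∃ i j, i ≠ j ∧ 1 < O.valuation (r i) ∧ 1 < O.valuation (r j) := by
  obtain ⟨hδ, h2, ht⟩ := infty_hyps O hO hp hN H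
  have hcard := H.card_large O hp hδ h2 ht
  obtain ⟨i, j, hi, hj, hij⟩ := Finset.one_lt_card_iff.1 (hcard.symm ▸ hpp.out.one_lt)
  exact ⟨i, j, hij, (Finset.mem_filter.1 hi).2, (Finset.mem_filter.1 hj).2⟩

include hO in
theorem dvd_mul_card_inertia (hp : 5 ≤ p) (hN : N ≠ 0)
    (H : CoverRoots p (constHom k L δ) (constHom k L κ)
      (algebraMap (RatFunc k) L RatFunc.X ^ N) r) :
    p * (p - 1) ∣ N * Nat.card (inertiaIn k O) := by
  obtain ⟨hδ, h2, ht⟩ := infty_hyps O hO hp hN H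
  obtain ⟨i, j, hij, hi, hj⟩ := H.exists_large O hO hp hN
  have h1 := H.valuation_sub_pow O hp hδ h2 ht hij hi hj
  obtain ⟨z, hz⟩ := (infty_package O hO).2.1 (r i - r j)
    (sub_ne_zero.2 fun h => hij (H.injective hp h))
  have hX := one_lt_valuation_X O hO
  have h3 := congrArg (· ^ (p * (p - 1))) hz
  simp only [← pow_mul] at h3
  rw [mul_comm, pow_mul, h1, map_pow, ← pow_mul, ← zpow_natCast, ← zpow_natCast, ← zpow_mul] at h3
  have h4 := zpow_right_injective₀ (zero_lt_one.trans hX) hX.ne' h3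
  have h5 : ((p * (p - 1) : ℕ) : ℤ) ∣ ((N * Nat.card (inertiaIn k O) : ℕ) : ℤ) :=
    ⟨z, by rw [h4, mul_comm]⟩
  exact_mod_cast h5

omit [IsAlgClosed k] [FiniteDimensional (RatFunc k) L] [IsGalois (RatFunc k) L] hpp [CharP L p] in
theorem valuation_lt_iff_of_mem_inertiaIn {O : ValuationSubring L} {σ : L ≃ₐ[RatFunc k] L}
    (hσ : σ ∈ inertiaIn k O) (a b : L) :
    O.valuation (σ a) < O.valuation (σ b) ↔ O.valuation a < O.valuation b := by
  rw [← not_le, ← not_le, not_iff_not]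
  by_cases ha : a = 0
  · simp [ha]
  have hv : 0 < O.valuation a := by rwa [Valuation.pos_iff]
  have hv' : 0 < O.valuation (σ a) := by rw [Valuation.pos_iff]; simpa using ha
  rw [← div_le_one₀ hv, ← div_le_one₀ hv', ← map_div₀, ← map_div₀, ← map_div₀,
    O.valuation_le_one_iff, O.valuation_le_one_iff]
  exact (((mem_inertiaIn_iff O σ).1 hσ).1 (b / a)).symm

omit [IsAlgClosed k] [FiniteDimensional (RatFunc k) L] [IsGalois (RatFunc k) L] hpp [CharP L p] in
theorem valuation_map_sub_lt {O : ValuationSubring L} {σ : L ≃ₐ[RatFunc k] L}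
    (hσ : σ ∈ inertiaIn k O) {a b : L} (hab : O.valuation a = O.valuation b) (hb : b ≠ 0)
    (hσb : σ b = b) : O.valuation (σ a - a) < O.valuation b := by
  have hv : 0 < O.valuation b := by rwa [Valuation.pos_iff]
  have h := ((mem_inertiaIn_iff O σ).1 hσ).2 (a / b) (by
    rw [← O.valuation_le_one_iff, map_div₀, hab, div_self hv.ne'])
  rwa [map_div₀ σ, hσb, ← sub_div, map_div₀, div_lt_one₀ hv] at h

include hO in
omit [FiniteDimensional (RatFunc k) L] [IsGalois (RatFunc k) L] in
theorem eq_one_of_fix_large (hp : 5 ≤ p) (hN : N ≠ 0)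
    (H : CoverRoots p (constHom k L δ) (constHom k L κ) (algebraMap (RatFunc k) L RatFunc.X ^ N) r)
    (hgen : ∀ σ : L ≃ₐ[RatFunc k] L, (∀ i, σ (r i) = r i) → σ = 1)
    {σ : L ≃ₐ[RatFunc k] L} (hσ : σ ∈ inertiaIn k O) {i j} (hij : i ≠ j)
    (hi : 1 < O.valuation (r i)) (hj : 1 < O.valuation (r j))
    (hσi : σ (r i) = r i) (hσj : σ (r j) = r j) : σ = 1 := by
  classical
  obtain ⟨hδ, h2, ht⟩ := infty_hyps O hO hp hN H
  have hdiff {a b} (hab : a ≠ b) (ha : 1 < O.valuation (r a)) (hb : 1 < O.valuation (r b)) :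
      O.valuation (r a - r b) = O.valuation (r i - r j) :=
    (pow_left_inj₀ zero_le zero_le (Nat.mul_ne_zero hpp.out.ne_zero (by lia))).1
      ((H.valuation_sub_pow O hp hδ h2 ht hab ha hb).trans
        (H.valuation_sub_pow O hp hδ h2 ht hij hi hj).symm)
  obtain ⟨s, hs⟩ := H.exists_perm hp (σ : L →+* L) (algEquiv_constHom σ δ)
    ((congrArg _ (map_pow _ _ _).symm).trans ((σ.commutes _).trans (map_pow _ _ _)))
  change ∀ i, σ (r i) = r (s i) at hs
  have hlarge (a) : 1 < O.valuation (r (s a)) ↔ 1 < O.valuation (r a) := by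
    have := valuation_lt_iff_of_mem_inertiaIn hσ 1 (r a)
    rwa [map_one, map_one, hs] at this
  have hfix (a) (ha : 1 < O.valuation (r a)) : s a = a := by
    by_contra hne
    by_cases hai : a = i
    · rw [hai] at hne
      exact hne (H.injective hp ((hs i).symm.trans hσi))
    have h3 := valuation_map_sub_lt hσ (hdiff hai ha hi)
      (sub_ne_zero.2 fun h => hij (H.injective hp h)) (by rw [map_sub, hσi, hσj])
    rw [map_sub σ, hσi, sub_sub_sub_cancel_right, hs, hdiff hne ((hlarge a).2 ha) ha] at h3
    exact lt_irrefl _ h3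
  have hsign := H.sign_eq_one (constHom k L) hp (σ : L →+* L) (algEquiv_constHom σ) s hs
  have hsupp : s.support ⊆ (Finset.univ.filter fun i => 1 < O.valuation (r i))ᶜ := by
    intro a ha
    simp only [Finset.mem_compl, Finset.mem_filter, Finset.mem_univ, true_and]
    exact fun h => Equiv.Perm.mem_support.1 ha (hfix a h)
  have hcard : s.support.card ≤ 2 := by
    refine (Finset.card_le_card hsupp).trans ?_
    rw [Finset.card_compl, H.card_large O hp hδ h2 ht, Fintype.card_fin]
    lia
  have hs1 : s = 1 := by
    by_contra hne
    have h3 : s.support.card = 2 := by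
      have h4 := Equiv.Perm.card_support_ne_one s
      have h5 : s.support.card ≠ 0 := by simpa using hne
      lia
    rw [Equiv.Perm.card_support_eq_two] at h3
    rw [h3.sign_eq] at hsign
    exact absurd hsign (by decide)
  refine hgen σ fun a => ?_
  rw [hs, hs1, Equiv.Perm.one_apply]

include hO in
theorem card_inertia_le (hp : 5 ≤ p) {r' m : ℕ} (hr' : r' * m = p - 1)
    (H : CoverRoots p (constHom k L δ) (constHom k L κ)
      (algebraMap (RatFunc k) L RatFunc.X ^ (3 * r')) r)
    (hgen : ∀ σ : L ≃ₐ[RatFunc k] L, (∀ i, σ (r i) = r i) → σ = 1) :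
    Nat.card (inertiaIn k O) ≤ p * m := by
  classical
  have hr0 : r' ≠ 0 := by rintro rfl; lia
  have hm0 : NeZero m := ⟨by rintro rfl; lia⟩
  have hN : 3 * r' ≠ 0 := by lia
  obtain ⟨hδ, h2, ht⟩ := infty_hyps O hO hp hN H
  obtain ⟨i, j, hij, hi, hj⟩ := H.exists_large O hO hp hN
  have hX := one_lt_valuation_X O hO
  set x := algebraMap (RatFunc k) L RatFunc.X with hx
  set w := r i - r j with hw
  have hw0 : w ≠ 0 := sub_ne_zero.2 fun h => hij (H.injective hp h)
  have hwpos : 0 < O.valuation w := by rwa [Valuation.pos_iff]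
  have hdiff {a b} (hab : a ≠ b) (ha : 1 < O.valuation (r a)) (hb : 1 < O.valuation (r b)) :
      O.valuation (r a - r b) = O.valuation w :=
    (pow_left_inj₀ zero_le zero_le (Nat.mul_ne_zero hpp.out.ne_zero (by lia))).1
      ((H.valuation_sub_pow O hp hδ h2 ht hab ha hb).trans
        (H.valuation_sub_pow O hp hδ h2 ht hij hi hj).symm)
  have hwpow : O.valuation w ^ (p * m) = O.valuation (x ^ 3) := by
    refine (pow_left_inj₀ zero_le zero_le hr0).1 ?_
    rw [← pow_mul, ← map_pow O.valuation (x ^ 3), ← pow_mul,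
      ← H.valuation_sub_pow O hp hδ h2 ht hij hi hj, ← hr']
    congr 1
    ring
  have hpermEx (σ : L ≃ₐ[RatFunc k] L) (hσ : σ ∈ inertiaIn k O) (a) (ha : 1 < O.valuation (r a)) :
      ∃ b, 1 < O.valuation (r b) ∧ σ (r a) = r b := by
    obtain ⟨s, hs⟩ := H.exists_perm hp (σ : L →+* L) (algEquiv_constHom σ δ)
      ((congrArg _ (map_pow _ _ _).symm).trans ((σ.commutes _).trans (map_pow _ _ _)))
    refine ⟨s a, ?_, hs a⟩
    have := valuation_lt_iff_of_mem_inertiaIn hσ 1 (r a)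
    rw [map_one, map_one] at this
    rw [← hs]
    exact this.2 ha
  have hσw (σ : L ≃ₐ[RatFunc k] L) (hσ : σ ∈ inertiaIn k O) :
      O.valuation (σ w) = O.valuation w := by
    obtain ⟨a, ha, hia⟩ := hpermEx σ hσ i hi
    obtain ⟨b, hb, hjb⟩ := hpermEx σ hσ j hj
    rw [hw, map_sub, hia, hjb]
    refine hdiff ?_ ha hb
    rintro rfl
    exact hij (H.injective hp (σ.injective (hia.trans hjb.symm)))
  have hx0 : x ≠ 0 := by rintro h; simp [h] at hX
  have hres (σ : inertiaIn k O) : ∃ c : rootsOfUnity m k,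
      O.valuation (σ.1 w / w - constHom k L (c : kˣ)) < 1 := by
    obtain ⟨c, hc⟩ := (infty_package O hO).1 (σ.1 w / w) (by
      rw [map_div₀, hσw _ σ.2, div_self hwpos.ne'])
    change O.valuation (σ.1 w / w - constHom k L c) < 1 at hc
    have hyO : σ.1 w / w ∈ O := by
      rw [← O.valuation_le_one_iff, map_div₀, hσw _ σ.2, div_self hwpos.ne']
    have hcO := constHom_mem O hO c
    have h3 : O.valuation ((σ.1 w / w) ^ (p * m) - 1) < 1 := by
      have h4 := valuation_map_sub_lt σ.2 (a := w ^ (p * m)) (b := x ^ 3)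
        (by rw [map_pow, hwpow]) (pow_ne_zero _ hx0)
        (by rw [map_pow]; exact congrArg (· ^ 3) (σ.1.commutes _))
      have h5 : (σ.1 w / w) ^ (p * m) - 1 = (σ.1 (w ^ (p * m)) - w ^ (p * m)) / w ^ (p * m) := by
        rw [div_pow, map_pow, sub_div, div_self (pow_ne_zero _ hw0)]
      rw [h5, map_div₀, map_pow O.valuation, hwpow]
      rwa [div_lt_one₀]
      rw [Valuation.pos_iff]
      exact pow_ne_zero _ hx0
    have h4 : O.valuation ((σ.1 w / w) ^ (p * m) - (constHom k L c) ^ (p * m)) < 1 := by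
      obtain ⟨q, hq⟩ : ∃ q ∈ O, (σ.1 w / w) ^ (p * m) - (constHom k L c) ^ (p * m) =
          (σ.1 w / w - constHom k L c) * q := by
        obtain ⟨q, hq⟩ := sub_dvd_pow_sub_pow (⟨_, hyO⟩ : O) ⟨_, hcO⟩ (p * m)
        exact ⟨q, q.2, congrArg Subtype.val hq⟩
      rw [hq.2, map_mul]
      exact mul_lt_one_of_lt_of_le hc ((O.valuation_le_one_iff _).2 hq.1)
    have h5 : c ^ (p * m) - 1 = 0 := by
      by_contra hne
      have h6 := valuation_constHom O hO hne
      rw [map_sub, map_pow, map_one, ← sub_sub_sub_cancel_left _ _ ((σ.1 w / w) ^ (p * m))] at h6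
      exact (Valuation.map_sub_lt _ h3 h4).ne h6
    have : CharP k p := (constHom k L).charP (constHom k L).injective p
    have h6 : c ^ m = 1 := by
      have h7 : (c ^ m - 1) ^ p = 0 := by
        rw [sub_pow_expChar, one_pow, ← pow_mul, mul_comm, h5]
      exact sub_eq_zero.1 (pow_eq_zero_iff hpp.out.ne_zero |>.1 h7)
    refine ⟨rootsOfUnity.mkOfPowEq c h6, ?_⟩
    simpa using hc
  choose c hc using hres
  choose b hb hib using fun σ : inertiaIn k O => hpermEx σ.1 σ.2 i hi
  have hinj : Function.Injective fun σ : inertiaIn k O =>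
      ((⟨b σ, by simpa using hb σ⟩, c σ) :
        (Finset.univ.filter fun i => 1 < O.valuation (r i)) × rootsOfUnity m k) := by
    intro σ τ h
    simp only [Prod.mk.injEq, Subtype.mk.injEq] at h
    obtain ⟨hbe, hce⟩ := h
    have hg : (τ⁻¹ * σ : inertiaIn k O).1 = 1 := by
      have hgi : (τ⁻¹ * σ : inertiaIn k O).1 (r i) = r i := by
        change τ.1.symm (σ.1 (r i)) = r i
        rw [AlgEquiv.symm_apply_eq, hib, hib, hbe]
      refine H.eq_one_of_fix_large O hO hp hN hgen (τ⁻¹ * σ).2 hij hi hj hgi ?_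
      have h3 : O.valuation (σ.1 w - τ.1 w) < O.valuation w := by
        have h4 := Valuation.map_sub_lt _ (hc σ) (hce ▸ hc τ)
        rw [hce, sub_sub_sub_cancel_right, ← sub_div, map_div₀, div_lt_one₀ hwpos] at h4
        exact h4
      rw [← hσw _ τ.2] at h3
      have h4 := (valuation_lt_iff_of_mem_inertiaIn (τ⁻¹).2 _ _).2 h3
      have h5 : (τ⁻¹).1 (τ.1 w) = w := τ.1.symm_apply_apply w
      rw [map_sub, h5] at h4
      change O.valuation ((τ⁻¹ * σ : inertiaIn k O).1 w - w) < _ at h4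
      rw [hw, map_sub (τ⁻¹ * σ : inertiaIn k O).1, hgi, sub_sub_sub_cancel_left, ← hw] at h4
      obtain ⟨a, ha, hja⟩ := hpermEx _ (τ⁻¹ * σ).2 j hj
      rw [hja] at h4 ⊢
      by_contra hne
      rw [hdiff (by rintro rfl; exact hne rfl) hj ha] at h4
      exact lt_irrefl _ h4
    exact (inv_mul_eq_one.1 (Subtype.ext hg)).symm
  have hle := Nat.card_le_card_of_injective _ hinj
  rw [Nat.card_prod, Nat.card_eq_fintype_card (α := Finset.filter _ _), Fintype.card_coe,
    H.card_large O hp hδ h2 ht] at hle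
  exact hle.trans (Nat.mul_le_mul_left _ (card_rootsOfUnity _ _))

include hO in
theorem card_inertia_eq (hp : 5 ≤ p) (hmod : p % 3 = 2) {r' m : ℕ} (hr' : r' * m = p - 1)
    (H : CoverRoots p (constHom k L δ) (constHom k L κ)
      (algebraMap (RatFunc k) L RatFunc.X ^ (3 * r')) r)
    (hgen : ∀ σ : L ≃ₐ[RatFunc k] L, (∀ i, σ (r i) = r i) → σ = 1) :
    Nat.card (inertiaIn k O) = p * m := by
  have hr0 : r' ≠ 0 := by rintro rfl; lia
  have h1 := H.dvd_mul_card_inertia O hO hp (by lia)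
  refine le_antisymm (H.card_inertia_le O hO hp hr' hgen) (Nat.le_of_dvd Nat.card_pos ?_)
  have h2 : r' * (p * m) ∣ r' * (3 * Nat.card (inertiaIn k O)) := by
    rw [← hr'] at h1
    convert h1 using 1 <;> ring
  have h3 := Nat.dvd_of_mul_dvd_mul_left (Nat.pos_of_ne_zero hr0) h2
  refine Nat.Coprime.dvd_of_dvd_mul_left ?_ h3
  refine ((Nat.Prime.coprime_iff_not_dvd Nat.prime_three).2 fun h => ?_).symm
  rcases (Nat.Prime.dvd_mul Nat.prime_three).1 h with h | h
  · lia
  · have : 3 ∣ p - 1 := hr' ▸ h.mul_left r'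
    lia

end CoverRoots

end InertiaCard

section Reduction

open Polynomial

theorem eq_of_cube_root {p : ℕ} [Fact p.Prime] (hp : 5 ≤ p) {k B F : Type*} [Field k]
    [CommRing B] [IsDomain B] [Field F] [CharP k p] (q : B →+* F) (ψ : k →+* B) (σ : B →+* B)
    (hσψ : ∀ c, σ (ψ c) = ψ c) (hσq : ∀ b, q (σ b) = q b) {R : k[X]}
    (hcop : IsCoprime (critPoly k) R) {y u τ : B} (hy : q y = 0) (hσy : σ y = y) (hu : q u ≠ 0)
    (hcrit : (critPoly F).eval (q u) = 0) (hτ : y * τ = (critPoly k * R).eval₂ ψ u)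
    (hτ3 : τ ^ 3 = (X ^ 2 * R ^ 2).eval₂ ψ u) : σ u = u := by
  have hchF : CharP F p := charP_of_injective_ringHom (q.comp ψ).injective p
  have h3 := CoverParam.three_ne_zero (A := F) (p := p) hp
  have h2 := two_ne_zero_of_lt (A := F) (p := p) (by lia)
  have hσeval (f : k[X]) (b : B) : σ (f.eval₂ ψ b) = f.eval₂ ψ (σ b) := by
    rw [hom_eval₂]
    congr 1
    exact RingHom.ext hσψ
  have hqR : (R.map (q.comp ψ)).eval (q u) ≠ 0 := by
    intro h
    obtain ⟨a, b, hab⟩ := hcop.map (mapRingHom (q.comp ψ))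
    have h1 := congrArg (eval (q u)) hab
    simp only [coe_mapRingHom, critPoly_map] at h1
    rw [eval_add, eval_mul, eval_mul, hcrit, h] at h1
    simp at h1
  have hqX : q u + 1 ≠ 0 := by
    intro h
    obtain ⟨a, b, hab⟩ := isCoprime_critPoly_X_add_one (A := F) hp
    have h1 := congrArg (eval (q u)) hab
    rw [eval_add, eval_mul, eval_mul, hcrit, eval_add, eval_X, eval_one, h] at h1
    simp at h1
  by_contra hne
  obtain ⟨c, hc⟩ := binomExpansion ((critPoly k * R).map ψ) u (σ u - u)
  obtain ⟨E, hE⟩ := sub_dvd_eval_sub (σ u) u ((X ^ 2 * R ^ 2 : k[X]).map ψ)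
  rw [add_sub_cancel, eval_map, eval_map] at hc
  rw [eval_map, eval_map] at hE
  have e1 : y * σ τ = (critPoly k * R).eval₂ ψ (σ u) := by
    rw [← hσeval, ← hτ, map_mul, hσy]
  have e2 : σ τ ^ 3 = (X ^ 2 * R ^ 2).eval₂ ψ (σ u) := by
    rw [← hσeval, ← hτ3, map_pow]
  rw [← e1, ← hτ] at hc
  rw [← e2, ← hτ3] at hE
  set D := eval u (derivative ((critPoly k * R).map ψ)) with hD
  have key : y * E = (D + c * (σ u - u)) * (σ τ ^ 2 + σ τ * τ + τ ^ 2) := by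
    apply mul_left_cancel₀ (sub_ne_zero.2 hne)
    linear_combination (-y) * hE + (σ τ ^ 2 + σ τ * τ + τ ^ 2) * hc
  have hqD : q D ≠ 0 := by
    rw [hD, ← eval_map_apply, ← derivative_map, Polynomial.map_map, Polynomial.map_mul,
      critPoly_map, derivative_mul, eval_add, eval_mul, eval_mul, hcrit, zero_mul, add_zero,
      derivative_critPoly]
    refine mul_ne_zero ?_ hqR
    rw [eval_mul, eval_add, eval_X, eval_one]
    refine mul_ne_zero ?_ hqX
    simpa using h2
  have h4 := congrArg q key
  simp only [map_mul, hy, zero_mul, map_add, map_sub, map_pow, hσq, sub_self, mul_zero,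
    add_zero] at h4
  have h5 : q τ = 0 := by
    have : q D * 3 * (q τ) ^ 2 = 0 := by linear_combination -h4
    simpa [hqD, h3] using this
  have h6 := congrArg q hτ3
  rw [map_pow, h5, zero_pow three_ne_zero, hom_eval₂, ← eval_map, Polynomial.map_mul,
    Polynomial.map_pow, Polynomial.map_pow, Polynomial.map_X, eval_mul, eval_pow, eval_pow,
    eval_X] at h6
  exact mul_ne_zero (pow_ne_zero 2 hu) (pow_ne_zero 2 hqR) h6.symm

theorem coverFactor_map {p : ℕ} {k B F : Type*} [Field k] [CommRing B] [Field F] (q : B →+* F)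
    (ψ : k →+* B) {δ κ : k} (hparam : CoverParam p δ κ) {T : B} {ρ : Fin (p + 2) → B}
    (hρ : coverPoly p (ψ δ) T = C (ψ δ) * ∏ i, (X - C (ρ i))) :
    CoverFactor p (q (ψ δ)) (q (ψ κ)) (q T) fun i => q (ρ i) := by
  refine ⟨hparam.map (q.comp ψ), ?_⟩
  rw [← coverPoly_map, hρ]
  simp [Polynomial.map_prod]

theorem exists_ringHom_field {B : Type} [CommRing B] (P : Ideal B) [P.IsPrime] :
    ∃ (F : Type) (_ : Field F) (q : B →+* F), ∀ b, q b = 0 ↔ b ∈ P := by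
  refine ⟨FractionRing (B ⧸ P), inferInstance,
    (algebraMap (B ⧸ P) (FractionRing (B ⧸ P))).comp (Ideal.Quotient.mk P), fun b => ?_⟩
  rw [RingHom.comp_apply, map_eq_zero_iff _ (IsFractionRing.injective _ _),
    Ideal.Quotient.eq_zero_iff_mem]

variable {k : Type} [Field k] {L : Type} [Field L] [Algebra (RatFunc k) L]
  [Algebra k[X] L] [IsScalarTower k[X] (RatFunc k) L]

variable (k L) in
/-- The embedding of the constants into the integral closure of `k[X]`. -/
noncomputable def constHomInt : k →+* integralClosure k[X] L :=
  (algebraMap k[X] (integralClosure k[X] L)).comp C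

theorem algebraMap_X_eq : algebraMap k[X] L X = algebraMap (RatFunc k) L RatFunc.X := by
  rw [IsScalarTower.algebraMap_apply k[X] (RatFunc k) L, RatFunc.algebraMap_X]

theorem coe_constHomInt (c : k) : (constHomInt k L c : L) = constHom k L c := by
  change algebraMap k[X] L (C c) = algebraMap (RatFunc k) L (RatFunc.C c)
  rw [IsScalarTower.algebraMap_apply k[X] (RatFunc k) L, RatFunc.algebraMap_C]

theorem CoverFactor.exists_lift {p : ℕ} [Fact p.Prime] [CharP L p] (hp : 5 ≤ p) {δ κ : k}
    {N : ℕ} {r : Fin (p + 2) → L} (H : CoverFactor p (constHom k L δ) (constHom k L κ)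
      (algebraMap (RatFunc k) L RatFunc.X ^ N) r) :
    ∃ ρ : Fin (p + 2) → integralClosure k[X] L, (∀ i, (ρ i : L) = r i) ∧
      coverPoly p (constHomInt k L δ) (algebraMap k[X] _ X ^ N) =
        C (constHomInt k L δ) * ∏ i, (X - C (ρ i)) := by
  have hδ : δ ≠ 0 := by
    rintro rfl
    exact H.param.delta_ne_zero hp (map_zero _)
  have hint (i) : IsIntegral k[X] (r i) := by
    refine ⟨C (C δ⁻¹) * coverPoly p (C δ) (X ^ N), ?_, ?_⟩
    · have h := (natDegree_coverPoly p (C δ) (X ^ N) (by lia) (C_ne_zero.2 hδ)).2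
      rw [Monic, leadingCoeff_mul, h, leadingCoeff_C, ← C_mul, inv_mul_cancel₀ hδ, C_1]
    · rw [eval₂_mul, eval₂_eq_eval_map (p := coverPoly _ _ _), coverPoly_map, map_pow,
        algebraMap_X_eq, IsScalarTower.algebraMap_apply k[X] (RatFunc k) L (C δ),
        RatFunc.algebraMap_C]
      exact mul_eq_zero_of_right _ (H.eval_root i)
  refine ⟨fun i => ⟨r i, hint i⟩, fun i => rfl, ?_⟩
  apply Polynomial.map_injective (algebraMap (integralClosure k[X] L) L) Subtype.coe_injective
  have h1 (c : k) : algebraMap (integralClosure k[X] L) L (constHomInt k L c) = constHom k L c :=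
    coe_constHomInt c
  have h2 : algebraMap (integralClosure k[X] L) L (algebraMap k[X] _ X) =
      algebraMap (RatFunc k) L RatFunc.X := algebraMap_X_eq
  rw [coverPoly_map, map_pow, h1, h2, H.eq_prod, Polynomial.map_mul, Polynomial.map_prod, map_C, h1]
  simp only [Polynomial.map_sub, map_X, map_C]
  rfl

variable [IsAlgClosed k] [FiniteDimensional (RatFunc k) L] [IsGalois (RatFunc k) L]
  {p : ℕ} [hpp : Fact p.Prime] [CharP k p] [CharP L p] {δ κ : k} {N : ℕ} {r : Fin (p + 2) → L}

theorem CoverRoots.etale (hp : 5 ≤ p) {r' : ℕ} (hr' : r' ≠ 0) (hparam : CoverParam p δ κ)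
    (H : CoverRoots p (constHom k L δ) (constHom k L κ)
      (algebraMap (RatFunc k) L RatFunc.X ^ (3 * r')) r)
    (hgen : ∀ σ : L ≃ₐ[RatFunc k] L, (∀ i, σ (r i) = r i) → σ = 1) :
    Algebra.Etale k[X] (integralClosure k[X] L) := by
  apply etale_of_inertia_trivial
  intro v σ hσ
  apply hgen
  have := v.isPrime
  obtain ⟨F, _, q, hq⟩ := exists_ringHom_field v.asIdeal
  obtain ⟨c, hc⟩ := exists_liesOver_span_X_sub_C v.asIdeal v.ne_bot
  obtain ⟨ρ, hρ, hρeq⟩ := H.toCoverFactor.exists_lift hp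
  have : CharP F p := charP_of_injective_ringHom (q.comp (constHomInt k L)).injective p
  have hx : q (algebraMap k[X] _ X) = q (constHomInt k L c) := by
    rw [← sub_eq_zero, ← map_sub, hq]
    change algebraMap k[X] _ X - algebraMap k[X] _ (C c) ∈ _
    rw [← map_sub]
    exact (Ideal.mem_of_liesOver v.asIdeal (Ideal.span {(X - C c : k[X])}) _).1
      (Ideal.mem_span_singleton_self _)
  have HF := coverFactor_map q (constHomInt k L) hparam hρeq
  let σB := MulSemiringAction.toRingHom (L ≃ₐ[RatFunc k] L) (integralClosure k[X] L) σ
  have hσB (b : integralClosure k[X] L) : (σB b : L) = σ b := rfl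
  have hσq (b : integralClosure k[X] L) : q (σB b) = q b := by
    rw [← sub_eq_zero, ← map_sub, hq]
    exact hσ b
  have hσψ (c : k) : σB (constHomInt k L c) = constHomInt k L c := by
    apply Subtype.ext
    rw [hσB, coe_constHomInt, algEquiv_constHom]
  have hσx : σB (algebraMap k[X] _ X) = algebraMap k[X] _ X := by
    apply Subtype.ext
    rw [hσB]
    change σ (algebraMap k[X] L X) = algebraMap k[X] L X
    rw [algebraMap_X_eq, AlgEquiv.commutes]
  obtain ⟨s, hs⟩ := H.exists_perm hp (σ : L →+* L) (algEquiv_constHom σ δ)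
    ((congrArg _ (map_pow _ _ _).symm).trans ((σ.commutes _).trans (map_pow _ _ _)))
  have hsρ (i) : σB (ρ i) = ρ (s i) := by
    apply Subtype.ext
    rw [hσB, hρ, hρ]
    exact hs i
  intro i
  by_contra hne
  have hsi : i ≠ s i := fun h => hne ((hs i).trans (by rw [← h]))
  have hqs : q (ρ i) = q (ρ (s i)) := by rw [← hsρ, hσq]
  by_cases hc0 : c = 0
  · have hx0 : q (algebraMap k[X] _ X) = 0 := by rw [hx, hc0, map_zero, map_zero]
    have hcrit := HF.eval_critPoly_eq_zero_of_eq hp hsi hqs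
    obtain ⟨R, hR, hcop⟩ := hparam.exists_factor hp
    have hE : (critPoly L).eval (r i) ^ 3 * (R.map (constHom k L)).eval (r i) =
        algebraMap (RatFunc k) L RatFunc.X ^ (3 * r') * r i ^ 2 := by
      rw [← H.eval_zero_root i, ← map_zero (constHom k L), ← coverPoly_map, hR, Polynomial.map_mul,
        Polynomial.map_pow, critPoly_map, eval_mul, eval_pow]
    set x := algebraMap (RatFunc k) L RatFunc.X with hxdef
    have hx0' : x ≠ 0 := by simp [hxdef, RatFunc.X_ne_zero]
    have hcoe (f : k[X]) (b : integralClosure k[X] L) :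
        ((f.eval₂ (constHomInt k L) b : integralClosure k[X] L) : L) =
          (f.map (constHom k L)).eval (b : L) := by
      change algebraMap (integralClosure k[X] L) L _ = _
      rw [hom_eval₂, eval_map]
      congr 1
      exact RingHom.ext coe_constHomInt
    set τ := (critPoly L).eval (r i) * (R.map (constHom k L)).eval (r i) / x ^ r' with hτ
    have hτ3 : τ ^ 3 = r i ^ 2 * (R.map (constHom k L)).eval (r i) ^ 2 := by
      rw [hτ, div_pow, div_eq_iff (pow_ne_zero _ (pow_ne_zero _ hx0')), ← pow_mul, mul_comm r']
      linear_combination (R.map (constHom k L)).eval (r i) ^ 2 * hE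
    have hτ3' : τ ^ 3 = ((X ^ 2 * R ^ 2 : k[X]).eval₂ (constHomInt k L) (ρ i) :
        integralClosure k[X] L) := by
      rw [hcoe, hτ3, hρ]
      simp
    have hτint : IsIntegral k[X] τ :=
      IsIntegral.of_pow three_pos (by rw [hτ3']; exact Subtype.property _)
    apply hne
    have := eq_of_cube_root hp q (constHomInt k L) σB hσψ hσq hcop
      (y := algebraMap k[X] _ X ^ r') (u := ρ i) (τ := ⟨τ, hτint⟩)
      (by rw [map_pow, hx0, zero_pow hr']) (by rw [map_pow, hσx])
      (HF.root_ne_zero hp i) hcrit ?_ (Subtype.ext hτ3')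
    · rw [← hρ, ← hσB, this]
    · apply Subtype.ext
      rw [hcoe, Polynomial.map_mul, critPoly_map, eval_mul, hρ]
      change (algebraMap k[X] L X) ^ r' * τ = _
      rw [algebraMap_X_eq, hτ, mul_div_cancel₀ _ (pow_ne_zero _ hx0')]
  · refine hsi (CoverRoots.injective ⟨HF, ?_⟩ hp hqs)
    rw [map_pow, hx]
    exact pow_ne_zero _ ((map_ne_zero (q.comp (constHomInt k L))).2 hc0)

theorem CoverRoots.exists_inertia_zero (hp : 5 ≤ p) (hparam : CoverParam p δ κ)
    (H : CoverRoots p (constHom k L δ) (constHom k L κ)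
      (algebraMap (RatFunc k) L RatFunc.X) r)
    (π : (L ≃ₐ[RatFunc k] L) →* Equiv.Perm (Fin (p + 2)))
    (hπ : ∀ σ i, σ (r i) = r (π σ i)) :
    ∃ σ : L ≃ₐ[RatFunc k] L, orderOf σ = 3 ∧ (π σ).support.card ≤ 6 := by
  classical
  obtain ⟨v, hv⟩ := exists_heightOneSpectrum_over (k := k) (L := L) 0
  have := v.isPrime
  obtain ⟨F, _, q, hq⟩ := exists_ringHom_field v.asIdeal
  obtain ⟨ρ, hρ, hρeq⟩ := CoverFactor.exists_lift (N := 1) hp (by simpa using H.toCoverFactor)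
  have : CharP F p := charP_of_injective_ringHom (q.comp (constHomInt k L)).injective p
  have hx : q (algebraMap k[X] _ X ^ 1) = 0 := by
    rw [hq, pow_one, ← sub_zero X, ← map_zero C]
    exact (Ideal.mem_of_liesOver v.asIdeal (Ideal.span {(X - C 0 : k[X])}) _).1
      (Ideal.mem_span_singleton_self _)
  have HF := coverFactor_map q (constHomInt k L) hparam hρeq
  rw [hx] at HF
  obtain ⟨i, hi⟩ := HF.exists_eval_critPoly_eq_zero hp
  obtain ⟨R, hR, hcop⟩ := hparam.exists_factor hp
  have hqR : q (R.eval₂ (constHomInt k L) (ρ i)) ≠ 0 := by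
    intro h
    obtain ⟨a, b, hab⟩ := hcop.map (mapRingHom (q.comp (constHomInt k L)))
    have h1 := congrArg (eval (q (ρ i))) hab
    rw [hom_eval₂, ← eval_map] at h
    simp only [coe_mapRingHom, critPoly_map] at h1
    rw [eval_add, eval_mul, eval_mul, hi, h] at h1
    simp at h1
  have hcoe (f : k[X]) (b : integralClosure k[X] L) :
      ((f.eval₂ (constHomInt k L) b : integralClosure k[X] L) : L) =
        (f.map (constHom k L)).eval (b : L) := by
    change algebraMap (integralClosure k[X] L) L _ = _
    rw [hom_eval₂, eval_map]
    congr 1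
    exact RingHom.ext coe_constHomInt
  have hE : (critPoly k).eval₂ (constHomInt k L) (ρ i) ^ 3 * R.eval₂ (constHomInt k L) (ρ i) =
      algebraMap k[X] _ X * ρ i ^ 2 := by
    rw [← eval₂_pow, ← eval₂_mul, ← hR]
    apply Subtype.ext
    rw [hcoe, coverPoly_map, map_zero, hρ, H.eval_zero_root i, ← hρ, ← algebraMap_X_eq]
    rfl
  have hunit {b : integralClosure k[X] L} (hb : q b ≠ 0) : v.valuation L (b : L) = 1 := by
    refine le_antisymm (v.valuation_le_one b) (not_lt.1 fun h => hb ?_)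
    rwa [hq, ← v.valuation_lt_one_iff_mem (K := L)]
  have h3 := valuation_eq_exp_neg_card_inertia (G := L ≃ₐ[RatFunc k] L) L v _
    (X_sub_C_ne_zero 0) hv
  have h4 := congrArg (fun b : integralClosure k[X] L => v.valuation L (b : L)) hE
  simp only [MulMemClass.coe_mul, SubmonoidClass.coe_pow, map_mul, map_pow] at h4
  rw [hunit hqR, hunit (HF.root_ne_zero hp i), one_pow, mul_one, mul_one] at h4
  rw [map_zero, sub_zero] at h3
  have hdvd : 3 ∣ Nat.card (v.asIdeal.inertia (L ≃ₐ[RatFunc k] L)) := by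
    have h5 := h4.trans h3
    have hne : v.valuation L ((critPoly k).eval₂ (constHomInt k L) (ρ i) :
        integralClosure k[X] L) ≠ 0 := by
      intro h0
      rw [h0, zero_pow three_ne_zero] at h5
      exact WithZero.exp_ne_zero h5.symm
    rw [← WithZero.exp_log hne, ← WithZero.exp_nsmul, WithZero.exp_inj, nsmul_eq_mul] at h5
    exact Int.natCast_dvd_natCast.1 ((dvd_neg).1 ⟨_, h5.symm⟩)
  obtain ⟨z, hz⟩ := exists_prime_orderOf_dvd_card' 3 hdvd
  refine ⟨z, by rwa [Subgroup.orderOf_coe], ?_⟩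
  refine le_trans (Finset.card_le_card fun j hj => ?_) (HF.card_eval_critPoly_eq_zero_le hp)
  rw [Finset.mem_filter]
  refine ⟨Finset.mem_univ _, HF.eval_critPoly_eq_zero_of_eq hp
    (Equiv.Perm.mem_support.1 hj).symm ?_⟩
  rw [← sub_eq_zero, ← map_sub, hq, ← neg_mem_iff, neg_sub]
  have hρj : ρ (π z j) = z.1 • ρ j := by
    apply Subtype.ext
    rw [hρ, ← hπ, ← hρ]
    rfl
  rw [hρj]
  exact z.2 (ρ j)

end Reduction

section SylowCyclic

theorem IsCyclic.subgroup_eq_of_card_eq {C : Type*} [CommGroup C] [Finite C] [IsCyclic C]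
    {H K : Subgroup C} (h : Nat.card H = Nat.card K) : H = K := by
  classical
  have := Fintype.ofFinite C
  have key : ∀ H : Subgroup C, (H : Set C) = {x | x ^ Nat.card H = 1} := by
    intro H
    refine Set.eq_of_subset_of_ncard_le (fun x hx => ?_) ?_ (Set.toFinite _)
    · exact congrArg Subtype.val (pow_card_eq_one' (x := (⟨x, hx⟩ : H)))
    · have := IsCyclic.card_pow_eq_one_le (α := C) (n := Nat.card H) Nat.card_pos
      rw [← Set.ncard_coe_finset] at this
      simpa [← Nat.card_coe_set_eq] using this
  exact SetLike.coe_injective (by rw [key H, key K, h])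

variable {Γ : Type*} [Group Γ] [Finite Γ] {p : ℕ} [hp : Fact p.Prime]

theorem isCyclic_mulAut_of_card_prime {P : Type*} [Group P] (hP : Nat.card P = p) :
    IsCyclic (MulAut P) ∧ Nat.card (MulAut P) = p - 1 := by
  have hPc : IsCyclic P := isCyclic_of_prime_card hP
  have e : MulAut P ≃* (ZMod p)ˣ := hP ▸ IsCyclic.mulAutMulEquiv P
  constructor
  · exact isCyclic_of_surjective e.symm.toMonoidHom e.symm.surjective
  · rw [Nat.card_congr e.toEquiv, Nat.card_eq_fintype_card, ZMod.card_units_eq_totient,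
      Nat.totient_prime hp.out]

theorem subgroup_eq_of_card_eq_of_le_normalizer {P H K : Subgroup Γ} (hP : Nat.card P = p)
    (hC : Subgroup.centralizer (P : Set Γ) ≤ P) (hPH : P ≤ H) (hPK : P ≤ K)
    (hH : H ≤ Subgroup.normalizer (P : Set Γ)) (hK : K ≤ Subgroup.normalizer (P : Set Γ))
    (hHK : Nat.card H = Nat.card K) : H = K := by
  classical
  obtain ⟨hcyc, hcard⟩ := isCyclic_mulAut_of_card_prime hP
  let φ := P.normalizerMonoidHom
  have hker : φ.ker ≤ P.subgroupOf (Subgroup.normalizer (P : Set Γ)) := by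
    rw [Subgroup.normalizerMonoidHom_ker]
    exact fun x hx => hC hx
  let _ : CommGroup (MulAut P) := hcyc.commGroup
  have hmap : ∀ H : Subgroup Γ, P ≤ H → H ≤ Subgroup.normalizer (P : Set Γ) →
      ((H.subgroupOf (Subgroup.normalizer (P : Set Γ))).map φ).comap φ =
        H.subgroupOf (Subgroup.normalizer (P : Set Γ)) := by
    intro H hPH _
    rw [Subgroup.comap_map_eq_self]
    exact hker.trans (Subgroup.comap_mono hPH)
  have hcardmap : ∀ H : Subgroup Γ, P ≤ H → H ≤ Subgroup.normalizer (P : Set Γ) →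
      Nat.card ((H.subgroupOf (Subgroup.normalizer (P : Set Γ))).map φ) * Nat.card φ.ker =
        Nat.card H := by
    intro H hPH hHN
    have h1 := Subgroup.relIndex_ker φ (K := H.subgroupOf (Subgroup.normalizer (P : Set Γ)))
    have h2 := Subgroup.relIndex_mul_relIndex ⊥ φ.ker
      (H.subgroupOf (Subgroup.normalizer (P : Set Γ))) bot_le
      (hker.trans (Subgroup.comap_mono hPH))
    rw [Subgroup.relIndex_bot_left, Subgroup.relIndex_bot_left] at h2
    have h1' : φ.ker.relIndex (H.subgroupOf (Subgroup.normalizer (P : Set Γ))) =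
      Nat.card ((H.subgroupOf (Subgroup.normalizer (P : Set Γ))).map φ) := h1
    rw [h1', Nat.card_congr (Subgroup.subgroupOfEquivOfLe hHN).toEquiv] at h2
    rw [mul_comm, ← h2]
  have heq : (H.subgroupOf (Subgroup.normalizer (P : Set Γ))).map φ =
      (K.subgroupOf (Subgroup.normalizer (P : Set Γ))).map φ := by
    refine IsCyclic.subgroup_eq_of_card_eq (C := MulAut P) ?_
    have h3 := (hcardmap H hPH hH).trans (hHK.trans (hcardmap K hPK hK).symm)
    exact Nat.eq_of_mul_eq_mul_right Nat.card_pos h3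
  have := hmap H hPH hH
  rw [heq, hmap K hPK hK, Subgroup.subgroupOf_inj, inf_eq_left.2 hH, inf_eq_left.2 hK] at this
  exact this.symm

theorem exists_normal_subgroup_card_prime {H : Subgroup Γ} {m : ℕ} (hm : m < p)
    (hH : Nat.card H = p * m) :
    ∃ P : Subgroup Γ, Nat.card P = p ∧ P ≤ H ∧ H ≤ Subgroup.normalizer (P : Set Γ) := by
  have hm0 : 0 < m := Nat.pos_of_ne_zero (by rintro rfl; exact Nat.card_pos.ne' hH)
  let S : Sylow p H := default
  have hS : Nat.card S = p := by
    rw [S.card_eq_multiplicity, hH, Nat.factorization_mul hp.out.ne_zero hm0.ne']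
    simp [hp.out.factorization, Nat.factorization_eq_zero_of_lt hm]
  have hSi : (S : Subgroup H).index = m := by
    have := (S : Subgroup H).card_mul_index
    rw [hH] at this
    have hS : Nat.card (S : Subgroup H) = p := hS
    rw [hS] at this
    exact Nat.eq_of_mul_eq_mul_left hp.out.pos this
  have h1 := card_sylow_modEq_one p H
  have h2 := Nat.le_of_dvd hm0 (hSi ▸ S.card_dvd_index)
  have h3 : Nat.card (Sylow p H) = 1 := by
    rw [Nat.ModEq, Nat.mod_eq_of_lt (h2.trans_lt hm), Nat.mod_eq_of_lt hp.out.one_lt] at h1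
    exact h1
  have : Subsingleton (Sylow p H) := (Nat.card_eq_one_iff_unique.1 h3).1
  have hn : (S : Subgroup H).Normal := S.normal_of_subsingleton
  refine ⟨(S : Subgroup H).map H.subtype, ?_, Subgroup.map_subtype_le _, ?_⟩
  · rw [Subgroup.card_map_of_injective H.subtype_injective]
    exact hS
  · intro g hg
    rw [Subgroup.mem_normalizer_iff]
    intro x
    constructor
    · rintro ⟨y, hy, rfl⟩
      exact ⟨⟨g, hg⟩ * y * ⟨g, hg⟩⁻¹, hn.conj_mem y hy _, by simp⟩
    · rintro ⟨y, hy, hyx⟩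
      refine ⟨⟨g, hg⟩⁻¹ * y * ⟨g, hg⟩⁻¹⁻¹, hn.conj_mem y hy _, ?_⟩
      have hyx : (y : Γ) = g * x * g⁻¹ := hyx
      simp [hyx, mul_assoc]

/-- If the Sylow `p`-subgroups have order `p` and are self-centralizing, then subgroups of order
`p * m` with `m < p` are conjugate. -/
theorem exists_conj_map_eq_of_card (hp2 : ¬ p ^ 2 ∣ Nat.card Γ)
    (hC : ∀ P : Subgroup Γ, Nat.card P = p → Subgroup.centralizer (P : Set Γ) ≤ P)
    {H K : Subgroup Γ} {m : ℕ} (hm : m < p) (hH : Nat.card H = p * m) (hK : Nat.card K = p * m) :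
    ∃ g : Γ, H.map (MulAut.conj g).toMonoidHom = K := by
  obtain ⟨P, hP, hPH, hHN⟩ := exists_normal_subgroup_card_prime hm hH
  obtain ⟨Q, hQ, hQK, hKN⟩ := exists_normal_subgroup_card_prime hm hK
  have hpd : p ∣ Nat.card Γ := hP ▸ Subgroup.card_subgroup_dvd_card P
  have hfac : (Nat.card Γ).factorization p = 1 := by
    have h1 := (hp.out.dvd_iff_one_le_factorization Nat.card_pos.ne').1 hpd
    have h2 := mt (hp.out.pow_dvd_iff_le_factorization Nat.card_pos.ne').2 hp2
    lia
  let SP : Sylow p Γ := Sylow.ofCard P (by rw [hfac, hP, pow_one])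
  let SQ : Sylow p Γ := Sylow.ofCard Q (by rw [hfac, hQ, pow_one])
  obtain ⟨g, hg⟩ := MulAction.exists_smul_eq Γ SP SQ
  have hgPQ : P.map (MulAut.conj g).toMonoidHom = Q := congrArg Sylow.toSubgroup hg
  refine ⟨g, subgroup_eq_of_card_eq_of_le_normalizer hQ (hC Q hQ) ?_ hQK ?_ hKN ?_⟩
  · rw [← hgPQ]; exact Subgroup.map_mono hPH
  · rw [← hgPQ]
    rintro _ ⟨h, hh, rfl⟩
    have := hHN hh
    rw [Subgroup.mem_normalizer_iff] at this ⊢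
    intro x
    obtain ⟨x, rfl⟩ := (MulAut.conj g).surjective x
    have e : ∀ y, (MulAut.conj g) y ∈ Subgroup.map (MulAut.conj g).toMonoidHom P ↔ y ∈ P :=
      fun y => Subgroup.mem_map_iff_mem (MulAut.conj g).injective
    change (MulAut.conj g) x ∈ _ ↔ (MulAut.conj g) h * (MulAut.conj g) x * ((MulAut.conj g) h)⁻¹ ∈ _
    rw [← map_inv, ← map_mul, ← map_mul, e, e]
    exact this x
  · rw [Subgroup.card_map_of_injective (MulAut.conj g).injective, hH, hK]

theorem card_of_normal_pSubgroup (hp2 : ¬ p ^ 2 ∣ Nat.card Γ)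
    (hC : ∀ P : Subgroup Γ, Nat.card P = p → Subgroup.centralizer (P : Set Γ) ≤ P)
    {H P : Subgroup Γ} (hPH : P ≤ H) (hn : (P.subgroupOf H).Normal) (hP : IsPGroup p P)
    (hP1 : P ≠ ⊥) : ∃ m, m ∣ p - 1 ∧ Nat.card H = p * m := by
  obtain ⟨n, hn'⟩ := IsPGroup.iff_card.1 hP
  have hPd := Subgroup.card_subgroup_dvd_card P
  have hcard : Nat.card P = p := by
    have h0 : n ≠ 0 := by rintro rfl; exact hP1 (Subgroup.card_eq_one.1 (by simpa using hn'))
    have h2 : n < 2 := by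
      by_contra h
      exact hp2 ((pow_dvd_pow p (not_lt.1 h)).trans (hn' ▸ hPd))
    have : n = 1 := by lia
    rw [hn', this, pow_one]
  obtain ⟨-, hmc⟩ := isCyclic_mulAut_of_card_prime hcard
  have hHN : H ≤ Subgroup.normalizer (P : Set Γ) := by
    rwa [Subgroup.normal_subgroupOf_iff_le_normalizer hPH] at hn
  let ψ : H →* MulAut P := P.normalizerMonoidHom.comp (Subgroup.inclusion hHN)
  have hker : ψ.ker ≤ P.subgroupOf H := by
    intro x hx
    have : Subgroup.inclusion hHN x ∈ P.normalizerMonoidHom.ker := hx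
    rw [Subgroup.normalizerMonoidHom_ker] at this
    exact hC P hcard this
  have hPc : IsCyclic P := isCyclic_of_prime_card hcard
  have hker' : ψ.ker = P.subgroupOf H := by
    refine le_antisymm hker fun x hx => ?_
    have : Subgroup.inclusion hHN x ∈ P.normalizerMonoidHom.ker := by
      rw [Subgroup.normalizerMonoidHom_ker]
      change (x : Γ) ∈ Subgroup.centralizer (P : Set Γ)
      rw [Subgroup.mem_centralizer_iff]
      intro y hy
      exact congrArg Subtype.val ((hPc.commGroup).mul_comm ⟨y, hy⟩ ⟨x, hx⟩)
    exact this
  have h1 : ψ.ker.index ∣ p - 1 := by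
    rw [Subgroup.index_ker, ← hmc]
    exact Subgroup.card_subgroup_dvd_card _
  refine ⟨ψ.ker.index, h1, ?_⟩
  rw [← ψ.ker.card_mul_index, hker',
    Nat.card_congr (Subgroup.subgroupOfEquivOfLe hPH).toEquiv, hcard]

end SylowCyclic

section AlternatingPrime

variable {p : ℕ} [hp : Fact p.Prime]

theorem not_sq_dvd_factorial_add_two (hodd : p ≠ 2) : ¬ p ^ 2 ∣ (p + 2).factorial := by
  have hpp := hp.out
  have h2 : ¬ p ∣ 2 := fun h => hodd ((Nat.prime_dvd_prime_iff_eq hpp Nat.prime_two).1 h)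
  obtain ⟨q, rfl⟩ : ∃ q, p = q + 1 := ⟨p - 1, by have := hpp.pos; lia⟩
  intro h
  rw [Nat.factorial_succ, Nat.factorial_succ, Nat.factorial_succ, sq,
    show (q + 1 + 1 + 1) * ((q + 1 + 1) * ((q + 1) * q.factorial)) =
      (q + 1) * ((q + 1 + 2) * ((q + 1 + 1) * q.factorial)) by ring] at h
  have h := Nat.dvd_of_mul_dvd_mul_left hpp.pos h
  rcases hpp.dvd_mul.1 h with h | h
  · exact h2 ((Nat.dvd_add_right dvd_rfl).1 h)
  rcases hpp.dvd_mul.1 h with h | h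
  · exact hpp.one_lt.ne' (Nat.dvd_one.1 ((Nat.dvd_add_right dvd_rfl).1 h))
  · have := (hpp.dvd_factorial).1 h
    lia

theorem not_sq_dvd_card_alternatingGroup (hodd : p ≠ 2) :
    ¬ p ^ 2 ∣ Nat.card (alternatingGroup (Fin (p + 2))) := by
  intro h
  apply not_sq_dvd_factorial_add_two hodd
  have h2 := two_mul_nat_card_alternatingGroup (α := Fin (p + 2))
  rw [Nat.card_perm, Nat.card_eq_fintype_card (α := Fin (p + 2)), Fintype.card_fin] at h2
  rw [← h2]
  exact Dvd.dvd.mul_left h 2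

theorem cycleType_of_orderOf_prime (hodd : p ≠ 2) {α : Type*} [Fintype α] [DecidableEq α]
    (hα : Fintype.card α = p + 2) {g : Equiv.Perm α} (hg : orderOf g = p) :
    g.cycleType = {p} := by
  have h2 := hp.out.two_le
  obtain ⟨n, hn⟩ := Equiv.Perm.cycleType_prime_order (hg.symm ▸ hp.out)
  have h1 := g.sum_cycleType_le
  rw [hn, hg, Multiset.sum_replicate, hα, smul_eq_mul] at h1
  have : n = 0 := by
    by_contra h
    have : 2 ≤ n + 1 := by lia
    have := Nat.mul_le_mul_right p this
    have : p ≤ 2 := by lia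
    lia
  rw [hn, this, hg]
  rfl

theorem centralizer_le_of_card_prime (hodd : p ≠ 2) (P : Subgroup (alternatingGroup (Fin (p + 2))))
    (hP : Nat.card P = p) :
    Subgroup.centralizer (P : Set (alternatingGroup (Fin (p + 2)))) ≤ P := by
  classical
  have hPc : IsCyclic P := isCyclic_of_prime_card hP
  obtain ⟨g, hg⟩ := IsCyclic.exists_ofOrder_eq_natCard (α := P)
  rw [hP] at hg
  have hg' : orderOf (g : Equiv.Perm (Fin (p + 2))) = p := by
    rw [Subgroup.orderOf_coe, Subgroup.orderOf_coe, hg]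
  have hct := cycleType_of_orderOf_prime hodd (by simp) hg'
  let Z := Subgroup.centralizer {(g : Equiv.Perm (Fin (p + 2)))}
  have hZ : Nat.card Z = 2 * p := by
    rw [Equiv.Perm.nat_card_centralizer, hct]
    simp
  let C := Subgroup.centralizer (P : Set (alternatingGroup (Fin (p + 2))))
  have hPC : P ≤ C := by
    intro x hx
    rw [Subgroup.mem_centralizer_iff]
    intro y hy
    exact congrArg Subtype.val ((hPc.commGroup).mul_comm ⟨y, hy⟩ ⟨x, hx⟩)
  have hCZ : C.map (alternatingGroup (Fin (p + 2))).subtype ≤ Z := by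
    rintro _ ⟨c, hc, rfl⟩
    rw [Subgroup.mem_centralizer_singleton_iff]
    exact congrArg Subtype.val (Subgroup.mem_centralizer_iff.1 hc g g.2).symm
  have hcard := Subgroup.card_map_of_injective
    (K := C) (alternatingGroup (Fin (p + 2))).subtype_injective
  have hne : C.map (alternatingGroup (Fin (p + 2))).subtype ≠ Z := by
    intro h
    have := Equiv.Perm.card_le_of_centralizer_le_alternating
      (g := (g : Equiv.Perm (Fin (p + 2)))) (h.symm.le.trans (Subgroup.map_subtype_le C))
    rw [hct] at this
    simp at this
  have hd1 : Nat.card C ∣ 2 * p := hcard ▸ hZ ▸ Subgroup.card_dvd_of_le hCZ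
  have hd2 : p ∣ Nat.card C := by
    have := Subgroup.card_dvd_of_le hPC
    rwa [hP] at this
  have hCp : Nat.card C = p := by
    obtain ⟨c, hc⟩ := hd2
    rw [hc, mul_comm 2 p] at hd1
    have := Nat.dvd_of_mul_dvd_mul_left hp.out.pos hd1
    rcases (Nat.dvd_prime Nat.prime_two).1 this with rfl | rfl
    · rw [hc, mul_one]
    · exfalso
      apply hne
      refine Subgroup.eq_of_le_of_card_ge hCZ ?_
      rw [hcard, hc, hZ, mul_comm]
  exact (Subgroup.eq_of_le_of_card_ge hPC (by rw [hP]; exact hCp.le)).symm.le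

theorem not_sq_dvd_card_of_mulEquiv (hodd : p ≠ 2) {Γ : Type*} [Group Γ]
    (e : Γ ≃* alternatingGroup (Fin (p + 2))) : ¬ p ^ 2 ∣ Nat.card Γ := by
  rw [Nat.card_congr e.toEquiv]
  exact not_sq_dvd_card_alternatingGroup hodd

theorem centralizer_le_of_mulEquiv (hodd : p ≠ 2) {Γ : Type*} [Group Γ]
    (e : Γ ≃* alternatingGroup (Fin (p + 2))) (P : Subgroup Γ) (hP : Nat.card P = p) :
    Subgroup.centralizer (P : Set Γ) ≤ P := by
  intro x hx
  have h := centralizer_le_of_card_prime hodd (P.map e.toMonoidHom)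
    (by rw [Subgroup.card_map_of_injective e.injective, hP])
  have : e x ∈ P.map e.toMonoidHom := by
    apply h
    rw [Subgroup.mem_centralizer_iff]
    rintro _ ⟨y, hy, rfl⟩
    have := Subgroup.mem_centralizer_iff.1 hx y hy
    change e y * e x = e x * e y
    rw [← map_mul, this, map_mul]
  exact (Subgroup.mem_map_iff_mem e.injective).1 this

end AlternatingPrime

section DoubleThreeCycles

open Equiv Equiv.Perm MulAction

theorem Equiv.Perm.eq_viaEmbedding {α β : Type*} {ι : α ↪ β} {w : Perm α} {π : Perm β}
    (h : ∀ i, π (ι i) = ι (w i)) (h' : ∀ x, x ∉ Set.range ι → π x = x) :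
    π = viaEmbeddingHom ι w := by
  ext x
  rw [viaEmbeddingHom_apply]
  by_cases hx : x ∈ Set.range ι
  · obtain ⟨i, rfl⟩ := hx
    rw [h, viaEmbedding_apply]
  · rw [h' x hx, viaEmbedding_apply_of_notMem _ _ _ hx]

theorem Equiv.Perm.viaEmbeddingHom_swap {α β : Type*} [DecidableEq α] [DecidableEq β]
    (ι : α ↪ β) (a b : α) : viaEmbeddingHom ι (swap a b) = swap (ι a) (ι b) := by
  symm
  apply eq_viaEmbedding
  · intro i
    rw [ι.injective.swap_apply]
  · intro x hx
    exact swap_apply_of_ne_of_ne (fun h => hx ⟨a, h.symm⟩) (fun h => hx ⟨b, h.symm⟩)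

theorem Equiv.Perm.cycleType_viaEmbeddingHom {α β : Type*} [Fintype α] [DecidableEq α]
    [Fintype β] [DecidableEq β] (ι : α ↪ β) (w : Perm α) :
    (viaEmbeddingHom ι w).cycleType = w.cycleType := by
  rw [viaEmbeddingHom_apply, viaEmbedding]
  convert! cycleType_extendDomain _

theorem exists_embedding_of_pattern {α β γ : Type*} {ι ι' : α ↪ β} (A B : α → γ)
    (hs : ∀ t, (∃ i, A i = t) ∨ ∃ j, B j = t) (hA : Function.Injective A)
    (hB : Function.Injective B) (h : ∀ i j, A i = B j ↔ ι i = ι' j) :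
    ∃ J : γ ↪ β, (∀ i, J (A i) = ι i) ∧ ∀ j, J (B j) = ι' j := by
  classical
  have key : ∀ t, ∃ y, (∀ i, A i = t → ι i = y) ∧ (∀ j, B j = t → ι' j = y) ∧
      ((∃ i, A i = t ∧ ι i = y) ∨ ∃ j, B j = t ∧ ι' j = y) := by
    intro t
    rcases hs t with ⟨i, rfl⟩ | ⟨j, rfl⟩
    · exact ⟨ι i, fun i' hi' => by rw [hA hi'], fun j hj => ((h i j).1 hj.symm).symm,
        Or.inl ⟨i, rfl, rfl⟩⟩
    · exact ⟨ι' j, fun i hi => (h i j).1 hi, fun j' hj' => by rw [hB hj'],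
        Or.inr ⟨j, rfl, rfl⟩⟩
  choose J h1 h2 h3 using key
  refine ⟨⟨J, ?_⟩, fun i => (h1 _ i rfl).symm, fun j => (h2 _ j rfl).symm⟩
  intro s t hst
  rcases h3 s with ⟨i, rfl, hi⟩ | ⟨j, rfl, hj⟩ <;> rcases h3 t with ⟨i', rfl, hi'⟩ | ⟨j', rfl, hj'⟩
  · rw [ι.injective (hi.trans (hst.trans hi'.symm))]
  · exact (h _ _).2 (hi.trans (hst.trans hj'.symm))
  · exact ((h _ _).2 (hi'.trans (hst.symm.trans hj.symm))).symm
  · rw [ι'.injective (hj.trans (hst.trans hj'.symm))]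

theorem Equiv.Perm.IsCycle.exists_pow_card_lt {α : Type*} [Fintype α] [DecidableEq α]
    {σ : Perm α} (hσ : σ.IsCycle) (T : Finset α) (hT : T ⊆ σ.support) (c : ℕ)
    (hc : T.offDiag.card < c * (orderOf σ - 1)) :
    ∃ i : ℕ, 0 < i ∧ i < orderOf σ ∧ (T.offDiag.filter fun q => (σ ^ i) q.1 = q.2).card < c := by
  by_contra! h
  have h1 := Finset.sum_card_bipartiteAbove_eq_sum_card_bipartiteBelow
    (s := Finset.Ioo 0 (orderOf σ)) (t := T.offDiag) (r := fun i q => (σ ^ i) q.1 = q.2)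
  have h2 : ∑ i ∈ Finset.Ioo 0 (orderOf σ), c ≤ ∑ i ∈ Finset.Ioo 0 (orderOf σ),
      (Finset.bipartiteAbove (fun i q => (σ ^ i) q.1 = q.2) T.offDiag i).card := by
    apply Finset.sum_le_sum
    intro i hi
    rw [Finset.mem_Ioo] at hi
    exact h i hi.1 hi.2
  have h3 : ∑ q ∈ T.offDiag, (Finset.bipartiteBelow (fun i q => (σ ^ i) q.1 = q.2)
      (Finset.Ioo 0 (orderOf σ)) q).card ≤ ∑ q ∈ T.offDiag, 1 := by
    apply Finset.sum_le_sum
    intro q hq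
    rw [Finset.mem_offDiag] at hq
    rw [Finset.card_le_one]
    intro i hi j hj
    rw [Finset.mem_bipartiteBelow, Finset.mem_Ioo] at hi hj
    have : σ ^ i = σ ^ j := hσ.pow_eq_pow_iff.2
      ⟨q.1, mem_support.1 (hT hq.1), hi.2.trans hj.2.symm⟩
    exact pow_injOn_Iio_orderOf (Set.mem_Iio.2 hi.1.2) (Set.mem_Iio.2 hj.1.2) this
  rw [Finset.sum_const, smul_eq_mul, Nat.card_Ioo] at h2
  rw [Finset.sum_const, smul_eq_mul, mul_one] at h3
  have : (orderOf σ - 0 - 1) * c = c * (orderOf σ - 1) := by rw [mul_comm]; rfl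
  lia

/-- The permutation `(v 0 v 1 v 2)(v 3 v 4 v 5)`. -/
def doubleThreeCycle {β : Type*} [DecidableEq β] (v : Fin 6 → β) : Perm β :=
  swap (v 0) (v 1) * swap (v 1) (v 2) * (swap (v 3) (v 4) * swap (v 4) (v 5))

/-- The permutation `(v 0 v 1)(v 2 v 3)`. -/
def doubleTwoCycle {β : Type*} [DecidableEq β] (v : Fin 4 → β) : Perm β :=
  swap (v 0) (v 1) * swap (v 2) (v 3)

section

variable {β γ : Type*} [DecidableEq β] [DecidableEq γ]

theorem viaEmbeddingHom_doubleThreeCycle (J : β ↪ γ) (v : Fin 6 → β) :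
    viaEmbeddingHom J (doubleThreeCycle v) = doubleThreeCycle fun i => J (v i) := by
  simp only [doubleThreeCycle, map_mul, viaEmbeddingHom_swap]

theorem viaEmbeddingHom_doubleTwoCycle (J : β ↪ γ) (v : Fin 4 → β) :
    viaEmbeddingHom J (doubleTwoCycle v) = doubleTwoCycle fun i => J (v i) := by
  simp only [doubleTwoCycle, map_mul, viaEmbeddingHom_swap]

theorem conj_swap (τ : Perm β) (a b : β) : τ * swap a b * τ⁻¹ = swap (τ a) (τ b) :=
  (Equiv.swap_apply_apply τ a b).symm

theorem conj_doubleThreeCycle (τ : Perm β) (v : Fin 6 → β) :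
    τ * doubleThreeCycle v * τ⁻¹ = doubleThreeCycle fun i => τ (v i) := by
  simp only [doubleThreeCycle, ← conj_swap]
  group

theorem conj_doubleTwoCycle (τ : Perm β) (v : Fin 4 → β) :
    τ * doubleTwoCycle v * τ⁻¹ = doubleTwoCycle fun i => τ (v i) := by
  simp only [doubleTwoCycle, ← conj_swap]
  group

end

theorem cycleType_eq_of_orderOf_three {α : Type*} [Fintype α] [DecidableEq α] {z : Perm α}
    (h3 : orderOf z = 3) (hz : z.support.card ≤ 6) (hz' : ¬ z.IsThreeCycle) :
    z.cycleType = {3, 3} := by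
  obtain ⟨n, hn⟩ := cycleType_prime_order (σ := z) (h3.symm ▸ Nat.prime_three)
  rw [h3] at hn
  have hs := z.sum_cycleType
  rw [hn, Multiset.sum_replicate, smul_eq_mul] at hs
  have : n ≤ 1 := by lia
  interval_cases n
  · exact (hz' hn).elim
  · exact hn

theorem exists_eq_doubleThreeCycle {α : Type*} [Fintype α] [DecidableEq α] {z : Perm α}
    (h3 : orderOf z = 3) (hz : z.support.card ≤ 6) (hz' : ¬ z.IsThreeCycle) :
    ∃ ι : Fin 6 ↪ α, z = doubleThreeCycle ι := by
  have hc := cycleType_eq_of_orderOf_three h3 hz hz'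
  have h6 : 6 ≤ Fintype.card α := by
    have := z.sum_cycleType_le
    rw [hc] at this
    exact this
  obtain ⟨κ⟩ : Nonempty (Fin 6 ↪ α) := Function.Embedding.nonempty_of_card_le (by simpa using h6)
  have hd : (doubleThreeCycle κ).cycleType = {3, 3} := by
    have : doubleThreeCycle κ = viaEmbeddingHom κ (doubleThreeCycle id) := by
      rw [viaEmbeddingHom_doubleThreeCycle]; rfl
    rw [this, cycleType_viaEmbeddingHom]
    have hs : (doubleThreeCycle (id : Fin 6 → Fin 6)).support.card = 6 := by decide +kernel
    apply cycleType_eq_of_orderOf_three _ hs.le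
    · intro h
      rw [← card_support_eq_three_iff, hs] at h
      norm_num at h
    · exact orderOf_eq_prime (by decide +kernel) (by decide +kernel)
  obtain ⟨τ, hτ⟩ := isConj_iff.1 (isConj_iff_cycleType_eq.2 (hd.trans hc.symm))
  refine ⟨κ.trans τ.toEmbedding, ?_⟩
  rw [← hτ, conj_doubleThreeCycle]
  rfl

/-- The injection of `Fin 6` into `Fin 9` which agrees with the inclusion `Fin 6 ⊆ Fin 9` at
`0` and `1`, sends `y` to `x`, and sends the other points outside `Fin 6`. -/
def overlapPattern (x y j : Fin 6) : Fin 9 :=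
  if j = 0 then 0 else if j = 1 then 1 else if j = y then Fin.castLE (by norm_num) x
  else if j < y then ⟨(j + 4) % 9, Nat.mod_lt _ (by norm_num)⟩
  else ⟨(j + 3) % 9, Nat.mod_lt _ (by norm_num)⟩

theorem overlapPattern_surj : ∀ x y : Fin 6, 2 ≤ x → 2 ≤ y → ∀ t : Fin 9,
    (∃ i : Fin 6, Fin.castLE (by norm_num) i = t) ∨ ∃ j, overlapPattern x y j = t := by
  decide +kernel

theorem overlapPattern_inj : ∀ x y : Fin 6, 2 ≤ x → 2 ≤ y →
    ∀ i j, overlapPattern x y i = overlapPattern x y j → i = j := by decide +kernel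

theorem overlapPattern_eq : ∀ x y : Fin 6, 2 ≤ x → 2 ≤ y → ∀ i j : Fin 6,
    Fin.castLE (by norm_num) i = overlapPattern x y j ↔ ((i = j ∧ i < 2) ∨ (i = x ∧ j = y)) := by
  decide +kernel

theorem card_support_overlapPattern : ∀ x y : Fin 6, 2 ≤ x → 2 ≤ y → (x = 2 → y ≠ 2) →
    ((doubleThreeCycle (Fin.castLE (by norm_num : 6 ≤ 9)) *
      (doubleThreeCycle (overlapPattern x y))⁻¹) ^ 20).support.card = 3 := by
  decide +kernel

/-- Two double three-cycles `(a b c)(d e f)`, `(a b x)(y z w)` sharing exactly one further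
point, not in the position of both `c` and `x`, generate a three-cycle. -/
theorem isThreeCycle_of_overlap {α : Type*} [Fintype α] [DecidableEq α] {ι ι' : Fin 6 ↪ α}
    {x y : Fin 6} (hx : 2 ≤ x) (hy : 2 ≤ y) (hxy : x = 2 → y ≠ 2)
    (h : ∀ i j, ι i = ι' j ↔ ((i = j ∧ i < 2) ∨ (i = x ∧ j = y))) :
    ((doubleThreeCycle ι * (doubleThreeCycle ι')⁻¹) ^ 20).IsThreeCycle := by
  obtain ⟨J, hJ, hJ'⟩ := exists_embedding_of_pattern (ι := ι) (ι' := ι')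
    (Fin.castLE (by norm_num : 6 ≤ 9)) (overlapPattern x y)
    (overlapPattern_surj x y hx hy) (Fin.castLE_injective _) (overlapPattern_inj x y hx hy)
    (fun i j => (overlapPattern_eq x y hx hy i j).trans (h i j).symm)
  have h1 : doubleThreeCycle ι =
      viaEmbeddingHom J (doubleThreeCycle (Fin.castLE (by norm_num))) := by
    rw [viaEmbeddingHom_doubleThreeCycle]; simp only [hJ]
  have h2 : doubleThreeCycle ι' = viaEmbeddingHom J (doubleThreeCycle (overlapPattern x y)) := by
    rw [viaEmbeddingHom_doubleThreeCycle]; simp only [hJ']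
  rw [h1, h2, ← map_inv, ← map_mul, ← map_pow, IsThreeCycle, cycleType_viaEmbeddingHom]
  exact card_support_eq_three_iff.1 (card_support_overlapPattern x y hx hy hxy)

/-- The injection of `Fin 6` into `Fin 10` which agrees with the inclusion `Fin 6 ⊆ Fin 10` exactly
at `0` and `1`. -/
def disjointPattern (j : Fin 6) : Fin 10 :=
  if j < 2 then Fin.castLE (by norm_num) j else Fin.natAdd 4 j

theorem exists_doubleTwoCycle_of_disjoint {α : Type*} [Fintype α] [DecidableEq α]
    {ι ι' : Fin 6 ↪ α}
    (h : ∀ i j, ι i = ι' j ↔ i = j ∧ i < 2) :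
    ∃ κ : Fin 4 ↪ α, doubleThreeCycle ι * doubleThreeCycle ι' * (doubleThreeCycle ι)⁻¹ *
      (doubleThreeCycle ι')⁻¹ = doubleTwoCycle κ := by
  obtain ⟨J, hJ, hJ'⟩ := exists_embedding_of_pattern (ι := ι) (ι' := ι')
    (Fin.castLE (by norm_num : 6 ≤ 10)) disjointPattern
    (by decide +kernel) (Fin.castLE_injective _) (by unfold Function.Injective; decide +kernel)
    (fun i j => Iff.trans (by revert i j; decide +kernel) (h i j).symm)
  have h1 : doubleThreeCycle ι =
      viaEmbeddingHom J (doubleThreeCycle (Fin.castLE (by norm_num))) := by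
    rw [viaEmbeddingHom_doubleThreeCycle]; simp only [hJ]
  have h2 : doubleThreeCycle ι' = viaEmbeddingHom J (doubleThreeCycle disjointPattern) := by
    rw [viaEmbeddingHom_doubleThreeCycle]; simp only [hJ']
  obtain ⟨v, hv, hw⟩ : ∃ v : Fin 4 → Fin 10, Function.Injective v ∧
      doubleThreeCycle (Fin.castLE (by norm_num : 6 ≤ 10)) * doubleThreeCycle disjointPattern *
      (doubleThreeCycle (Fin.castLE (by norm_num : 6 ≤ 10)))⁻¹ *
      (doubleThreeCycle disjointPattern)⁻¹ = doubleTwoCycle v := by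
    refine ⟨![0, 1, 2, 6], ?_, ?_⟩
    · unfold Function.Injective; decide +kernel
    · decide +kernel
  refine ⟨(Function.Embedding.mk v hv).trans J, ?_⟩
  rw [h1, h2]
  simp only [← map_inv, ← map_mul, hw, viaEmbeddingHom_doubleTwoCycle]
  rfl

theorem isThreeCycle_of_overlap_zero {α : Type*} [Fintype α] [DecidableEq α] {ι ι' : Fin 4 ↪ α}
    (h : ∀ i j, ι i = ι' j ↔ i = 0 ∧ j = 0) :
    ((doubleTwoCycle ι * doubleTwoCycle ι') ^ 2).IsThreeCycle := by
  obtain ⟨J, hJ, hJ'⟩ := exists_embedding_of_pattern (ι := ι) (ι' := ι')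
    (Fin.castLE (by norm_num : 4 ≤ 7)) ![0, 4, 5, 6]
    (by decide +kernel) (Fin.castLE_injective _) (by unfold Function.Injective; decide +kernel)
    (fun i j => Iff.trans (by revert i j; decide +kernel) (h i j).symm)
  have h1 : doubleTwoCycle ι = viaEmbeddingHom J (doubleTwoCycle (Fin.castLE (by norm_num))) := by
    rw [viaEmbeddingHom_doubleTwoCycle]; simp only [hJ]
  have h2 : doubleTwoCycle ι' = viaEmbeddingHom J (doubleTwoCycle ![0, 4, 5, 6]) := by
    rw [viaEmbeddingHom_doubleTwoCycle]; simp only [hJ']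
  rw [h1, h2, ← map_mul, ← map_pow, IsThreeCycle, cycleType_viaEmbeddingHom]
  refine card_support_eq_three_iff.1 ?_
  decide +kernel

end DoubleThreeCycles

section Recognition

open Equiv Equiv.Perm MulAction

variable {α : Type*} [Fintype α] [DecidableEq α]

theorem Equiv.Perm.isPreprimitive_of_isCycle_prime {H : Subgroup (Perm α)} [IsPretransitive H α]
    {σ : Perm α} (hσH : σ ∈ H) (hσ : σ.IsCycle) (hp : σ.support.card.Prime)
    (hn : Fintype.card α < 2 * σ.support.card) : IsPreprimitive H α := by
  have := Equiv.Perm.isPretransitive_of_isCycle_mem hσ hσH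
  have hc : Nat.card (SubMulAction.ofFixingSubgroup H (σ.support : Set α)ᶜ) = σ.support.card := by
    rw [← Nat.card_eq_finsetCard]
    refine Nat.card_congr (Equiv.subtypeEquivRight fun x => ?_)
    rw [SubMulAction.mem_ofFixingSubgroup_iff, Set.mem_compl_iff, not_not, Finset.mem_coe]
  have := IsPreprimitive.of_prime_card (G := fixingSubgroup H (σ.support : Set α)ᶜ)
    (X := SubMulAction.ofFixingSubgroup H (σ.support : Set α)ᶜ) (hc ▸ hp)
  let f : SubMulAction.ofFixingSubgroup H (σ.support : Set α)ᶜ →ₑ[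
      (fixingSubgroup H (σ.support : Set α)ᶜ).subtype] α :=
    { toFun := Subtype.val, map_smul' := fun _ _ => rfl }
  refine IsPreprimitive.of_card_lt (f := f) ?_
  have : (Set.range f).ncard = σ.support.card := by
    rw [← hc, ← Set.image_univ, Set.ncard_image_of_injective (f := f) _ Subtype.val_injective,
      Set.ncard_univ]
  rw [this, Nat.card_eq_fintype_card]
  exact hn

theorem Equiv.Perm.isTwoPretransitive_of_isCycle_prime {H : Subgroup (Perm α)}
    (hH : IsPreprimitive H α) {σ : Perm α} (hσH : σ ∈ H) (hσ : σ.IsCycle)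
    (hn : Fintype.card α = σ.support.card + 2) : IsMultiplyPretransitive H α 2 := by
  have := Equiv.Perm.isPretransitive_of_isCycle_mem hσ hσH
  have h2 := hσ.two_le_card_support
  refine hH.is_two_pretransitive (s := (σ.support : Set α)ᶜ) (n := 1) ?_ ?_ this
  · apply Nat.add_left_cancel (n := (σ.support : Set α).ncard)
    rw [Set.ncard_add_ncard_compl, Set.ncard_coe_finset, Nat.card_eq_fintype_card, hn]
  · rw [Nat.card_eq_fintype_card]; lia

theorem Equiv.Perm.exists_isThreeCycle_mem_of_doubleTwoCycle {H : Subgroup (Perm α)}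
    (hH : IsMultiplyPretransitive H α 2) {σ : Perm α} (hσH : σ ∈ H) (hσ : σ.IsCycle)
    (hn : Fintype.card α = σ.support.card + 2) (hp : 8 ≤ σ.support.card) {ι : Fin 4 ↪ α}
    (hι : doubleTwoCycle ι ∈ H) : ∃ g ∈ H, g.IsThreeCycle := by
  obtain ⟨a, b, hab, hs⟩ : ∃ a b, a ≠ b ∧ σ.supportᶜ = {a, b} := by
    rw [← Finset.card_eq_two, Finset.card_compl]; lia
  have hfix : ∀ x, σ x = x ↔ x = a ∨ x = b := fun x => by
    have := Finset.ext_iff.1 hs x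
    simpa [notMem_support] using this
  obtain ⟨y, hy⟩ : ∃ y, y ∉ Set.range ι := by
    by_contra! h
    have := Fintype.card_le_of_surjective ι h
    rw [Fintype.card_fin] at this; lia
  have h0y : ι 0 ≠ y := fun h => hy ⟨0, h⟩
  obtain ⟨τ, hτa, hτb⟩ := (is_two_pretransitive_iff (G := H)).1 hH h0y hab
  let κ : Fin 4 ↪ α := ι.trans (τ : Perm α).toEmbedding
  have hκ : doubleTwoCycle κ ∈ H := by
    have := H.mul_mem (H.mul_mem τ.2 hι) (H.inv_mem τ.2)
    rwa [conj_doubleTwoCycle] at this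
  have hκ0 : κ 0 = a := hτa
  have hκb : ∀ i, κ i ≠ b := fun i h => hy ⟨i, (τ : Perm α).injective (h.trans hτb.symm)⟩
  let T : Finset α := (Finset.univ.erase 0).map κ
  have hT : T ⊆ σ.support := by
    intro t ht
    obtain ⟨i, hi, rfl⟩ := Finset.mem_map.1 ht
    rw [mem_support, ne_eq, hfix, not_or]
    refine ⟨fun h => Finset.ne_of_mem_erase hi (κ.injective (h.trans hκ0.symm)), hκb i⟩
  obtain ⟨i, hi0, hi, hc⟩ := hσ.exists_pow_card_lt T hT 1 (by
    rw [hσ.orderOf, Finset.offDiag_card, Finset.card_map, Finset.card_erase_of_mem (by simp)]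
    simp only [Finset.card_univ, Fintype.card_fin]; lia)
  rw [Nat.lt_one_iff, Finset.card_eq_zero, Finset.filter_eq_empty_iff] at hc
  have hfi : ∀ j, 0 < j → j < orderOf σ → ∀ x, (σ ^ j) x = x → x = a ∨ x = b := by
    intro j hj0 hj x hx
    rw [← hfix]
    by_contra h
    have := (hσ.pow_eq_one_iff' h).2 hx
    exact pow_ne_one_of_lt_orderOf hj0.ne' hj this
  have hfa : (σ ^ i) a = a := pow_apply_eq_self_of_apply_eq_self ((hfix a).2 (Or.inl rfl)) i
  let κ' : Fin 4 ↪ α := κ.trans (σ ^ i).toEmbedding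
  have hκ' : doubleTwoCycle κ' ∈ H := by
    have := H.mul_mem (H.mul_mem (H.pow_mem hσH i) hκ) (H.inv_mem (H.pow_mem hσH i))
    rwa [conj_doubleTwoCycle] at this
  refine ⟨_, H.pow_mem (H.mul_mem hκ hκ') 2, isThreeCycle_of_overlap_zero ?_⟩
  intro u v
  constructor
  · intro h
    have h : κ u = (σ ^ i) (κ v) := h
    by_cases hu : u = 0
    · refine ⟨hu, ?_⟩
      rw [hu, hκ0] at h
      have := (σ ^ i).injective (h.symm.trans hfa.symm)
      exact κ.injective (this.trans hκ0.symm)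
    · exfalso
      have hv : v ≠ 0 := by
        rintro rfl
        rw [hκ0, hfa, ← hκ0] at h
        exact hu (κ.injective h)
      have huT : κ u ∈ T := Finset.mem_map_of_mem κ (Finset.mem_erase.2 ⟨hu, Finset.mem_univ _⟩)
      have hvT : κ v ∈ T := Finset.mem_map_of_mem κ (Finset.mem_erase.2 ⟨hv, Finset.mem_univ _⟩)
      by_cases huv : κ v = κ u
      · rw [← huv] at h
        rcases hfi i hi0 hi _ h.symm with h' | h'
        · exact hv (κ.injective (h'.trans hκ0.symm))
        · exact hκb _ h'
      · exact hc (x := (κ v, κ u)) (Finset.mem_offDiag.2 ⟨hvT, huT, huv⟩) h.symm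
  · rintro ⟨rfl, rfl⟩
    change κ 0 = (σ ^ i) (κ 0)
    rw [hκ0, hfa]

theorem Equiv.Perm.exists_isThreeCycle_mem {H : Subgroup (Perm α)}
    (hH : IsMultiplyPretransitive H α 2) {σ : Perm α} (hσH : σ ∈ H) (hσ : σ.IsCycle)
    (hn : Fintype.card α = σ.support.card + 2) (hp : 8 ≤ σ.support.card) {z : Perm α}
    (hzH : z ∈ H) (hz3 : orderOf z = 3) (hz6 : z.support.card ≤ 6) :
    ∃ g ∈ H, g.IsThreeCycle := by
  by_cases hz : z.IsThreeCycle
  · exact ⟨z, hzH, hz⟩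
  obtain ⟨ι, rfl⟩ := exists_eq_doubleThreeCycle hz3 hz6 hz
  obtain ⟨a, b, hab, hs⟩ : ∃ a b, a ≠ b ∧ σ.supportᶜ = {a, b} := by
    rw [← Finset.card_eq_two, Finset.card_compl]; lia
  have hfix : ∀ x, σ x = x ↔ x = a ∨ x = b := fun x => by
    have := Finset.ext_iff.1 hs x
    simpa [notMem_support] using this
  have h01 : ι 0 ≠ ι 1 := fun h => by simpa using ι.injective h
  obtain ⟨τ, hτa, hτb⟩ := (is_two_pretransitive_iff (G := H)).1 hH h01 hab
  let κ : Fin 6 ↪ α := ι.trans (τ : Perm α).toEmbedding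
  have hκ : doubleThreeCycle κ ∈ H := by
    have := H.mul_mem (H.mul_mem τ.2 hzH) (H.inv_mem τ.2)
    rwa [conj_doubleThreeCycle] at this
  have hκ0 : κ 0 = a := hτa
  have hκ1 : κ 1 = b := hτb
  have hlt : ∀ u : Fin 6, ¬ 2 ≤ u → u = 0 ∨ u = 1 := by decide
  have hge : ∀ u : Fin 6, 2 ≤ u → u ≠ 0 ∧ u ≠ 1 := by decide
  let T : Finset α := (Finset.univ.filter fun u : Fin 6 => 2 ≤ u).map κ
  have hT : T ⊆ σ.support := by
    intro t ht
    obtain ⟨i, hi, rfl⟩ := Finset.mem_map.1 ht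
    have hi := hge i (Finset.mem_filter.1 hi).2
    rw [mem_support, ne_eq, hfix, not_or]
    exact ⟨fun h => hi.1 (κ.injective (h.trans hκ0.symm)),
      fun h => hi.2 (κ.injective (h.trans hκ1.symm))⟩
  have hTmem : ∀ u : Fin 6, 2 ≤ u → κ u ∈ T := fun u hu =>
    Finset.mem_map_of_mem κ (Finset.mem_filter.2 ⟨Finset.mem_univ _, hu⟩)
  obtain ⟨i, hi0, hi, hc⟩ := hσ.exists_pow_card_lt T hT 2 (by
    have : (Finset.univ.filter fun u : Fin 6 => 2 ≤ u).card = 4 := by decide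
    rw [hσ.orderOf, Finset.offDiag_card, Finset.card_map, this]
    lia)
  rw [Nat.lt_succ_iff, Finset.card_le_one] at hc
  have hne : ∀ x ∈ T, (σ ^ i) x ≠ x := by
    intro x hx h
    have := (hσ.pow_eq_one_iff' (mem_support.1 (hT hx))).2 h
    exact pow_ne_one_of_lt_orderOf hi0.ne' hi this
  have hf : ∀ x, σ x = x → (σ ^ i) x = x := fun x hx => pow_apply_eq_self_of_apply_eq_self hx i
  let κ' : Fin 6 ↪ α := κ.trans (σ ^ i).toEmbedding
  have hκ' : doubleThreeCycle κ' ∈ H := by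
    have := H.mul_mem (H.mul_mem (H.pow_mem hσH i) hκ) (H.inv_mem (H.pow_mem hσH i))
    rwa [conj_doubleThreeCycle] at this
  have hκ'f : ∀ v : Fin 6, ¬ 2 ≤ v → κ' v = κ v := by
    intro v hv
    apply hf
    rw [hfix]
    rcases hlt v hv with rfl | rfl
    exacts [Or.inl hκ0, Or.inr hκ1]
  have hκ's : ∀ v, κ' v = (σ ^ i) (κ v) := fun v => rfl
  have hmix : ∀ u v : Fin 6, κ u = κ' v → (u = v ∧ u < 2) ∨ (2 ≤ u ∧ 2 ≤ v) := by
    intro u v h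
    by_cases hv : 2 ≤ v
    · by_cases hu : 2 ≤ u
      · exact Or.inr ⟨hu, hv⟩
      · rw [← hκ'f u hu] at h
        exact (hu (κ'.injective h ▸ hv)).elim
    · rw [hκ'f v hv] at h
      have := κ.injective h
      exact Or.inl ⟨this, this ▸ not_le.1 hv⟩
  by_cases hdis : ∃ x y : Fin 6, 2 ≤ x ∧ 2 ≤ y ∧ κ x = κ' y
  · obtain ⟨x, y, hx, hy, hxy⟩ := hdis
    have hoff : ∀ u v : Fin 6, 2 ≤ u → 2 ≤ v → κ u = κ' v → (κ v, κ u) ∈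
        T.offDiag.filter fun q => (σ ^ i) q.1 = q.2 := by
      intro u v hu hv h
      refine Finset.mem_filter.2 ⟨Finset.mem_offDiag.2 ⟨hTmem v hv, hTmem u hu, fun h' => ?_⟩,
        h.symm⟩
      have h' : κ v = κ u := h'
      exact hne _ (hTmem v hv) (h.symm.trans h'.symm)
    refine ⟨_, H.pow_mem (H.mul_mem hκ (H.inv_mem hκ')) 20,
      isThreeCycle_of_overlap hx hy ?_ fun u v => ⟨fun h => ?_, ?_⟩⟩
    · rintro rfl rfl
      exact hne _ (hTmem 2 le_rfl) hxy.symm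
    · refine (hmix u v h).imp id fun h2 => ?_
      have := hc _ (hoff u v h2.1 h2.2 h) _ (hoff x y hx hy hxy)
      rw [Prod.mk.injEq] at this
      exact ⟨κ.injective this.2, κ.injective this.1⟩
    · rintro (⟨rfl, hu⟩ | ⟨rfl, rfl⟩)
      · exact (hκ'f u (not_le.2 hu)).symm
      · exact hxy
  · obtain ⟨v, hv⟩ := exists_doubleTwoCycle_of_disjoint (ι := κ) (ι' := κ') fun u v =>
      ⟨fun h => (hmix u v h).resolve_right fun h2 => hdis ⟨u, v, h2.1, h2.2, h⟩, by
        rintro ⟨rfl, hu⟩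
        exact (hκ'f u (not_le.2 hu)).symm⟩
    refine exists_isThreeCycle_mem_of_doubleTwoCycle hH hσH hσ hn hp (ι := v) ?_
    rw [← hv]
    exact H.mul_mem (H.mul_mem (H.mul_mem hκ hκ') (H.inv_mem hκ)) (H.inv_mem hκ')

theorem Subgroup.eq_top_of_card_perm_quotient_lt {Γ : Type*} [Group Γ] [Finite Γ]
    [IsSimpleGroup Γ] (K : Subgroup Γ) (h : K.index.factorial < Nat.card Γ) : K = ⊤ := by
  rcases K.normalCore_normal.eq_bot_or_eq_top with h' | h'
  · exfalso
    have hinj : Function.Injective (MulAction.toPermHom Γ (Γ ⧸ K)) := by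
      rw [← MonoidHom.ker_eq_bot_iff, ← Subgroup.normalCore_eq_ker, h']
    have := Nat.card_le_card_of_injective _ hinj
    rw [Nat.card_perm] at this
    exact absurd this (not_le.2 h)
  · exact top_le_iff.1 (h' ▸ K.normalCore_le)

theorem alternatingGroup_le_of_transitive {p : ℕ} (hp : p.Prime) (hp2 : p ≠ 2) (hmod : p % 3 = 2)
    (hα : Fintype.card α = p + 2) {H : Subgroup (Perm α)} (hHA : H ≤ alternatingGroup α)
    [hH : IsPretransitive H α] (hcard : p * (p - 1) ∣ Nat.card H) {z : Perm α}
    (hzH : z ∈ H) (hz3 : orderOf z = 3) (hz6 : z.support.card ≤ 6) : alternatingGroup α ≤ H := by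
  have : Fact p.Prime := ⟨hp⟩
  have hp5 : p = 5 ∨ 8 ≤ p := by
    by_contra! h
    have := hp.two_le
    obtain ⟨h1, h2⟩ := h
    interval_cases p <;> norm_num at *
  rcases hp5 with rfl | hp8
  · have h3 : 3 ∣ Nat.card H := by
      have := orderOf_dvd_natCard (⟨z, hzH⟩ : H)
      rwa [Subgroup.orderOf_mk, hz3] at this
    have h7 : 7 ∣ Nat.card H := by
      have : Nonempty α := Fintype.card_pos_iff.1 (by lia)
      obtain ⟨a⟩ := this
      have := MulAction.index_stabilizer_of_transitive H a
      rw [Nat.card_eq_fintype_card, hα] at this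
      rw [← show _ = 7 from this]
      exact Subgroup.index_dvd_card _
    have hA : Nat.card (alternatingGroup α) = 2520 := by
      have : Nontrivial α := Fintype.one_lt_card_iff_nontrivial.1 (by lia)
      have h2 := two_mul_nat_card_alternatingGroup (α := α)
      rw [Nat.card_perm, Nat.card_eq_fintype_card (α := α), hα,
        show Nat.factorial (5 + 2) = 5040 from rfl] at h2
      lia
    have : IsSimpleGroup (alternatingGroup α) :=
      alternatingGroup.isSimpleGroup (by rw [Nat.card_eq_fintype_card]; lia)
    have hK : Nat.card (H.subgroupOf (alternatingGroup α)) = Nat.card H :=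
      Nat.card_congr (Subgroup.subgroupOfEquivOfLe hHA).toEquiv
    have hi := (H.subgroupOf (alternatingGroup α)).card_mul_index
    rw [hK, hA] at hi
    have h420 : 420 ∣ Nat.card H := by
      have : Nat.Coprime 3 7 := by norm_num
      have h21 := this.mul_dvd_of_dvd_of_dvd h3 h7
      have : Nat.Coprime (3 * 7) 20 := by norm_num
      exact this.mul_dvd_of_dvd_of_dvd h21 hcard
    have hle : (H.subgroupOf (alternatingGroup α)).index ≤ 6 := by
      have := Nat.le_of_dvd Nat.card_pos h420
      by_contra! h
      have := Nat.mul_le_mul this h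
      lia
    rw [← Subgroup.subgroupOf_eq_top]
    apply Subgroup.eq_top_of_card_perm_quotient_lt
    rw [hA]
    exact (Nat.factorial_le hle).trans_lt (by norm_num [Nat.factorial])
  · obtain ⟨σ, hσ⟩ := exists_prime_orderOf_dvd_card' p ((Dvd.intro _ rfl).trans hcard)
    have hσ' : orderOf (σ : Perm α) = p := by rw [Subgroup.orderOf_coe, hσ]
    have hct := cycleType_of_orderOf_prime hp2 hα hσ'
    have hcyc : (σ : Perm α).IsCycle := by
      rw [← card_cycleType_eq_one, hct]; rfl
    have hsup : (σ : Perm α).support.card = p := by rw [← hcyc.orderOf, hσ']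
    have hprim : IsPreprimitive H α :=
      isPreprimitive_of_isCycle_prime σ.2 hcyc (hsup ▸ hp) (by lia)
    have h2 := isTwoPretransitive_of_isCycle_prime hprim σ.2 hcyc (by lia)
    obtain ⟨g, hgH, hg⟩ := exists_isThreeCycle_mem h2 σ.2 hcyc (by lia) (by lia) hzH hz3 hz6
    exact alternatingGroup_le_of_isPreprimitive_of_isThreeCycle_mem hprim hg hgH

end Recognition

section Generic

open Polynomial

theorem irreducible_coverPoly_X {k : Type*} [Field k] {p : ℕ} [Fact p.Prime] [CharP k p]
    (hp : 5 ≤ p) {δ : k} (hδ : δ ≠ 0) :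
    Irreducible (coverPoly p (RatFunc.C δ) (RatFunc.X : RatFunc k)) := by
  have h4 : ((4 : ℕ) : k) ≠ 0 := natCast_ne_zero_of_lt (p := p) (by lia) (by lia)
  push_cast at h4
  have h1 : Irreducible (coverPoly p (C δ) (X : k[X])) := by
    rw [← MulEquiv.irreducible_iff (Bivariate.swap (R := k))]
    have h2 : Bivariate.swap (R := k) (coverPoly p (C δ) X) =
        C (-X ^ 2) * X + C (coverPoly p δ 0) := by
      rw [coverPoly_eq_sub, map_sub, ← map_zero C, ← coverPoly_map, Bivariate.swap_map_C, map_mul,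
        map_pow, Bivariate.swap_X, Bivariate.swap_Y]
      simp only [map_neg, map_pow]
      ring
    rw [h2]
    refine irreducible_C_mul_X_add_C (neg_ne_zero.2 (pow_ne_zero 2 X_ne_zero)) ?_
    rw [IsRelPrime.neg_left_iff]
    refine IsRelPrime.pow_left (IsCoprime.isRelPrime ?_)
    refine (irreducible_X.coprime_iff_not_dvd).2 fun h => ?_
    rw [X_dvd_iff, coeff_zero_eq_eval_zero, eval_coverPoly] at h
    simp [h4] at h
  have h3 := (h1.isPrimitive (by
    rw [(natDegree_coverPoly p (C δ) X (by lia) (C_ne_zero.2 hδ)).1]; lia)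
    ).irreducible_iff_irreducible_map_fraction_map (K := RatFunc k) |>.1 h1
  rwa [coverPoly_map, RatFunc.algebraMap_X, RatFunc.algebraMap_C] at h3

variable {k : Type} [Field k] {L : Type} [Field L] [Algebra (RatFunc k) L]
  [Algebra k[X] L] [IsScalarTower k[X] (RatFunc k) L]
  [IsAlgClosed k] [FiniteDimensional (RatFunc k) L] [IsGalois (RatFunc k) L]
  {p : ℕ} [hpp : Fact p.Prime] [CharP k p] [CharP L p] {δ κ : k} {r : Fin (p + 2) → L}

theorem CoverRoots.exists_algEquiv_of_mem_alternatingGroup (hp : 5 ≤ p) (hmod : p % 3 = 2)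
    (hparam : CoverParam p δ κ)
    (H : CoverRoots p (constHom k L δ) (constHom k L κ) (algebraMap (RatFunc k) L RatFunc.X) r)
    (hgen : ∀ σ : L ≃ₐ[RatFunc k] L, (∀ i, σ (r i) = r i) → σ = 1) (s : Equiv.Perm (Fin (p + 2)))
    (hs : s ∈ alternatingGroup (Fin (p + 2))) :
    ∃ σ : L ≃ₐ[RatFunc k] L, ∀ i, σ (r i) = r (s i) := by
  have hδ : δ ≠ 0 := hparam.delta_ne_zero hp
  obtain ⟨π, hπ⟩ := H.exists_perm_hom (K := RatFunc k) hp ⟨_, rfl⟩ ⟨_, rfl⟩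
  have hπinj : Function.Injective π := by
    rw [injective_iff_map_eq_one]
    intro σ hσ
    exact hgen σ fun i => by rw [hπ, hσ, Equiv.Perm.one_apply]
  have htrans : MulAction.IsPretransitive π.range (Fin (p + 2)) := by
    refine ⟨fun i j => ?_⟩
    have hirr := irreducible_coverPoly_X (p := p) hp hδ
    have hroot (i) : aeval (r i) (coverPoly p (RatFunc.C δ) (RatFunc.X : RatFunc k)) = 0 := by
      rw [aeval_def, ← eval_map, coverPoly_map]
      exact H.eval_root i
    have hev : aeval (r j) (minpoly (RatFunc k) (r i)) = 0 := by
      rw [← minpoly.eq_of_irreducible hirr (hroot i), map_mul, hroot j, zero_mul]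
    obtain ⟨σ, hσ⟩ := minpoly.exists_algEquiv_of_root' (Algebra.IsAlgebraic.isAlgebraic (r i)) hev
    refine ⟨⟨π σ, σ, rfl⟩, ?_⟩
    apply H.injective hp
    rw [← hσ, hπ]
    rfl
  obtain ⟨z, hz3, hz6⟩ := H.exists_inertia_zero hp hparam π hπ
  obtain ⟨O, hO⟩ := exists_place_over_infty k L
  have hcard : p * (p - 1) ∣ Nat.card π.range := by
    have h1 := CoverRoots.dvd_mul_card_inertia O hO hp one_ne_zero (by simpa using H)
    rw [one_mul] at h1
    rw [← Nat.card_congr (π.ofInjective hπinj).toEquiv]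
    exact h1.trans (Subgroup.card_subgroup_dvd_card _)
  have hle := alternatingGroup_le_of_transitive hpp.out (by lia) hmod (Fintype.card_fin _)
    (H := π.range) ?_ hcard (z := π z) ⟨z, rfl⟩ ?_ hz6
  · obtain ⟨σ, rfl⟩ := hle hs
    exact ⟨σ, hπ σ⟩
  · rintro _ ⟨σ, rfl⟩
    rw [Equiv.Perm.mem_alternatingGroup]
    exact H.sign_eq_one (constHom k L) hp (σ : L →+* L) (algEquiv_constHom σ) _ (hπ σ)
  · rw [orderOf_injective π hπinj, hz3]

end Generic

section Transfer

open Polynomial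

theorem normal_of_isSplittingField_map {K₀ K L : Type*} [Field K₀] [Field K] [Field L]
    [Algebra K₀ K] [Algebra K L] [Algebra K₀ L] [IsScalarTower K₀ K L] (f : K₀[X]) (hf0 : f ≠ 0)
    [hf : IsSplittingField K L (f.map (algebraMap K₀ K))] (x : K) {N : ℕ} (hN : N ≠ 0) (x₀ : K₀)
    (hx : algebraMap K₀ K x₀ = x ^ N)
    (hgen : ∀ S : Subfield K, (∀ a, algebraMap K₀ K a ∈ S) → x ∈ S → S = ⊤)
    (hspl : (X ^ N - C (x ^ N) : K[X]).Splits) : Normal K₀ L := by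
  have hg0 : f * (X ^ N - C x₀) ≠ 0 :=
    mul_ne_zero hf0 (X_pow_sub_C_ne_zero (Nat.pos_of_ne_zero hN) _)
  have : IsSplittingField K₀ L (f * (X ^ N - C x₀)) := by
    rw [isSplittingField_iff_intermediateField]
    constructor
    · rw [Polynomial.map_mul, IsScalarTower.algebraMap_eq K₀ K L, ← Polynomial.map_map,
        ← Polynomial.map_map]
      refine hf.splits.mul ?_
      rw [Polynomial.map_sub, Polynomial.map_pow, map_X, map_C, hx]
      exact hspl.map _
    · set E := IntermediateField.adjoin K₀ ((f * (X ^ N - C x₀)).rootSet L) with hE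
      have hmem {y : L} (hy : aeval y (f * (X ^ N - C x₀)) = 0) : y ∈ E :=
        IntermediateField.subset_adjoin _ _ ((mem_rootSet_of_ne hg0).2 hy)
      have hK (a : K) : algebraMap K L a ∈ E.toSubfield := by
        have h := hgen (E.toSubfield.comap (algebraMap K L)) (fun a => ?_) ?_
        · exact (h.symm ▸ Subfield.mem_top a : a ∈ E.toSubfield.comap (algebraMap K L))
        · rw [Subfield.mem_comap, ← IsScalarTower.algebraMap_apply]
          exact E.algebraMap_mem a
        · refine hmem ?_
          rw [map_mul, map_sub, map_pow, aeval_X, aeval_C, IsScalarTower.algebraMap_apply K₀ K L,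
            hx, map_pow, sub_self, mul_zero]
      have h2 := (isSplittingField_iff_intermediateField.1 hf).2
      have h3 : E.toSubfield.toIntermediateField hK = ⊤ := by
        rw [eq_top_iff, ← h2, IntermediateField.adjoin_le_iff]
        intro y hy
        refine hmem ?_
        rw [map_mul, aeval_def, IsScalarTower.algebraMap_eq K₀ K L, ← eval₂_map, ← aeval_def,
          aeval_eq_zero_of_mem_rootSet hy, zero_mul]
      rw [eq_top_iff]
      intro y _
      have : y ∈ E.toSubfield.toIntermediateField hK := h3 ▸ IntermediateField.mem_top
      exact this
  exact Normal.of_isSplittingField (f * (X ^ N - C x₀))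

theorem exists_algEquiv_of_le_commutator {K₀ K M L : Type*} [Field K₀] [Field K] [Field M] [Field L]
    [Algebra K₀ M] [Algebra K L] (φ : K₀ →+* K) (j : M →+* L)
    (hj : ∀ a, j (algebraMap K₀ M a) = algebraMap K L (φ a)) (f : K₀[X]) (hf0 : f ≠ 0)
    [IsSplittingField K L (f.map φ)] (x : K) {N : ℕ} (hN : N ≠ 0) (x₀ : K₀) (hx : φ x₀ = x ^ N)
    (hgen : ∀ S : Subfield K, (∀ a, φ a ∈ S) → x ∈ S → S = ⊤)
    (hspl : (X ^ N - C (x ^ N) : K[X]).Splits)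
    (hζ : ∀ y : K, y ^ N = x ^ N → ∃ ζ, y = φ ζ * x) {n : ℕ} (r : Fin n → M)
    {A : Subgroup (Equiv.Perm (Fin n))} (hA : A ≤ ⁅A, A⁆)
    (hM : ∀ s ∈ A, ∃ σ : M ≃ₐ[K₀] M, ∀ i, σ (r i) = r (s i)) {s : Equiv.Perm (Fin n)}
    (hs : s ∈ A) : ∃ σ : L ≃ₐ[K] L, ∀ i, σ (j (r i)) = j (r (s i)) := by
  let _ : Algebra K₀ K := φ.toAlgebra
  let _ : Algebra K₀ L := ((algebraMap K L).comp φ).toAlgebra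
  let _ : Algebra M L := j.toAlgebra
  have : IsScalarTower K₀ K L := .of_algebraMap_eq fun _ => rfl
  have : IsScalarTower K₀ M L := .of_algebraMap_eq fun a => (hj a).symm
  have : IsSplittingField K L (f.map (algebraMap K₀ K)) := ‹_›
  have : Normal K₀ L := normal_of_isSplittingField_map f hf0 x hN x₀ hx hgen hspl
  have hL (s) (hs : s ∈ A) : ∃ τ : L ≃ₐ[K₀] L, ∀ i, τ (j (r i)) = j (r (s i)) := by
    obtain ⟨σ, hσ⟩ := hM s hs
    refine ⟨σ.liftNormal L, fun i => ?_⟩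
    rw [← hσ]
    exact σ.liftNormal_commutes L (r i)
  have hτx (τ : L ≃ₐ[K₀] L) : ∃ ζ : K₀, τ (algebraMap K L x) =
      algebraMap K₀ L ζ * algebraMap K L x := by
    have h1 : τ (algebraMap K L x) ^ N = algebraMap K L (x ^ N) := by
      rw [← map_pow, ← map_pow, ← hx]
      exact τ.commutes x₀
    obtain ⟨y, hy⟩ := hspl.mem_range_of_isRoot (X_pow_sub_C_ne_zero (Nat.pos_of_ne_zero hN) _)
      (i := algebraMap K L) (x := τ (algebraMap K L x)) (by
        rw [Polynomial.map_sub, Polynomial.map_pow, map_X, map_C, IsRoot, eval_sub, eval_pow,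
          eval_X, eval_C, h1, sub_self])
    obtain ⟨ζ, rfl⟩ := hζ y ((algebraMap K L).injective (by rw [map_pow, hy, h1]))
    exact ⟨ζ, by rw [← hy, map_mul]; rfl⟩
  have hcomm (τ₁ τ₂ : L ≃ₐ[K₀] L) :
      (τ₁ * τ₂) (algebraMap K L x) = (τ₂ * τ₁) (algebraMap K L x) := by
    obtain ⟨ζ₁, h₁⟩ := hτx τ₁
    obtain ⟨ζ₂, h₂⟩ := hτx τ₂
    simp only [AlgEquiv.mul_apply, h₁, h₂, map_mul, AlgEquiv.commutes]
    ring
  have hfix (τ : L ≃ₐ[K₀] L) (h : τ (algebraMap K L x) = algebraMap K L x) (a : K) :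
      τ (algebraMap K L a) = algebraMap K L a := by
    have h1 := hgen (RingHom.eqLocusField ((τ : L →+* L).comp (algebraMap K L)) (algebraMap K L))
      (fun a => τ.commutes a) h
    exact (h1.symm ▸ Subfield.mem_top a : a ∈ RingHom.eqLocusField _ _)
  let R : Subgroup (Equiv.Perm (Fin n)) :=
    { carrier := {s | ∃ σ : L ≃ₐ[K] L, ∀ i, σ (j (r i)) = j (r (s i))}
      mul_mem' := by
        rintro s t ⟨σ, hσ⟩ ⟨τ, hτ⟩
        exact ⟨σ * τ, fun i => by rw [AlgEquiv.mul_apply, hτ, hσ]; rfl⟩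
      one_mem' := ⟨1, fun i => rfl⟩
      inv_mem' := by
        rintro s ⟨σ, hσ⟩
        refine ⟨σ⁻¹, fun i => ?_⟩
        apply σ.injective
        rw [hσ, ← AlgEquiv.mul_apply, mul_inv_cancel]
        simp }
  have hR : ⁅A, A⁆ ≤ R := by
    rw [Subgroup.commutator_le]
    intro s₁ hs₁ s₂ hs₂
    obtain ⟨τ₁, h₁⟩ := hL s₁ hs₁
    obtain ⟨τ₂, h₂⟩ := hL s₂ hs₂
    have hinv {s : Equiv.Perm (Fin n)} {τ : L ≃ₐ[K₀] L} (h : ∀ i, τ (j (r i)) = j (r (s i))) (i) :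
        τ⁻¹ (j (r i)) = j (r (s⁻¹ i)) := by
      apply τ.injective
      rw [h, ← AlgEquiv.mul_apply, mul_inv_cancel]
      simp
    have hx' : (τ₁ * τ₂ * τ₁⁻¹ * τ₂⁻¹) (algebraMap K L x) = algebraMap K L x := by
      rw [mul_assoc, AlgEquiv.mul_apply, hcomm, ← AlgEquiv.mul_apply,
        show τ₁ * τ₂ * (τ₂⁻¹ * τ₁⁻¹) = 1 by group]
      rfl
    refine ⟨AlgEquiv.ofRingEquiv (f := (τ₁ * τ₂ * τ₁⁻¹ * τ₂⁻¹).toRingEquiv) (hfix _ hx'),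
      fun i => ?_⟩
    change (τ₁ * τ₂ * τ₁⁻¹ * τ₂⁻¹) (j (r i)) = _
    rw [commutatorElement_def, AlgEquiv.mul_apply, AlgEquiv.mul_apply,
      AlgEquiv.mul_apply, hinv h₂, hinv h₁, h₂, h₁]
    rfl
  exact hR (hA hs)

end Transfer

section Splitting

open Polynomial

theorem exists_prod_fin_of_splits {K : Type*} [Field K] {f : K[X]} (hf : f.Splits) {n : ℕ}
    (hn : f.natDegree = n) :
    ∃ r : Fin n → K, f = C f.leadingCoeff * ∏ i, (X - C (r i)) := by
  obtain ⟨l, hl⟩ : ∃ l : List K, (l : Multiset K) = f.roots := ⟨_, Multiset.coe_toList _⟩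
  have hlen : n = l.length := by
    rw [← hn, hf.natDegree_eq_card_roots, ← hl, Multiset.coe_card]
  subst hlen
  refine ⟨fun i => l[i], ?_⟩
  have h := Fin.prod_univ_fun_getElem l fun a => X - C a
  simp only [Fin.getElem_fin] at h ⊢
  rw [h]
  conv_lhs => rw [hf.eq_prod_roots, ← hl, Multiset.map_coe, Multiset.prod_coe]

theorem exists_coverParam (k : Type*) [Field k] [IsAlgClosed k] (p : ℕ) [Fact p.Prime]
    [CharP k p] (hp : 5 ≤ p) : ∃ δ κ : k, CoverParam p δ κ := by
  obtain ⟨κ, hκ⟩ := IsAlgClosed.exists_pow_nat_eq (3 : k) two_pos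
  have hκ0 : κ ≠ 0 := by
    rintro rfl
    exact CoverParam.three_ne_zero (A := k) (p := p) hp (by simpa using hκ.symm)
  exact ⟨-12 / κ ^ (p - 1), κ, hκ, div_mul_cancel₀ _ (pow_ne_zero _ hκ0)⟩

theorem CoverParam.exists_coverRoots {K L : Type*} [Field K] [Field L] [Algebra K L] {p : ℕ}
    [Fact p.Prime] [CharP K p] (hp : 5 ≤ p) {δ κ t : K} (h : CoverParam p δ κ) (ht : t ≠ 0)
    [hL : IsSplittingField K L (coverPoly p δ t)] :
    ∃ r : Fin (p + 2) → L,
      CoverRoots p (algebraMap K L δ) (algebraMap K L κ) (algebraMap K L t) r := by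
  have : CharP L p := charP_of_injective_algebraMap (algebraMap K L).injective p
  have hδ : δ ≠ 0 := h.delta_ne_zero hp
  have hdeg := natDegree_coverPoly p (algebraMap K L δ) (algebraMap K L t) (by lia)
    ((_root_.map_ne_zero _).2 hδ)
  have hs := hL.splits
  rw [coverPoly_map] at hs
  obtain ⟨r, hr⟩ := exists_prod_fin_of_splits hs hdeg.1
  rw [hdeg.2] at hr
  exact ⟨r, ⟨h.map _, hr⟩, (_root_.map_ne_zero _).2 ht⟩

theorem CoverRoots.eq_one_of_forall_apply_eq {K L : Type*} [Field K] [Field L] [Algebra K L]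
    {p : ℕ} [Fact p.Prime] [CharP L p] (hp : 5 ≤ p) {δ κ t : K}
    [hL : IsSplittingField K L (coverPoly p δ t)]
    {r : Fin (p + 2) → L}
    (H : CoverRoots p (algebraMap K L δ) (algebraMap K L κ) (algebraMap K L t) r)
    (σ : L ≃ₐ[K] L) (hσ : ∀ i, σ (r i) = r i) : σ = 1 := by
  have h1 : AlgHom.equalizer (σ : L →ₐ[K] L) (AlgHom.id K L) = ⊤ := by
    rw [eq_top_iff, ← hL.adjoin_rootSet, Algebra.adjoin_le_iff]
    intro y hy
    have h2 := aeval_eq_zero_of_mem_rootSet hy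
    rw [aeval_def, ← eval_map, coverPoly_map] at h2
    obtain ⟨i, rfl⟩ := H.exists_root_eq hp h2
    exact hσ i
  ext y
  exact (h1.symm ▸ Algebra.mem_top : y ∈ AlgHom.equalizer (σ : L →ₐ[K] L) (AlgHom.id K L))

theorem CoverParam.isGalois {K L : Type*} [Field K] [Field L] [Algebra K L] {p : ℕ}
    [Fact p.Prime] [CharP K p] (hp : 5 ≤ p) {δ κ t : K} (h : CoverParam p δ κ) (ht : t ≠ 0)
    [hL : IsSplittingField K L (coverPoly p δ t)] : IsGalois K L := by
  have : CharP L p := charP_of_injective_algebraMap (algebraMap K L).injective p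
  refine IsGalois.of_separable_splitting_field (p := coverPoly p δ t) ?_
  obtain ⟨r, H⟩ := h.exists_coverRoots (L := L) hp ht
  rw [← separable_map (algebraMap K L), coverPoly_map, H.eq_prod]
  refine Separable.unit_mul ?_ (separable_prod_X_sub_C_iff.2 (H.injective hp))
  exact isUnit_C.2 (isUnit_iff_ne_zero.2 (H.param.delta_ne_zero hp))

theorem exists_ringHom_of_isSplittingField {K₀ K M L : Type*} [Field K₀] [Field K] [Field M]
    [Field L] [Algebra K₀ M] [Algebra K L] (φ : K₀ →+* K) (f : K₀[X]) [IsSplittingField K₀ M f]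
    [hL : IsSplittingField K L (f.map φ)] :
    ∃ j : M →+* L, ∀ a, j (algebraMap K₀ M a) = algebraMap K L (φ a) := by
  let _ : Algebra K₀ L := ((algebraMap K L).comp φ).toAlgebra
  have h : (f.map (algebraMap K₀ L)).Splits := by
    have := hL.splits
    rwa [Polynomial.map_map] at this
  exact ⟨IsSplittingField.lift M f h, (IsSplittingField.lift M f h).commutes⟩

/-- The endomorphism `X ↦ X ^ N` of the rational function field. -/
noncomputable def powHom (k : Type*) [Field k] {N : ℕ} (hN : N ≠ 0) : RatFunc k →+* RatFunc k :=
  RatFunc.mapRingHom (expand k N) (nonZeroDivisors_le_comap_nonZeroDivisors_of_injective _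
    (expand_injective (Nat.pos_of_ne_zero hN)))

theorem powHom_algebraMap {k : Type*} [Field k] {N : ℕ} (hN : N ≠ 0) (f : k[X]) :
    powHom k hN (algebraMap k[X] (RatFunc k) f) = algebraMap k[X] (RatFunc k) (expand k N f) := by
  have := RatFunc.map_apply_div (expand k N) (nonZeroDivisors_le_comap_nonZeroDivisors_of_injective
    _ (expand_injective (Nat.pos_of_ne_zero hN))) f 1
  rwa [map_one, map_one, div_one, map_one, div_one] at this

theorem powHom_C {k : Type*} [Field k] {N : ℕ} (hN : N ≠ 0) (c : k) :
    powHom k hN (RatFunc.C c) = RatFunc.C c := by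
  rw [← RatFunc.algebraMap_C, powHom_algebraMap, expand_C]

theorem powHom_X {k : Type*} [Field k] {N : ℕ} (hN : N ≠ 0) :
    powHom k hN RatFunc.X = RatFunc.X ^ N := by
  rw [← RatFunc.algebraMap_X, powHom_algebraMap, expand_X, map_pow]

theorem subfield_ratFunc_eq_top {k : Type*} [Field k] (S : Subfield (RatFunc k))
    (hC : ∀ c, RatFunc.C c ∈ S) (hX : RatFunc.X ∈ S) : S = ⊤ := by
  have hpoly (f : k[X]) : algebraMap k[X] (RatFunc k) f ∈ S := by
    induction f using Polynomial.induction_on' with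
    | add f g hf hg => rw [map_add]; exact add_mem hf hg
    | monomial n a =>
      rw [← C_mul_X_pow_eq_monomial, map_mul, map_pow, RatFunc.algebraMap_C, RatFunc.algebraMap_X]
      exact mul_mem (hC a) (pow_mem hX n)
  rw [eq_top_iff]
  intro f _
  rw [← f.num_div_denom]
  exact div_mem (hpoly _) (hpoly _)

variable {k : Type} [Field k] [IsAlgClosed k] {p : ℕ} [hpp : Fact p.Prime] [CharP k p] {δ κ : k}

theorem CoverParam.exists_algEquiv_of_mem_alternatingGroup (hp : 5 ≤ p) (hmod : p % 3 = 2)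
    (h : CoverParam p δ κ) {N : ℕ} (hN : ¬ p ∣ N) {L : Type} [Field L] [Algebra (RatFunc k) L]
    [hL : IsSplittingField (RatFunc k) L (coverPoly p (RatFunc.C δ) (RatFunc.X ^ N))]
    [CharP L p] : ∃ r : Fin (p + 2) → L,
      CoverRoots p (constHom k L δ) (constHom k L κ) (algebraMap (RatFunc k) L RatFunc.X ^ N) r ∧
        ∀ s ∈ alternatingGroup (Fin (p + 2)), ∃ σ : L ≃ₐ[RatFunc k] L, ∀ i, σ (r i) = r (s i) := by
  have hN0 : N ≠ 0 := by rintro rfl; exact hN (dvd_zero p)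
  have hchar : CharP (RatFunc k) p := charP_of_injective_ringHom RatFunc.C.injective p
  have hδ : δ ≠ 0 := h.delta_ne_zero hp
  let f : (RatFunc k)[X] := coverPoly p (RatFunc.C δ) RatFunc.X
  let M := f.SplittingField
  have hM : IsSplittingField (RatFunc k) M (coverPoly p (RatFunc.C δ) RatFunc.X) :=
    IsSplittingField.splittingField f
  have hcM : CharP M p := charP_of_injective_algebraMap (algebraMap (RatFunc k) M).injective p
  have : IsGalois (RatFunc k) M := (h.map RatFunc.C).isGalois hp RatFunc.X_ne_zero
  have : FiniteDimensional (RatFunc k) M := IsSplittingField.finiteDimensional M f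
  obtain ⟨r₀, H₀⟩ := (h.map RatFunc.C).exists_coverRoots (L := M) hp RatFunc.X_ne_zero
  have hMA := CoverRoots.exists_algEquiv_of_mem_alternatingGroup hp hmod h H₀
    (CoverRoots.eq_one_of_forall_apply_eq hp H₀)
  have hfN : f.map (powHom k hN0) = coverPoly p (RatFunc.C δ) (RatFunc.X ^ N) := by
    rw [coverPoly_map, powHom_C, powHom_X]
  have hLN : IsSplittingField (RatFunc k) L (f.map (powHom k hN0)) := hfN ▸ hL
  have hN' : NeZero (N : k) := ⟨fun h0 => hN ((CharP.cast_eq_zero_iff k p N).1 h0)⟩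
  obtain ⟨ζ, hζ⟩ := HasEnoughRootsOfUnity.exists_primitiveRoot k N
  have hζ' := hζ.map_of_injective (RatFunc.C (K := k)).injective
  have : NeZero N := ⟨hN0⟩
  obtain ⟨j, hj⟩ := exists_ringHom_of_isSplittingField (M := M) (L := L) (powHom k hN0) f
  have hA : alternatingGroup (Fin (p + 2)) ≤
      ⁅alternatingGroup (Fin (p + 2)), alternatingGroup (Fin (p + 2))⁆ := by
    have h1 := commutator_alternatingGroup_eq_top (α := Fin (p + 2)) (by simp; lia)
    have h2 := congrArg (Subgroup.map (alternatingGroup (Fin (p + 2))).subtype) h1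
    rw [commutator_def, Subgroup.map_commutator, ← MonoidHom.range_eq_map,
      Subgroup.range_subtype] at h2
    exact h2.ge
  refine ⟨fun i => j (r₀ i), ⟨⟨h.map _, ?_⟩, pow_ne_zero _ ?_⟩, fun s hs => ?_⟩
  · have h1 := congrArg (Polynomial.map j) H₀.eq_prod
    rw [coverPoly_map, hj, hj, powHom_C, powHom_X, map_pow, Polynomial.map_mul, map_C, hj, powHom_C,
      Polynomial.map_prod] at h1
    simp only [Polynomial.map_sub, map_X, map_C] at h1
    exact h1
  · exact (_root_.map_ne_zero _).2 RatFunc.X_ne_zero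
  · refine exists_algEquiv_of_le_commutator (powHom k hN0) j hj f ?_ RatFunc.X hN0 RatFunc.X
      (powHom_X hN0) (fun S hS hX => subfield_ratFunc_eq_top S
        (fun c => powHom_C hN0 c ▸ hS (RatFunc.C c)) hX)
      (X_pow_sub_C_splits_of_isPrimitiveRoot hζ' rfl) (fun y hy => ?_) r₀ hA hMA hs
    · exact coverPoly_ne_zero (p := p) (by lia) ((_root_.map_ne_zero _).2 hδ)
    · obtain ⟨i, -, hi⟩ := hζ'.eq_pow_of_pow_eq_one (ξ := y / RatFunc.X) (by
        rw [div_pow, hy, div_self (pow_ne_zero _ RatFunc.X_ne_zero)])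
      refine ⟨RatFunc.C (ζ ^ i), ?_⟩
      rw [powHom_C, map_pow, hi, div_mul_cancel₀ _ RatFunc.X_ne_zero]

end Splitting

section Realization

open Polynomial

theorem exists_cover_card_inertia (k : Type) [Field k] [IsAlgClosed k] {p : ℕ} [Fact p.Prime]
    [CharP k p] (hp : 5 ≤ p) (hmod : p % 3 = 2) {m : ℕ} (hm : m ∣ p - 1) :
    ∃ (L : Type) (_ : Field L) (_ : Algebra (RatFunc k) L) (_ : Algebra k[X] L)
      (_ : IsScalarTower k[X] (RatFunc k) L),
      FiniteDimensional (RatFunc k) L ∧ IsGalois (RatFunc k) L ∧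
      Algebra.Etale k[X] (integralClosure k[X] L) ∧
      Nonempty ((L ≃ₐ[RatFunc k] L) ≃* alternatingGroup (Fin (p + 2))) ∧
      ∃ O : ValuationSubring L, O.comap (algebraMap (RatFunc k) L) = inftyPlace k ∧
        Nat.card (inertiaIn k O) = p * m := by
  obtain ⟨r', hr⟩ := hm
  have hr' : r' * m = p - 1 := by rw [hr, mul_comm]
  have hr0 : r' ≠ 0 := by rintro rfl; lia
  have hrp : r' < p := by
    have := Nat.le_of_dvd (by lia) (Dvd.intro _ hr')
    lia
  have hN : ¬ p ∣ 3 * r' := by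
    rw [(Fact.out : p.Prime).dvd_mul]
    rintro (h | h)
    · exact absurd (Nat.le_of_dvd (by lia) h) (by lia)
    · exact absurd (Nat.le_of_dvd (by lia) h) (by lia)
  obtain ⟨δ, κ, h⟩ := exists_coverParam k p hp
  have hchar : CharP (RatFunc k) p := charP_of_injective_ringHom RatFunc.C.injective p
  let f : (RatFunc k)[X] := coverPoly p (RatFunc.C δ) (RatFunc.X ^ (3 * r'))
  let L := f.SplittingField
  have hL : IsSplittingField (RatFunc k) L (coverPoly p (RatFunc.C δ) (RatFunc.X ^ (3 * r'))) :=
    IsSplittingField.splittingField f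
  have : CharP L p := charP_of_injective_algebraMap (algebraMap (RatFunc k) L).injective p
  have : IsGalois (RatFunc k) L :=
    (h.map RatFunc.C).isGalois hp (pow_ne_zero (3 * r') RatFunc.X_ne_zero)
  have : FiniteDimensional (RatFunc k) L := IsSplittingField.finiteDimensional L f
  obtain ⟨r, H, hA⟩ := h.exists_algEquiv_of_mem_alternatingGroup (L := L) hp hmod hN
  have hgen : ∀ σ : L ≃ₐ[RatFunc k] L, (∀ i, σ (r i) = r i) → σ = 1 :=
    CoverRoots.eq_one_of_forall_apply_eq hp (δ := RatFunc.C δ) (κ := RatFunc.C κ)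
      (t := RatFunc.X ^ (3 * r')) (by rw [map_pow]; exact H)
  obtain ⟨O, hO⟩ := exists_place_over_infty k L
  refine ⟨L, inferInstance, inferInstance, inferInstance, inferInstance, inferInstance,
    inferInstance, H.etale hp hr0 h hgen, ?_, O, hO, H.card_inertia_eq O hO hp hmod hr' hgen⟩
  obtain ⟨π, hπ⟩ := H.exists_perm_hom (K := RatFunc k) hp ⟨_, rfl⟩
    ⟨RatFunc.X ^ (3 * r'), map_pow _ _ _⟩
  have hπinj : Function.Injective π := by
    rw [injective_iff_map_eq_one]
    intro σ hσ
    exact hgen σ fun i => by rw [hπ, hσ, Equiv.Perm.one_apply]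
  have hrange : π.range = alternatingGroup (Fin (p + 2)) := by
    ext s
    constructor
    · rintro ⟨σ, rfl⟩
      rw [Equiv.Perm.mem_alternatingGroup]
      exact H.sign_eq_one (constHom k L) hp (σ : L →+* L) (algEquiv_constHom σ) _ (hπ σ)
    · intro hs
      obtain ⟨σ, hσ⟩ := hA s hs
      exact ⟨σ, Equiv.ext fun i => H.injective hp (by rw [← hπ, hσ])⟩
  exact ⟨(π.ofInjective hπinj).trans (MulEquiv.subgroupCongr hrange)⟩

end Realization

end

/-- **Abhyankar's Inertia Conjecture for `A_{p+2}`** (Muskat–Pries): let `k` be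
an algebraically closed field of odd characteristic `p` with `p ≡ 2 (mod 3)` and
let `G` be the alternating group `A_{p+2}` on `p + 2` letters.  Let `G₀ ≤ G` have
a normal `p`-subgroup `G₁` with cyclic quotient `G₀/G₁` of order prime to `p`.
Then `G₀` occurs as the inertia group at a point over `∞` of some `G`-Galois
cover of the projective line branched only at `∞` if and only if the conjugates
of `G₁` generate `G`. -/
theorem abhyankar_inertia_Ap2 (k : Type) [Field k] [IsAlgClosed k]
    (p : ℕ) (hp : p.Prime) (hodd : Odd p) (hmod : p % 3 = 2) [CharP k p]
    (G : Type) [Group G]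
    (hG : Nonempty (G ≃* alternatingGroup (Fin (p + 2))))
    (G₀ G₁ : Subgroup G) (h₁₀ : G₁ ≤ G₀)
    [hnorm : (G₁.subgroupOf G₀).Normal] (hp₁ : IsPGroup p G₁)
    (hcyc : IsCyclic (G₀ ⧸ G₁.subgroupOf G₀))
    (htame : ¬ p ∣ Nat.card (G₀ ⧸ G₁.subgroupOf G₀)) :
    OccursAsInertiaAtInfty k G G₀ ↔
      Subgroup.normalClosure (G₁ : Set G) = ⊤ := by
  have : Fact p.Prime := ⟨hp⟩
  obtain ⟨ε⟩ := hG
  have hp5 : 5 ≤ p := by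
    have := hp.two_le
    have := Nat.odd_iff.1 hodd
    lia
  have hp2 : p ≠ 2 := by lia
  have : Finite G := Finite.of_equiv _ ε.symm.toEquiv
  have hcard : 5 ≤ Nat.card (Fin (p + 2)) := by rw [Nat.card_fin]; lia
  have : IsSimpleGroup (alternatingGroup (Fin (p + 2))) := alternatingGroup.isSimpleGroup hcard
  have : Nontrivial G := ε.toEquiv.nontrivial
  have : IsSimpleGroup G := IsSimpleGroup.isSimpleGroup_of_surjective ε.symm.toMonoidHom
    ε.symm.surjective
  constructor
  · rintro ⟨L, _, _, _, _, _, _, _, e, O, hO, hI⟩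
    have : CharP L p := charP_of_injective_ringHom (constHom k L).injective p
    refine (Subgroup.normalClosure_normal (s := (G₁ : Set G))).eq_bot_or_eq_top.resolve_left ?_
    intro hbot
    have hG₁ : G₁ = ⊥ := by
      rw [eq_bot_iff, ← hbot]
      exact Subgroup.subset_normalClosure
    have hsub : Subsingleton (L ≃ₐ[RatFunc k] L) := by
      refine card_galois_eq_one_of_tame p O hO ?_
      rw [← hI, Subgroup.card_map_of_injective e.injective]
      subst hG₁
      rw [Subgroup.card_eq_card_quotient_mul_card_subgroup ((⊥ : Subgroup G).subgroupOf G₀)]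
      simpa using htame
    have : Subsingleton G := e.toEquiv.subsingleton
    exact not_subsingleton G this
  · intro htop
    have hG₁ : G₁ ≠ ⊥ := by
      rintro rfl
      rw [Subgroup.normalClosure_eq_self] at htop
      exact bot_ne_top htop
    obtain ⟨m, hm, hG₀⟩ := card_of_normal_pSubgroup (not_sq_dvd_card_of_mulEquiv hp2 ε)
      (centralizer_le_of_mulEquiv hp2 ε) h₁₀ hnorm hp₁ hG₁
    obtain ⟨L, _, _, _, _, _, _, hE, ⟨η⟩, O, hO, hI⟩ := exists_cover_card_inertia k hp5 hmod hm
    have hmp : m < p := by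
      have := Nat.le_of_dvd (by lia) hm
      lia
    let e₀ : G ≃* (L ≃ₐ[RatFunc k] L) := ε.trans η.symm
    obtain ⟨g, hg⟩ := exists_conj_map_eq_of_card (not_sq_dvd_card_of_mulEquiv hp2 η)
      (centralizer_le_of_mulEquiv hp2 η) hmp (H := G₀.map e₀.toMonoidHom)
      ((Subgroup.card_map_of_injective e₀.injective).trans hG₀) hI
    refine ⟨L, _, _, _, ‹_›, ‹_›, ‹_›, hE, e₀.trans (MulAut.conj g), O, hO, ?_⟩
    rw [← hg, Subgroup.map_map]
    rfl
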